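/- Fix algebraic numbers a, b ∈ ℂ with a ≠ b and a, b ∉ {0,1}. Then the set of parameters t ∈ ℂ \ {0,1} for which both (a,1) and (b,1) are preperiodic for F_t is finite. (Dynamical reformulation of the Masser–Zannier theorem.) -/

import Mathlib

/-- The degree-4 homogeneous lift `F_{t₁,t₂}(z,w) = ((t₁w² − t₂z²)², 4t₂zw(w−z)(t₁w − t₂z))`
of the Lattès map `f_t(z) = (z²−t)²/(4z(z−1)(z−t))`. -/
def LattesLift (t₁ t₂ : ℂ) (p : ℂ × ℂ) : ℂ × ℂ :=
  ((t₁ * p.2 ^ 2 - t₂ * p.1 ^ 2) ^ 2,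
    4 * t₂ * p.1 * p.2 * (p.2 - p.1) * (t₁ * p.2 - t₂ * p.1))

/-- A point `(z,w) ∈ ℂ² \ {(0,0)}` is preperiodic for `F_t = F_{t,1}` if there are
`0 ≤ m < n` with the determinant of the matrix with rows `F_t^n(z,w)`, `F_t^m(z,w)` zero,
i.e. `(z:w) ∈ ℙ¹` is preperiodic for the Lattès map `f_t`. -/
def LattesPreperiodic (t : ℂ) (p : ℂ × ℂ) : Prop :=
  ∃ m n : ℕ, m < n ∧
    ((LattesLift t 1)^[n] p).1 * ((LattesLift t 1)^[m] p).2 -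
      ((LattesLift t 1)^[n] p).2 * ((LattesLift t 1)^[m] p).1 = 0

namespace Lattes

open Polynomial NumberField

/-- The homogeneous doubling map of the Legendre family over a commutative ring. -/
def step {R : Type*} [CommRing R] (t : R) (p : R × R) : R × R :=
  ((t * p.2 ^ 2 - p.1 ^ 2) ^ 2, 4 * p.1 * p.2 * (p.2 - p.1) * (t * p.2 - p.1))

/-- The `n`-th iterate of `(c, 1)` under `step t`. -/
def orbit {R : Type*} [CommRing R] (t c : R) : ℕ → R × R
  | 0 => (c, 1)
  | n + 1 => step t (orbit t c n)

/-- The numerator of the `n`-th iterate of `c`, as a polynomial in the parameter. -/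
noncomputable def num {R : Type*} [CommRing R] (c : R) (n : ℕ) : R[X] := (orbit X (C c) n).1

/-- The denominator of the `n`-th iterate of `c`, as a polynomial in the parameter. -/
noncomputable def den {R : Type*} [CommRing R] (c : R) (n : ℕ) : R[X] := (orbit X (C c) n).2

section Algebra

variable {R S : Type*} [CommRing R] [CommRing S]

lemma step_smul (t l : R) (p : R × R) : step t (l * p.1, l * p.2) =
    (l ^ 4 * (step t p).1, l ^ 4 * (step t p).2) := by
  simp only [step, Prod.mk.injEq]; constructor <;> ring

lemma orbit_map (φ : R →+* S) (t c : R) (n : ℕ) :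
    orbit (φ t) (φ c) n = (φ (orbit t c n).1, φ (orbit t c n).2) := by
  induction n with
  | zero => simp [orbit]
  | succ n ih => simp [orbit, ih, step, map_ofNat φ 4]

lemma eval_num (c t : R) (n : ℕ) : (num c n).eval t = (orbit t c n).1 := by
  have := orbit_map (evalRingHom t) X (C c) n
  simp only [coe_evalRingHom, eval_X, eval_C] at this
  rw [this]; rfl

lemma eval_den (c t : R) (n : ℕ) : (den c n).eval t = (orbit t c n).2 := by
  have := orbit_map (evalRingHom t) X (C c) n
  simp only [coe_evalRingHom, eval_X, eval_C] at this
  rw [this]; rfl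

lemma map_num (φ : R →+* S) (c : R) (n : ℕ) : (num c n).map φ = num (φ c) n := by
  have := orbit_map (mapRingHom φ) X (C c) n
  simp only [coe_mapRingHom, map_X, map_C] at this
  rw [num, num, this]

lemma map_den (φ : R →+* S) (c : R) (n : ℕ) : (den c n).map φ = den (φ c) n := by
  have := orbit_map (mapRingHom φ) X (C c) n
  simp only [coe_mapRingHom, map_X, map_C] at this
  rw [den, den, this]

lemma num_zero (c : R) : num c 0 = C c := rfl

lemma den_zero (c : R) : den c 0 = 1 := rfl

lemma num_succ (c : R) (n : ℕ) : num c (n + 1) = (X * den c n ^ 2 - num c n ^ 2) ^ 2 := rfl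

lemma den_succ (c : R) (n : ℕ) : den c (n + 1) =
    4 * num c n * den c n * (den c n - num c n) * (X * den c n - num c n) := rfl

lemma orbit_zero_param (c : R) (n : ℕ) : (orbit 0 c n).1 = c ^ 4 ^ n := by
  induction n with
  | zero => simp [orbit]
  | succ n ih => simp [orbit, step, ih]; ring

lemma orbit_one_param (c : R) (n : ℕ) :
    (orbit 1 c n).1 - (orbit 1 c n).2 = (c - 1) ^ 4 ^ n := by
  induction n with
  | zero => simp [orbit]
  | succ n ih =>
    rw [pow_succ, pow_mul, ← ih]; simp [orbit, step]; ring

lemma orbit_self_den (c : R) (n : ℕ) : (orbit c c (n + 1)).2 = 0 := by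
  induction n with
  | zero => simp [orbit, step]
  | succ n ih => rw [orbit, step, ih]; simp

lemma orbit_self_num (c : R) (n : ℕ) :
    (orbit c c (n + 1)).1 = ((c - c ^ 2) ^ 2) ^ 4 ^ n := by
  induction n with
  | zero => simp [orbit, step]
  | succ n ih =>
    rw [pow_succ 4, pow_mul, ← ih, orbit, step, orbit_self_den]; simp; ring

end Algebra

section Degree

variable {R : Type*} [CommRing R] [Nontrivial R]

lemma degree_num_den (c : R) (n : ℕ) : (num c (n + 1)).Monic ∧
    (num c (n + 1)).natDegree = 2 * 4 ^ n ∧ (den c (n + 1)).degree < ((2 * 4 ^ n : ℕ) : WithBot ℕ) := by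
  induction n with
  | zero =>
    have h1 : num c 1 = (X - C (c ^ 2)) ^ 2 := by
      rw [num_succ, num_zero, den_zero]; simp
    refine ⟨?_, ?_, ?_⟩
    · rw [h1]; exact (monic_X_sub_C _).pow 2
    · rw [h1, (monic_X_sub_C _).natDegree_pow, natDegree_X_sub_C]; simp
    · have h2 : den c 1 = C (4 * c * (1 - c)) * (X - C c) := by
        rw [den_succ, num_zero, den_zero]
        simp only [C_mul, C_sub, C_1, map_ofNat]; ring
      rw [h2]
      refine lt_of_le_of_lt (degree_mul_le _ _) ?_
      refine lt_of_le_of_lt (add_le_add_left degree_C_le _) ?_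
      rw [degree_X_sub_C]; norm_num
  | succ n ih =>
    obtain ⟨hm, hd, hlt⟩ := ih
    set A := num c (n + 1)
    set B := den c (n + 1)
    set D := 2 * 4 ^ n with hD
    have hDpos : 0 < D := by positivity
    have hBn : B.natDegree + 1 ≤ D := by
      by_cases hB : B = 0
      · rw [hB, natDegree_zero]; omega
      · rw [degree_eq_natDegree hB] at hlt
        exact_mod_cast hlt
    have hA2 : (A ^ 2).natDegree = 2 * D := by rw [hm.natDegree_pow, hd]
    have hA2m : (A ^ 2).Monic := hm.pow 2
    have hXB : (X * B ^ 2).natDegree ≤ 2 * D - 1 := by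
      have h1 := natDegree_mul_le (p := X) (q := B ^ 2)
      have h2 := natDegree_pow_le (p := B) (n := 2)
      have h3 := natDegree_X_le (R := R)
      omega
    have hdeg : (X * B ^ 2).degree < (A ^ 2).degree := by
      rw [degree_eq_natDegree hA2m.ne_zero, hA2]
      refine lt_of_le_of_lt degree_le_natDegree ?_
      exact_mod_cast (by omega)
    have hmon : (A ^ 2 - X * B ^ 2).Monic := hA2m.sub_of_left hdeg
    have hnd : (A ^ 2 - X * B ^ 2).natDegree = 2 * D := by
      rw [natDegree_sub_eq_left_of_natDegree_lt, hA2]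
      omega
    have hnum : num c (n + 1 + 1) = (A ^ 2 - X * B ^ 2) ^ 2 := by
      rw [num_succ]; ring
    refine ⟨?_, ?_, ?_⟩
    · rw [hnum]; exact hmon.pow 2
    · rw [hnum, hmon.natDegree_pow, hnd]; ring
    · rw [den_succ]
      refine lt_of_le_of_lt degree_le_natDegree ?_
      have e1 : (4 * A * B * (B - A) * (X * B - A)).natDegree ≤ 4 * D - 1 := by
        have h4 : (4 : R[X]).natDegree = 0 := by
          exact natDegree_ofNat 4
        have a1 := natDegree_mul_le (p := 4 * A * B * (B - A)) (q := X * B - A)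
        have a2 := natDegree_mul_le (p := 4 * A * B) (q := B - A)
        have a3 := natDegree_mul_le (p := 4 * A) (q := B)
        have a4 := natDegree_mul_le (p := 4) (q := A)
        have a5 := natDegree_sub_le B A
        have a6 := natDegree_sub_le (X * B) A
        have a7 := natDegree_mul_le (p := X) (q := B)
        have h3 := natDegree_X_le (R := R)
        rw [hd] at *
        omega
      have : (4 * A * B * (B - A) * (X * B - A)).natDegree < 2 * 4 ^ (n + 1) := by
        rw [pow_succ]; omega
      exact_mod_cast this

end Degree

section AbsoluteValue

variable {F : Type*} [Field F]

/-- The maximum of the absolute values of the two coordinates. -/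
noncomputable def nrm (v : AbsoluteValue F ℝ) (p : F × F) : ℝ := max (v p.1) (v p.2)

lemma nrm_nonneg (v : AbsoluteValue F ℝ) (p : F × F) : 0 ≤ nrm v p :=
  le_max_of_le_left (v.nonneg _)

lemma nrm_pos (v : AbsoluteValue F ℝ) {p : F × F} (hp : p ≠ 0) : 0 < nrm v p := by
  by_contra h
  have h1 : v p.1 ≤ 0 := (le_max_left _ _).trans (not_lt.1 h)
  have h2 : v p.2 ≤ 0 := (le_max_right _ _).trans (not_lt.1 h)
  apply hp
  ext
  · exact v.eq_zero.1 (le_antisymm h1 (v.nonneg _))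
  · exact v.eq_zero.1 (le_antisymm h2 (v.nonneg _))

lemma nrm_smul (v : AbsoluteValue F ℝ) (l : F) (p : F × F) :
    nrm v (l * p.1, l * p.2) = v l * nrm v p := by
  simp only [nrm, map_mul]
  rw [mul_max_of_nonneg _ _ (v.nonneg l)]

lemma nrm_one (v : AbsoluteValue F ℝ) (x : F) : nrm v (1, x) = max 1 (v x) := by
  simp [nrm]

lemma step_lower (v : AbsoluteValue F ℝ) {κ : ℝ} (hκ : 1 ≤ κ)
    (hv : ∀ x y, v (x + y) ≤ κ * max (v x) (v y)) (h2 : (2 : F) ≠ 0) {t : F} (ht0 : t ≠ 0)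
    (ht1 : t ≠ 1) (p : F × F) :
    nrm v p ^ 4 ≤ κ ^ 5 * (v 2)⁻¹ ^ 2 * max 1 (v t)⁻¹ ^ 2 * max 1 (v (1 - t))⁻¹ ^ 2 *
      max 1 (v t) * nrm v (step t p) := by
  obtain ⟨z, w⟩ := p
  set N := nrm v (step t (z, w)) with hN
  have hN0 : 0 ≤ N := nrm_nonneg _ _
  have hκ0 : 0 < κ := by linarith
  have hvs : ∀ x y, v (x - y) ≤ κ * max (v x) (v y) := fun x y => by
    rw [sub_eq_add_neg, ← v.map_neg y]; exact hv _ _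
  have v2 : 0 < v 2 := v.pos h2
  have vt : 0 < v t := v.pos ht0
  have v1t : 0 < v (1 - t) := v.pos (sub_ne_zero.2 (Ne.symm ht1))
  set a := max 1 (v t)⁻¹ with ha
  set b := max 1 (v (1 - t))⁻¹ with hb
  set T := max 1 (v t) with hT
  have ha1 : 1 ≤ a := le_max_left _ _
  have hb1 : 1 ≤ b := le_max_left _ _
  have hT1 : 1 ≤ T := le_max_left _ _
  set x := z ^ 2 - t * w ^ 2 with hx
  set y := z ^ 2 - 2 * z * w + t * w ^ 2 with hy
  set q := z ^ 2 - 2 * t * z * w + t * w ^ 2 with hq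
  set m := Real.sqrt (κ * T * N) with hm
  have hm0 : 0 ≤ m := Real.sqrt_nonneg _
  have hm2 : m ^ 2 = κ * T * N := Real.sq_sqrt (by positivity)
  have key : ∀ u : F, v (u ^ 2) ≤ κ * T * N → v u ≤ m := fun u hu => by
    apply Real.le_sqrt_of_sq_le
    rwa [← map_pow]
  have hN1 : v (step t (z, w)).1 ≤ N := le_max_left _ _
  have hN2 : v (step t (z, w)).2 ≤ N := le_max_right _ _
  have hTN : N ≤ T * N := le_mul_of_one_le_left hN0 hT1
  have hκTN : T * N ≤ κ * T * N := by
    rw [mul_assoc]; exact le_mul_of_one_le_left (by positivity) hκ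
  have mx : v x ≤ m := key x (by
    have : x ^ 2 = (step t (z, w)).1 := by simp [step, hx]; ring
    rw [this]; linarith)
  have my : v y ≤ m := key y (by
    have : y ^ 2 = (step t (z, w)).1 - (step t (z, w)).2 := by simp [step, hy]; ring
    rw [this, mul_assoc]
    refine (hvs _ _).trans (mul_le_mul_of_nonneg_left (max_le ?_ ?_) hκ0.le) <;> linarith)
  have mq : v q ≤ m := key q (by
    have : q ^ 2 = (step t (z, w)).1 - t * (step t (z, w)).2 := by simp [step, hq]; ring
    rw [this, mul_assoc]
    refine (hvs _ _).trans (mul_le_mul_of_nonneg_left (max_le ?_ ?_) hκ0.le)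
    · linarith
    · rw [map_mul]; exact mul_le_mul (le_max_right _ _) hN2 (v.nonneg _) (by positivity))
  have hzw : v (z * w) ≤ κ * m * (v 2)⁻¹ * b := by
    have e : z * w = (q - y) / (2 * (1 - t)) := by
      rw [eq_div_iff (mul_ne_zero h2 (sub_ne_zero.2 (Ne.symm ht1)))]; simp only [hq, hy]; ring
    have h1 : v (q - y) ≤ κ * m :=
      (hvs _ _).trans (mul_le_mul_of_nonneg_left (max_le mq my) hκ0.le)
    rw [e, map_div₀, map_mul, div_eq_mul_inv, mul_inv, ← mul_assoc]
    gcongr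
    exact le_max_right _ _
  have hcomb : ∀ u u' : F, v u ≤ m → v u' ≤ m → ∀ r : F, r = (u + u') / 2 + z * w →
      v r ≤ κ ^ 2 * m * (v 2)⁻¹ * b := fun u u' hu hu' r hr => by
    have h1 : v ((u + u') / 2) ≤ κ * m * (v 2)⁻¹ * b := by
      rw [map_div₀, div_eq_mul_inv]
      calc v (u + u') * (v 2)⁻¹ ≤ κ * m * (v 2)⁻¹ := by
            gcongr
            exact (hv _ _).trans (mul_le_mul_of_nonneg_left (max_le hu hu') hκ0.le)
        _ ≤ _ := le_mul_of_one_le_right (by positivity) hb1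
    rw [hr]
    refine (hv _ _).trans ?_
    calc κ * max _ _ ≤ κ * (κ * m * (v 2)⁻¹ * b) :=
          mul_le_mul_of_nonneg_left (max_le h1 hzw) hκ0.le
      _ = _ := by ring
  have hz2 : v (z ^ 2) ≤ κ ^ 2 * m * (v 2)⁻¹ * b :=
    hcomb x y mx my _ (by field_simp; simp only [hx, hy]; ring)
  have htw2 : v (t * w ^ 2) ≤ κ ^ 2 * m * (v 2)⁻¹ * b :=
    hcomb y (-x) my (by rwa [v.map_neg]) _ (by field_simp; simp only [hx, hy]; ring)
  have hw2 : v (w ^ 2) ≤ κ ^ 2 * m * (v 2)⁻¹ * b * (v t)⁻¹ := by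
    rw [map_mul] at htw2
    rw [← div_eq_mul_inv, le_div_iff₀ vt]; linarith
  have hs : nrm v (z, w) ^ 2 ≤ κ ^ 2 * m * (v 2)⁻¹ * b * a := by
    have h1 : v z ^ 2 ≤ κ ^ 2 * m * (v 2)⁻¹ * b * a := by
      rw [← map_pow]; exact hz2.trans (le_mul_of_one_le_right (by positivity) ha1)
    have h2 : v w ^ 2 ≤ κ ^ 2 * m * (v 2)⁻¹ * b * a := by
      rw [← map_pow]; refine hw2.trans ?_
      gcongr
      exact le_max_right _ _
    simp only [nrm]
    rcases max_cases (v z) (v w) with h | h <;> rw [h.1] <;> assumption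
  calc nrm v (z, w) ^ 4 = (nrm v (z, w) ^ 2) ^ 2 := by ring
    _ ≤ (κ ^ 2 * m * (v 2)⁻¹ * b * a) ^ 2 := by gcongr
    _ = κ ^ 4 * (v 2)⁻¹ ^ 2 * a ^ 2 * b ^ 2 * m ^ 2 := by ring
    _ = _ := by rw [hm2]; ring

lemma step_ne_zero {F : Type*} [Field F] (v : AbsoluteValue F ℝ) (h2 : (2 : F) ≠ 0) {t : F}
    (ht0 : t ≠ 0) (ht1 : t ≠ 1) {p : F × F} (hp : p ≠ 0) : step t p ≠ 0 := by
  intro h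
  have h1 := step_lower v (κ := 2) (by norm_num) (fun x y => by
    refine (v.add_le x y).trans ?_
    have := le_max_left (v x) (v y)
    have := le_max_right (v x) (v y)
    linarith) h2 ht0 ht1 p
  rw [h] at h1
  have h3 : nrm v (0 : F × F) = 0 := by simp [nrm]
  rw [h3, mul_zero] at h1
  have := pow_pos (nrm_pos v hp) 4
  linarith

lemma orbit_ne_zero {F : Type*} [Field F] (v : AbsoluteValue F ℝ) (h2 : (2 : F) ≠ 0) {t : F}
    (ht0 : t ≠ 0) (ht1 : t ≠ 1) (c : F) (n : ℕ) : orbit t c n ≠ 0 := by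
  induction n with
  | zero => simp [orbit, Prod.ext_iff]
  | succ n ih => exact step_ne_zero v h2 ht0 ht1 ih

end AbsoluteValue

lemma orbit_ne_zero' {c t : ℂ} (hc0 : c ≠ 0) (hc1 : c ≠ 1) (n : ℕ) : orbit t c n ≠ 0 := by
  by_cases h0 : t = 0
  · intro h
    have := orbit_zero_param c n
    rw [← h0, h] at this
    exact pow_ne_zero _ hc0 this.symm
  by_cases h1 : t = 1
  · intro h
    have := orbit_one_param c n
    rw [h1] at h
    rw [h] at this
    simp only [Prod.fst_zero, Prod.snd_zero, sub_zero] at this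
    exact pow_ne_zero _ (sub_ne_zero.2 hc1) this.symm
  exact orbit_ne_zero (NormedField.toAbsoluteValue ℂ) two_ne_zero h0 h1 c n

lemma isCoprime_num_den_complex {c : ℂ} (hc0 : c ≠ 0) (hc1 : c ≠ 1) (n : ℕ) :
    IsCoprime (num c n) (den c n) := by
  apply isCoprime_of_irreducible_dvd
  · rintro ⟨h1, h2⟩
    have h := orbit_ne_zero' (t := 0) hc0 hc1 n
    apply h
    rw [Prod.ext_iff, ← eval_num, ← eval_den, h1, h2]; simp
  · intro p hp h1 h2
    obtain ⟨t, ht⟩ := IsAlgClosed.exists_root p (degree_pos_of_irreducible hp).ne'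
    apply orbit_ne_zero' (t := t) hc0 hc1 n
    rw [Prod.ext_iff, ← eval_num, ← eval_den]
    exact ⟨ht.dvd h1, ht.dvd h2⟩

section Places

variable (L : Type*) [Field L] [NumberField L]

/-- Index set for the places of a number field: complex embeddings and finite places. -/
abbrev Pl := (L →+* ℂ) ⊕ FinitePlace L

variable {L}

/-- The absolute value attached to an index. -/
noncomputable def pabs : Pl L → AbsoluteValue L ℝ
  | Sum.inl σ => (NormedField.toAbsoluteValue ℂ).comp σ.injective
  | Sum.inr v => v.val

/-- The constant in the triangle inequality for `m` summands. -/
noncomputable def kap (w : Pl L) (m : ℕ) : ℝ := Sum.elim (fun _ => (m : ℝ)) (fun _ => 1) w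

/-- Summation of a function over all places. -/
noncomputable def psum (f : Pl L → ℝ) : ℝ :=
  ∑ σ : L →+* ℂ, f (Sum.inl σ) + ∑ᶠ v : FinitePlace L, f (Sum.inr v)

/-- A function on places vanishing at almost all finite places. -/
def Adm (f : Pl L → ℝ) : Prop := ∀ᶠ v : FinitePlace L in Filter.cofinite, f (Sum.inr v) = 0

lemma pabs_inl (σ : L →+* ℂ) (x : L) : pabs (Sum.inl σ) x = ‖σ x‖ := rfl

lemma pabs_inr (v : FinitePlace L) (x : L) : pabs (Sum.inr v) x = v x := rfl

lemma kap_pos (w : Pl L) {m : ℕ} (hm : 0 < m) : 1 ≤ kap w m := by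
  rcases w with σ | v
  · simpa [kap, Nat.one_le_iff_ne_zero, Nat.pos_iff_ne_zero] using hm
  · simp [kap]

lemma pabs_sum_le (w : Pl L) {ι : Type*} (s : Finset ι) (f : ι → L) {B : ℝ} (hB : 0 ≤ B)
    (hf : ∀ i ∈ s, pabs w (f i) ≤ B) {m : ℕ} (hm : s.card ≤ m) :
    pabs w (∑ i ∈ s, f i) ≤ kap w m * B := by
  rcases w with σ | v
  · calc pabs (Sum.inl σ) (∑ i ∈ s, f i) ≤ ∑ i ∈ s, pabs (Sum.inl σ) (f i) :=
          AbsoluteValue.sum_le _ _ _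
      _ ≤ s.card • B := Finset.sum_le_card_nsmul _ _ _ hf
      _ ≤ m * B := by
          rw [nsmul_eq_mul]; gcongr
  · simp only [kap, Sum.elim_inr, one_mul]
    clear hm
    induction s using Finset.cons_induction with
    | empty => simpa using hB
    | cons i s hi ih =>
      rw [Finset.sum_cons]
      refine (FinitePlace.add_le v _ _).trans (max_le ?_ ?_)
      · exact hf i (Finset.mem_cons_self _ _)
      · exact ih fun j hj => hf j (Finset.mem_cons_of_mem hj)

lemma pabs_add_le (w : Pl L) (x y : L) :
    pabs w (x + y) ≤ kap w 2 * max (pabs w x) (pabs w y) := by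
  have := pabs_sum_le w Finset.univ ![x, y] (B := max (pabs w x) (pabs w y))
    (le_max_of_le_left ((pabs w).nonneg _)) (fun i _ => by fin_cases i <;> simp) (m := 2) (by simp)
  simpa using this

lemma Adm.add {f g : Pl L → ℝ} (hf : Adm f) (hg : Adm g) : Adm (fun w => f w + g w) := by
  filter_upwards [hf, hg] with v h1 h2
  rw [h1, h2, add_zero]

lemma Adm.sub {f g : Pl L → ℝ} (hf : Adm f) (hg : Adm g) : Adm (fun w => f w - g w) := by
  filter_upwards [hf, hg] with v h1 h2
  rw [h1, h2, sub_zero]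

lemma Adm.const_mul {f : Pl L → ℝ} (hf : Adm f) (c : ℝ) : Adm (fun w => c * f w) := by
  filter_upwards [hf] with v h1
  rw [h1, mul_zero]

lemma Adm.sum {ι : Type*} (s : Finset ι) {f : ι → Pl L → ℝ} (hf : ∀ i ∈ s, Adm (f i)) :
    Adm (fun w => ∑ i ∈ s, f i w) := by
  have := (Filter.eventually_all_finset s).2 hf
  filter_upwards [this] with v h1
  exact Finset.sum_eq_zero h1

lemma psum_add {f g : Pl L → ℝ} (hf : Adm f) (hg : Adm g) :
    psum (fun w => f w + g w) = psum f + psum g := by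
  simp only [psum]
  rw [Finset.sum_add_distrib, finsum_add_distrib hf hg]
  ring

lemma psum_const_mul (f : Pl L → ℝ) (c : ℝ) :
    psum (fun w => c * f w) = c * psum f := by
  simp only [psum]
  rw [← Finset.mul_sum, ← mul_finsum]
  ring

lemma psum_sub {f g : Pl L → ℝ} (hf : Adm f) (hg : Adm g) :
    psum (fun w => f w - g w) = psum f - psum g := by
  have := psum_add hf (hg.const_mul (-1))
  rw [psum_const_mul] at this
  simp only [neg_mul, one_mul, ← sub_eq_add_neg] at this
  exact this

lemma psum_sum {ι : Type*} (s : Finset ι) {f : ι → Pl L → ℝ} (hf : ∀ i ∈ s, Adm (f i)) :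
    psum (fun w => ∑ i ∈ s, f i w) = ∑ i ∈ s, psum (f i) := by
  induction s using Finset.cons_induction with
  | empty => simp [psum]
  | cons i s hi ih =>
    simp only [Finset.sum_cons]
    rw [psum_add (hf i (Finset.mem_cons_self _ _))
      (Adm.sum s fun j hj => hf j (Finset.mem_cons_of_mem hj)),
      ih fun j hj => hf j (Finset.mem_cons_of_mem hj)]

lemma psum_nonneg {f : Pl L → ℝ} (hf : ∀ w, 0 ≤ f w) : 0 ≤ psum f :=
  add_nonneg (Finset.sum_nonneg fun _ _ => hf _) (finsum_nonneg fun _ => hf _)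

lemma psum_mono {f g : Pl L → ℝ} (hf : Adm f) (hg : Adm g) (h : ∀ w, f w ≤ g w) :
    psum f ≤ psum g := by
  have := psum_nonneg (f := fun w => g w - f w) fun w => sub_nonneg.2 (h w)
  rw [psum_sub hg hf] at this
  linarith

lemma adm_arch (c : ℝ) : Adm (L := L) (Sum.elim (fun _ => c) (fun _ => 0)) :=
  Filter.Eventually.of_forall fun _ => rfl

lemma psum_arch (c : ℝ) :
    psum (L := L) (Sum.elim (fun _ => c) (fun _ => 0)) = Module.finrank ℚ L * c := by
  simp only [psum, Sum.elim_inl, Sum.elim_inr, finsum_zero, add_zero, Finset.sum_const,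
    Finset.card_univ, NumberField.Embeddings.card, nsmul_eq_mul]

lemma log_kap (m : ℕ) : (fun w : Pl L => Real.log (kap w m)) =
    Sum.elim (fun _ => Real.log m) (fun _ => 0) := by
  ext w; rcases w with σ | v <;> simp [kap]

lemma eventually_eq_one (x : L) : ∀ᶠ v : FinitePlace L in Filter.cofinite, x = 0 ∨ v x = 1 := by
  by_cases hx : x = 0
  · exact Filter.Eventually.of_forall fun _ => Or.inl hx
  · have : ∀ᶠ v : FinitePlace L in Filter.cofinite, v x = 1 :=
      FinitePlace.hasFiniteMulSupport hx
    filter_upwards [this] with v hv using Or.inr hv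

lemma adm_log (x : L) : Adm (fun w => Real.log (pabs w x)) := by
  filter_upwards [eventually_eq_one x] with v hv
  rcases hv with rfl | h
  · simp
  · rw [pabs_inr, h, Real.log_one]

lemma psum_log {x : L} (hx : x ≠ 0) : psum (fun w => Real.log (pabs w x)) = 0 := by
  have h1 : ∑ᶠ v : FinitePlace L, Real.log (v x) = Real.log (∏ᶠ v : FinitePlace L, v x) :=
    (Real.log_finprod fun v => FinitePlace.pos_iff.2 hx).symm
  have h2 : ∏ σ : L →+* ℂ, ‖σ x‖ = |(Algebra.norm ℚ x : ℝ)| := by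
    have h3 := Algebra.norm_eq_prod_embeddings ℚ ℂ x
    have h4 : ∏ σ : L →+* ℂ, σ x = ∏ σ : L →ₐ[ℚ] ℂ, σ x :=
      Fintype.prod_equiv (RingHom.equivRatAlgHom L ℂ) _ _ fun _ => rfl
    rw [← norm_prod, h4, ← h3]
    simp only [eq_ratCast]
    rw [← Complex.ofReal_ratCast, Complex.norm_real, Real.norm_eq_abs]
  have h5 : ∑ σ : L →+* ℂ, Real.log ‖σ x‖ = Real.log (∏ σ : L →+* ℂ, ‖σ x‖) :=
    (Real.log_prod fun σ _ => norm_ne_zero_iff.2 (by simpa using hx)).symm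
  simp only [psum, pabs_inl, pabs_inr]
  rw [h1, h5, h2, FinitePlace.prod_eq_inv_abs_norm hx]
  simp

lemma adm_log_nrm {p : L × L} (hp : p ≠ 0) : Adm (fun w => Real.log (nrm (pabs w) p)) := by
  filter_upwards [eventually_eq_one p.1, eventually_eq_one p.2] with v h1 h2
  have : nrm (pabs (Sum.inr v)) p = 1 := by
    simp only [nrm, pabs_inr]
    rcases h1 with h1 | h1 <;> rcases h2 with h2 | h2
    · exact absurd (Prod.ext h1 h2) hp
    · simp [h1, h2]
    · simp [h1, h2]
    · simp [h1, h2]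
  rw [this, Real.log_one]

/-- The unnormalised height of a nonzero vector. -/
noncomputable def ht (p : L × L) : ℝ := psum (fun w => Real.log (nrm (pabs w) p))

lemma ht_smul {l : L} (hl : l ≠ 0) {p : L × L} (hp : p ≠ 0) : ht (l * p.1, l * p.2) = ht p := by
  have h : (fun w : Pl L => Real.log (nrm (pabs w) (l * p.1, l * p.2))) =
      fun w => Real.log (pabs w l) + Real.log (nrm (pabs w) p) := by
    ext w
    rw [nrm_smul, Real.log_mul ((pabs w).pos hl).ne' (nrm_pos _ hp).ne']
  rw [ht, h, psum_add (adm_log l) (adm_log_nrm hp), psum_log hl, zero_add, ht]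

lemma one_ne_zero_pair (x : L) : ((1, x) : L × L) ≠ 0 := by simp [Prod.ext_iff]

lemma adm_max (x : L) : Adm (fun w => Real.log (max 1 (pabs w x))) := by
  have := adm_log_nrm (one_ne_zero_pair x)
  simpa only [nrm_one] using this

lemma ht_one (x : L) : ht (1, x) = psum (fun w => Real.log (max 1 (pabs w x))) := by
  simp only [ht, nrm_one]

lemma ht_inv {x : L} (hx : x ≠ 0) : ht (1, x⁻¹) = ht (1, x) := by
  rw [← ht_smul hx (one_ne_zero_pair x⁻¹)]
  have : ht ((x * (1, x⁻¹).1, x * (1, x⁻¹).2) : L × L) = ht (x, 1) := by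
    simp [mul_inv_cancel₀ hx]
  rw [this]
  simp only [ht, nrm, max_comm]

lemma ht_one_sub (x : L) : ht (1, 1 - x) ≤ ht (1, x) + Module.finrank ℚ L * Real.log 2 := by
  have e := psum_arch (L := L) (Real.log (2 : ℕ))
  rw [← log_kap] at e
  rw [ht_one, ht_one]
  rw [Nat.cast_ofNat] at e
  have ha : Adm (fun w : Pl L => Real.log (kap w 2)) := by rw [log_kap]; exact adm_arch _
  rw [← e, ← psum_add (adm_max x) ha]
  refine psum_mono (adm_max _) ((adm_max x).add ha) fun w => ?_
  have hk : 1 ≤ kap w 2 := kap_pos w (by norm_num)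
  rw [← Real.log_mul (by positivity) (by positivity)]
  apply Real.log_le_log (by positivity)
  have h1 := pabs_add_le w 1 (-x)
  rw [← sub_eq_add_neg, (pabs w).map_neg, map_one] at h1
  refine max_le ?_ (by linarith)
  have : 1 ≤ max 1 (pabs w x) := le_max_left _ _
  nlinarith

lemma psum_ge_embeddings {K : Type*} [Field K] [Algebra K L] [Algebra K ℂ]
    [Fintype (L →ₐ[K] ℂ)] {f : Pl L → ℝ} (hf : ∀ w, 0 ≤ f w) :
    ∑ τ : L →ₐ[K] ℂ, f (Sum.inl (τ : L →+* ℂ)) ≤ psum f := by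
  classical
  have hinj : Function.Injective (fun τ : L →ₐ[K] ℂ => (τ : L →+* ℂ)) :=
    AlgHom.coe_ringHom_injective
  have h1 : ∑ τ : L →ₐ[K] ℂ, f (Sum.inl (τ : L →+* ℂ)) =
      ∑ σ ∈ Finset.univ.image (fun τ : L →ₐ[K] ℂ => (τ : L →+* ℂ)), f (Sum.inl σ) := by
    rw [Finset.sum_image fun x _ y _ h => hinj h]
  rw [h1, psum]
  have h2 : 0 ≤ ∑ᶠ v : FinitePlace L, f (Sum.inr v) := finsum_nonneg fun _ => hf _
  have h3 := Finset.sum_le_sum_of_subset_of_nonneg (Finset.subset_univ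
    (Finset.univ.image (fun τ : L →ₐ[K] ℂ => (τ : L →+* ℂ))))
    (f := fun σ => f (Sum.inl σ)) (fun _ _ _ => hf _)
  linarith

end Places

lemma ht_algebraMap_le {K : Type} [Field K] [NumberField K] (x : K) :
    ∃ C : ℝ, 0 ≤ C ∧ ∀ (L : Type) [Field L] [NumberField L] [Algebra K L],
      ht (1, algebraMap K L x) ≤ C * Module.finrank ℚ L := by
  have hx : IsAlgebraic ℤ x := (IsFractionRing.isAlgebraic_iff ℤ ℚ K).2 (Algebra.IsAlgebraic.isAlgebraic x)
  obtain ⟨m, hm, hmx⟩ := hx.exists_integral_multiple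
  set B : ℝ := 1 + ∑ σ : K →+* ℂ, ‖σ x‖ with hB
  have hB1 : 1 ≤ B := by
    have : 0 ≤ ∑ σ : K →+* ℂ, ‖σ x‖ := Finset.sum_nonneg fun _ _ => norm_nonneg _
    linarith
  have hm1 : (1 : ℝ) ≤ |(m : ℝ)| := by exact_mod_cast Int.one_le_abs hm
  refine ⟨Real.log B + Real.log |(m : ℝ)|,
    add_nonneg (Real.log_nonneg hB1) (Real.log_nonneg hm1), fun L _ _ _ => ?_⟩
  have hmL : (m : L) ≠ 0 := by exact_mod_cast hm
  have e := psum_sub (adm_arch (L := L) (Real.log B + Real.log |(m : ℝ)|)) (adm_log (m : L))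
  rw [psum_log hmL, psum_arch, sub_zero, mul_comm] at e
  rw [← e, ht_one]
  refine psum_mono (adm_max _) ((adm_arch _).sub (adm_log _)) fun w => ?_
  rcases w with σ | v
  · simp only [Sum.elim_inl, pabs_inl, map_intCast, Complex.norm_intCast]
    rw [add_sub_cancel_right]
    apply Real.log_le_log (by positivity)
    refine max_le hB1 ?_
    have := Finset.single_le_sum (f := fun σ : K →+* ℂ => ‖σ x‖) (fun _ _ => norm_nonneg _)
      (Finset.mem_univ (σ.comp (algebraMap K L)))
    simp only [RingHom.comp_apply] at this
    linarith
  · simp only [Sum.elim_inr, pabs_inr, zero_sub]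
    have hint : ∀ y : L, IsIntegral ℤ y → v y ≤ 1 := fun y hy => by
      rw [← FinitePlace.norm_embedding_eq]
      exact FinitePlace.norm_le_one L v.maximalIdeal (⟨y, hy⟩ : 𝓞 L)
    have hvm : 0 < v (m : L) := FinitePlace.pos_iff.2 hmL
    have h1 : v (m : L) ≤ 1 := hint _ (isIntegral_algebraMap (R := ℤ) (x := m))
    have h2 : v ((m : L) * algebraMap K L x) ≤ 1 := by
      apply hint
      have := hmx.map (IsScalarTower.toAlgHom ℤ K L)
      simpa [zsmul_eq_mul] using this
    rw [← Real.log_inv]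
    apply Real.log_le_log (by positivity)
    refine max_le ((one_le_inv₀ hvm).2 h1) ?_
    rw [map_mul] at h2
    rw [← one_div, le_div_iff₀ hvm]
    linarith

section OrbitHeight

variable {L : Type*} [Field L] [NumberField L]

lemma ht_step {t : L} (ht0 : t ≠ 0) (ht1 : t ≠ 1) {p : L × L} (hp : p ≠ 0) :
    4 * ht p ≤ ht (step t p) + (7 * (Module.finrank ℚ L * Real.log 2) + 5 * ht (1, t)) := by
  have h1t : 1 - t ≠ 0 := sub_ne_zero.2 (Ne.symm ht1)
  have hv2 : (2 : L) ≠ 0 := two_ne_zero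
  have hs : step t p ≠ 0 := step_ne_zero (pabs (Sum.inl (Classical.arbitrary (L →+* ℂ)))) hv2 ht0 ht1 hp
  have hk := psum_arch (L := L) (Real.log (2 : ℕ))
  rw [← log_kap, Nat.cast_ofNat] at hk
  have hka : Adm (fun w : Pl L => Real.log (kap w 2)) := by rw [log_kap]; exact adm_arch _
  have a1 := hka.const_mul 5
  have a2 := (adm_log (2 : L)).const_mul (-2)
  have a3 := (adm_max t⁻¹).const_mul 2
  have a4 := (adm_max (1 - t)⁻¹).const_mul 2
  have a5 := adm_max t
  have a6 := adm_log_nrm hs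
  have key : psum (fun w : Pl L => 4 * Real.log (nrm (pabs w) p)) ≤
      psum (fun w : Pl L => 5 * Real.log (kap w 2) + -2 * Real.log (pabs w 2) +
        2 * Real.log (max 1 (pabs w t⁻¹)) + 2 * Real.log (max 1 (pabs w (1 - t)⁻¹)) +
        Real.log (max 1 (pabs w t)) + Real.log (nrm (pabs w) (step t p))) := by
    refine psum_mono ((adm_log_nrm hp).const_mul 4)
      (((((a1.add a2).add a3).add a4).add a5).add a6) fun w => ?_
    have h := step_lower (pabs w) (kap_pos w (by norm_num : 0 < 2)) (pabs_add_le w) hv2 ht0 ht1 p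
    have p1 : 0 < kap w 2 := lt_of_lt_of_le one_pos (kap_pos w (by norm_num))
    have p2 : 0 < pabs w 2 := (pabs w).pos hv2
    have p3 : 0 < nrm (pabs w) (step t p) := nrm_pos _ hs
    have p4 : 0 < nrm (pabs w) p := nrm_pos _ hp
    rw [← map_inv₀ (pabs w) t, ← map_inv₀ (pabs w) (1 - t)] at h
    have p5 : 0 < max 1 (pabs w t⁻¹) := lt_max_of_lt_left one_pos
    have p6 : 0 < max 1 (pabs w (1 - t)⁻¹) := lt_max_of_lt_left one_pos
    have p7 : 0 < max 1 (pabs w t) := lt_max_of_lt_left one_pos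
    have h' := Real.log_le_log (by positivity) h
    rw [Real.log_mul (by positivity) (by positivity), Real.log_mul (by positivity) (by positivity),
      Real.log_mul (by positivity) (by positivity), Real.log_mul (by positivity) (by positivity),
      Real.log_mul (by positivity) (by positivity)] at h'
    simp only [Real.log_pow, Real.log_inv] at h'
    push_cast at h'
    linarith
  rw [psum_const_mul, psum_add ((((a1.add a2).add a3).add a4).add a5) a6,
    psum_add (((a1.add a2).add a3).add a4) a5, psum_add ((a1.add a2).add a3) a4,
    psum_add (a1.add a2) a3, psum_add a1 a2, psum_const_mul, psum_const_mul, psum_const_mul,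
    psum_const_mul, psum_log hv2, hk, ← ht_one, ← ht_one, ← ht_one, ht_inv ht0, ht_inv h1t] at key
  have := ht_one_sub t
  simp only [ht] at *
  linarith

lemma le_of_growth_of_periodic {u : ℕ → ℝ} {C : ℝ} (hu : ∀ j, 4 * u j ≤ u (j + 1) + C)
    {m p : ℕ} (hp : 0 < p) (hper : ∀ k, u (m + k + p) = u (m + k)) (j : ℕ) : 3 * u j ≤ C := by
  by_contra! h
  have h1 : ∀ k, C < 3 * u (j + k) := fun k => by
    induction k with
    | zero => exact h
    | succ k ih => have := hu (j + k); rw [← add_assoc]; linarith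
  have h2 : ∀ k, u (j + k) < u (j + (k + 1)) := fun k => by
    have := hu (j + k); have := h1 k; rw [← add_assoc]; linarith
  have h3 : StrictMono fun k => u (j + k) := strictMono_nat_of_lt_succ h2
  have h4 : u (j + m) < u (j + (m + p)) := h3 (by omega)
  have h5 := hper j
  rw [add_comm j m, show j + (m + p) = m + j + p by ring, h5] at h4
  exact lt_irrefl _ h4

lemma ht_orbit_le {t c : L} (ht0 : t ≠ 0) (ht1 : t ≠ 1)
    (hper : ∃ m n : ℕ, m < n ∧ (orbit t c n).1 * (orbit t c m).2 -
      (orbit t c n).2 * (orbit t c m).1 = 0) (j : ℕ) :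
    3 * ht (orbit t c j) ≤ 7 * (Module.finrank ℚ L * Real.log 2) + 5 * ht (1, t) := by
  obtain ⟨m, n, hmn, hdet⟩ := hper
  have hne : ∀ k, orbit t c k ≠ 0 := fun k =>
    orbit_ne_zero (pabs (Sum.inl (Classical.arbitrary (L →+* ℂ)))) two_ne_zero ht0 ht1 c k
  have hbase : ∃ l : L, l ≠ 0 ∧ orbit t c n = (l * (orbit t c m).1, l * (orbit t c m).2) := by
    have hn := hne n
    have hm := hne m
    revert hn hm hdet
    generalize orbit t c n = P
    generalize orbit t c m = Q
    obtain ⟨x, y⟩ := P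
    obtain ⟨z, w⟩ := Q
    intro hdet hn hm
    simp only at hdet ⊢
    have hl : ∀ l : L, ((x, y) : L × L) = (l * z, l * w) → l ≠ 0 := by
      rintro l hl rfl
      apply hn; rw [hl]; simp
    by_cases hz : z = 0
    · have hw : w ≠ 0 := fun hw => hm (by simp [hz, hw])
      have : ((x, y) : L × L) = (y / w * z, y / w * w) := by
        rw [hz] at hdet ⊢
        have : x * w = 0 := by linear_combination hdet
        have : x = 0 := by simpa [hw] using this
        rw [this]; field_simp; simp
      exact ⟨_, hl _ this, this⟩
    · have : ((x, y) : L × L) = (x / z * z, x / z * w) := by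
        refine Prod.ext ?_ ?_
        · simp only; field_simp
        · simp only; field_simp; linear_combination -hdet
      exact ⟨_, hl _ this, this⟩
  have hall : ∀ k, ∃ l : L, l ≠ 0 ∧ orbit t c (n + k) =
      (l * (orbit t c (m + k)).1, l * (orbit t c (m + k)).2) := fun k => by
    induction k with
    | zero => exact hbase
    | succ k ih =>
      obtain ⟨l, hl, h⟩ := ih
      refine ⟨l ^ 4, pow_ne_zero _ hl, ?_⟩
      rw [← add_assoc, ← add_assoc, orbit, orbit, h, step_smul]
  refine le_of_growth_of_periodic (u := fun j => ht (orbit t c j)) (m := m) (p := n - m)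
    (fun j => ht_step ht0 ht1 (hne j)) (by omega) (fun k => ?_) j
  obtain ⟨l, hl, h⟩ := hall k
  have e : m + k + (n - m) = n + k := by omega
  simp only [e]
  rw [h, ht_smul hl (hne _)]

end OrbitHeight

section Bezout

variable {F : Type*} [Field F]

lemma exists_bezout {A B G : F[X]} {D : ℕ} (hA : A.Monic) (hD : A.natDegree = D) (hD0 : 0 < D)
    (hB : B.natDegree < D) (hAB : IsCoprime A B) (hG : G.natDegree ≤ 2 * D - 1) :
    ∃ U V : F[X], U.natDegree < D ∧ V.natDegree < D ∧ U * A + V * B = G := by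
  obtain ⟨U0, V0, h⟩ := hAB
  have hV : ((G * V0) %ₘ A).natDegree < D := by
    rw [← hD]
    exact natDegree_modByMonic_lt _ hA (fun h => by rw [h, natDegree_one] at hD; omega)
  have hdvd : A ∣ G - (G * V0) %ₘ A * B := by
    refine ⟨G * U0 + (G * V0) /ₘ A * B, ?_⟩
    have := modByMonic_add_div (G * V0) A
    linear_combination -G * h - B * this
  refine ⟨(G - (G * V0) %ₘ A * B) /ₘ A, (G * V0) %ₘ A, ?_, hV, ?_⟩
  · rw [natDegree_divByMonic _ hA, hD]
    have h1 := natDegree_sub_le G ((G * V0) %ₘ A * B)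
    have h2 := natDegree_mul_le (p := (G * V0) %ₘ A) (q := B)
    have := max_le (c := 2 * D - 1) hG (show ((G * V0) %ₘ A * B).natDegree ≤ 2 * D - 1 by omega)
    omega
  · have h1 := modByMonic_add_div (G - (G * V0) %ₘ A * B) A
    rw [(modByMonic_eq_zero_iff_dvd hA).2 hdvd, zero_add] at h1
    linear_combination h1

/-- `k m` is a valid constant in the triangle inequality for `m` summands. -/
def SumBd (v : AbsoluteValue F ℝ) (k : ℕ → ℝ) : Prop :=
  ∀ (s : Finset ℕ) (f : ℕ → F) (B : ℝ), 0 ≤ B → (∀ i ∈ s, v (f i) ≤ B) → ∀ m : ℕ, s.card ≤ m →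
    v (∑ i ∈ s, f i) ≤ k m * B

lemma SumBd.add {v : AbsoluteValue F ℝ} {k : ℕ → ℝ} (hk : SumBd v k) (x y : F) {B : ℝ}
    (hB : 0 ≤ B) (hx : v x ≤ B) (hy : v y ≤ B) : v (x + y) ≤ k 2 * B := by
  have := hk (Finset.range 2) (fun i => if i = 0 then x else y) B hB
    (fun i _ => by split_ifs <;> assumption) 2 (by simp)
  simpa [Finset.sum_range_succ] using this

lemma eval_bound {v : AbsoluteValue F ℝ} {k : ℕ → ℝ} (hk : SumBd v k) {U : F[X]} {D : ℕ}
    (hU : U.natDegree < D) {M : ℝ} (hM0 : 0 ≤ M) (hM : ∀ j < D, v (U.coeff j) ≤ M) (t : F) :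
    v (U.eval t) ≤ k D * (M * max 1 (v t) ^ (D - 1)) := by
  rw [eval_eq_sum_range' hU]
  refine hk _ _ _ (by positivity) (fun i hi => ?_) D (by simp)
  have hi' := Finset.mem_range.1 hi
  rw [map_mul, map_pow]
  refine mul_le_mul (hM i hi') ?_ (by positivity) hM0
  calc v t ^ i ≤ max 1 (v t) ^ i := by gcongr; exact le_max_right _ _
    _ ≤ _ := pow_le_pow_right₀ (le_max_left _ _) (by omega)

lemma lower_of_bezout {v : AbsoluteValue F ℝ} {k : ℕ → ℝ} (hk : SumBd v k)
    {A B U V U' V' : F[X]} {D : ℕ} (hD0 : 0 < D) (hkD : 0 ≤ k D)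
    (hU : U.natDegree < D) (hV : V.natDegree < D) (hU' : U'.natDegree < D)
    (hV' : V'.natDegree < D) (h : U * A + V * B = 1) (h' : U' * A + V' * B = X ^ (2 * D - 1))
    {M : ℝ} (hM0 : 0 ≤ M)
    (hM : ∀ j < D, v (U.coeff j) ≤ M ∧ v (V.coeff j) ≤ M ∧ v (U'.coeff j) ≤ M ∧ v (V'.coeff j) ≤ M)
    (t : F) : max 1 (v t) ^ D ≤ k 2 * (k D * M) * nrm v (A.eval t, B.eval t) := by
  set S := max 1 (v t) with hS
  have hS1 : 1 ≤ S := le_max_left _ _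
  set N := nrm v (A.eval t, B.eval t) with hN
  have hN0 : 0 ≤ N := nrm_nonneg _ _
  have hcomb : ∀ P Q : F[X], P.natDegree < D → Q.natDegree < D → (∀ j < D, v (P.coeff j) ≤ M) →
      (∀ j < D, v (Q.coeff j) ≤ M) →
      v ((P * A + Q * B).eval t) ≤ k 2 * (k D * (M * S ^ (D - 1)) * N) := by
    intro P Q hP hQ hPM hQM
    rw [eval_add, eval_mul, eval_mul]
    refine hk.add _ _ (by positivity) ?_ ?_ <;> rw [map_mul]
    · exact mul_le_mul (eval_bound hk hP hM0 hPM t) (le_max_left _ _) (v.nonneg _) (by positivity)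
    · exact mul_le_mul (eval_bound hk hQ hM0 hQM t) (le_max_right _ _) (v.nonneg _) (by positivity)
  have c1 := hcomb U V hU hV (fun j hj => (hM j hj).1) (fun j hj => (hM j hj).2.1)
  have c2 := hcomb U' V' hU' hV' (fun j hj => (hM j hj).2.2.1) (fun j hj => (hM j hj).2.2.2)
  rw [h, eval_one, map_one] at c1
  rw [h', eval_pow, eval_X, map_pow] at c2
  have hmax : S ^ (2 * D - 1) ≤ k 2 * (k D * (M * S ^ (D - 1)) * N) := by
    rcases max_cases 1 (v t) with hc | hc
    · have : S = 1 := hc.1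
      rw [this] at c1 ⊢; simpa using c1
    · have : S = v t := hc.1
      rw [this] at c2 ⊢; exact c2
  have e : S ^ (2 * D - 1) = S ^ D * S ^ (D - 1) := by rw [← pow_add]; congr 1; omega
  rw [e] at hmax
  have hpos : 0 < S ^ (D - 1) := by positivity
  refine le_of_mul_le_mul_right (hmax.trans (le_of_eq ?_)) hpos
  ring

end Bezout

lemma sumBd_pabs {L : Type*} [Field L] [NumberField L] (w : Pl L) : SumBd (pabs w) (kap w) :=
  fun s f _ hB hf _ hm => pabs_sum_le w s f hB hf hm

lemma sumBd_complex : SumBd (NormedField.toAbsoluteValue ℂ) (fun m => (m : ℝ)) := by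
  intro s f B hB hf m hm
  calc _ ≤ ∑ i ∈ s, NormedField.toAbsoluteValue ℂ (f i) := AbsoluteValue.sum_le _ _ _
      _ ≤ s.card • B := Finset.sum_le_card_nsmul _ _ _ hf
      _ ≤ m * B := by
          rw [nsmul_eq_mul]; gcongr

lemma exists_lower_complex {A B : ℂ[X]} {D : ℕ} (hA : A.Monic) (hD : A.natDegree = D)
    (hD0 : 0 < D) (hB : B.natDegree < D) (hAB : IsCoprime A B) :
    ∃ κ : ℝ, 0 < κ ∧ ∀ z : ℂ, max 1 ‖z‖ ^ D ≤ κ * max ‖A.eval z‖ ‖B.eval z‖ := by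
  obtain ⟨U, V, hU, hV, h⟩ := exists_bezout (G := 1) hA hD hD0 hB hAB (by simp)
  obtain ⟨U', V', hU', hV', h'⟩ := exists_bezout (G := X ^ (2 * D - 1)) hA hD hD0 hB hAB (by simp)
  set M : ℝ := 1 + ∑ j ∈ Finset.range D,
    (‖U.coeff j‖ + ‖V.coeff j‖ + ‖U'.coeff j‖ + ‖V'.coeff j‖) with hM
  have hMj : ∀ j < D, ‖U.coeff j‖ + ‖V.coeff j‖ + ‖U'.coeff j‖ + ‖V'.coeff j‖ + 1 ≤ M := by
    intro j hj
    have := Finset.single_le_sum (f := fun j => ‖U.coeff j‖ + ‖V.coeff j‖ + ‖U'.coeff j‖ +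
      ‖V'.coeff j‖) (fun _ _ => by positivity) (Finset.mem_range.2 hj)
    linarith
  have hM1 : 0 < M := by
    have : 0 ≤ ∑ j ∈ Finset.range D,
      (‖U.coeff j‖ + ‖V.coeff j‖ + ‖U'.coeff j‖ + ‖V'.coeff j‖) :=
      Finset.sum_nonneg fun _ _ => by positivity
    linarith
  refine ⟨2 * (D * M), by positivity, fun z => ?_⟩
  have := lower_of_bezout sumBd_complex hD0 (by positivity) hU hV hU' hV' h h'
    hM1.le (fun j hj => by
      have := hMj j hj
      have a1 := norm_nonneg (U.coeff j)
      have a2 := norm_nonneg (V.coeff j)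
      have a3 := norm_nonneg (U'.coeff j)
      have a4 := norm_nonneg (V'.coeff j)
      exact ⟨show ‖U.coeff j‖ ≤ M by linarith, show ‖V.coeff j‖ ≤ M by linarith,
        show ‖U'.coeff j‖ ≤ M by linarith, show ‖V'.coeff j‖ ≤ M by linarith⟩) z
  exact_mod_cast this

/-- A uniform lower bound for a coprime pair over all places of all extensions. -/
lemma exists_lower {K : Type} [Field K] [NumberField K] {A B : K[X]} {D : ℕ} (hA : A.Monic)
    (hD : A.natDegree = D) (hD0 : 0 < D) (hB : B.natDegree < D) (hAB : IsCoprime A B) :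
    ∃ C : ℝ, 0 ≤ C ∧ ∀ (L : Type) [Field L] [NumberField L] [Algebra K L],
      ∃ κ : Pl L → ℝ, (∀ w, 1 ≤ κ w) ∧ Adm (fun w => Real.log (κ w)) ∧
        psum (fun w => Real.log (κ w)) ≤ C * Module.finrank ℚ L ∧
        ∀ (w : Pl L) (t : L), max 1 (pabs w t) ^ D ≤ κ w *
          nrm (pabs w) (aeval t A, aeval t B) := by
  obtain ⟨U, V, hU, hV, h⟩ := exists_bezout (G := 1) hA hD hD0 hB hAB (by simp)
  obtain ⟨U', V', hU', hV', h'⟩ := exists_bezout (G := X ^ (2 * D - 1)) hA hD hD0 hB hAB (by simp)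
  classical
  set S : Finset K := (Finset.range D).image U.coeff ∪ (Finset.range D).image V.coeff ∪
    (Finset.range D).image U'.coeff ∪ (Finset.range D).image V'.coeff with hS
  choose C hC0 hC using fun x : K => ht_algebraMap_le x
  have hl2 : 0 ≤ Real.log 2 := Real.log_nonneg (by norm_num)
  have hlD : 0 ≤ Real.log D := Real.log_natCast_nonneg D
  refine ⟨Real.log 2 + Real.log D + ∑ x ∈ S, C x, ?_, fun L _ _ _ => ?_⟩
  · have : 0 ≤ ∑ x ∈ S, C x := Finset.sum_nonneg fun x _ => hC0 x
    linarith
  set M : Pl L → ℝ := fun w => ∏ x ∈ S, max 1 (pabs w (algebraMap K L x)) with hM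
  have hM1 : ∀ w, 1 ≤ M w := fun w => Finset.one_le_prod fun _ _ => le_max_left _ _
  have hk2 : ∀ w : Pl L, 1 ≤ kap w 2 := fun w => kap_pos w (by norm_num)
  have hkD : ∀ w : Pl L, 1 ≤ kap w D := fun w => kap_pos w hD0
  have hlog : (fun w : Pl L => Real.log (kap w 2 * (kap w D * M w))) = fun w =>
      Real.log (kap w 2) + (Real.log (kap w D) +
        ∑ x ∈ S, Real.log (max 1 (pabs w (algebraMap K L x)))) := by
    ext w
    have h1 := hk2 w
    have h2 := hkD w
    have h3 := hM1 w
    rw [Real.log_mul (by positivity) (by positivity), Real.log_mul (by positivity) (by positivity),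
      Real.log_prod fun x _ => (lt_max_of_lt_left one_pos).ne']
  have a1 : Adm (fun w : Pl L => Real.log (kap w 2)) := by rw [log_kap]; exact adm_arch _
  have a2 : Adm (fun w : Pl L => Real.log (kap w D)) := by rw [log_kap]; exact adm_arch _
  have a3 : Adm (fun w : Pl L => ∑ x ∈ S, Real.log (max 1 (pabs w (algebraMap K L x)))) :=
    Adm.sum S fun x _ => adm_max _
  refine ⟨fun w => kap w 2 * (kap w D * M w), fun w => ?_, ?_, ?_, fun w t => ?_⟩
  · exact one_le_mul_of_one_le_of_one_le (hk2 w)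
      (one_le_mul_of_one_le_of_one_le (hkD w) (hM1 w))
  · rw [hlog]; exact a1.add (a2.add a3)
  · rw [hlog, psum_add a1 (a2.add a3), psum_add a2 a3, psum_sum S fun x _ => adm_max _, log_kap,
      log_kap, psum_arch, psum_arch]
    have : ∑ x ∈ S, psum (fun w => Real.log (max 1 (pabs w (algebraMap K L x)))) ≤
        (∑ x ∈ S, C x) * Module.finrank ℚ L := by
      rw [Finset.sum_mul]
      refine Finset.sum_le_sum fun x _ => ?_
      rw [← ht_one]; exact hC x L
    push_cast
    nlinarith
  · have hcoef : ∀ x ∈ S, pabs w (algebraMap K L x) ≤ M w := fun x hx => by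
      have h1 : ∀ y ∈ S, 1 ≤ max 1 (pabs w (algebraMap K L y)) := fun _ _ => le_max_left _ _
      calc pabs w (algebraMap K L x) ≤ max 1 (pabs w (algebraMap K L x)) := le_max_right _ _
        _ ≤ M w := by
          rw [hM]; simp only
          rw [← Finset.mul_prod_erase S _ hx]
          exact le_mul_of_one_le_right (by positivity)
            (Finset.one_le_prod fun y _ => le_max_left _ _)
    have := lower_of_bezout (sumBd_pabs w)
      (A := A.map (algebraMap K L)) (B := B.map (algebraMap K L))
      (U := U.map (algebraMap K L)) (V := V.map (algebraMap K L))
      (U' := U'.map (algebraMap K L)) (V' := V'.map (algebraMap K L)) hD0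
      (zero_le_one.trans (hkD w)) (by rwa [natDegree_map]) (by rwa [natDegree_map])
      (by rwa [natDegree_map]) (by rwa [natDegree_map])
      (by rw [← Polynomial.map_mul, ← Polynomial.map_mul, ← Polynomial.map_add, h,
        Polynomial.map_one])
      (by rw [← Polynomial.map_mul, ← Polynomial.map_mul, ← Polynomial.map_add, h',
        Polynomial.map_pow, map_X])
      (zero_le_one.trans (hM1 w))
      (fun j hj => by
        have hj' := Finset.mem_range.2 hj
        simp only [coeff_map]
        refine ⟨hcoef _ ?_, hcoef _ ?_, hcoef _ ?_, hcoef _ ?_⟩ <;>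
        · simp only [hS, Finset.mem_union, Finset.mem_image]
          have hex : ∀ P : K[X], ∃ a ∈ Finset.range D, P.coeff a = P.coeff j :=
            fun P => ⟨j, hj', rfl⟩
          tauto) t
    simpa only [eval_map_algebraMap] using this

section Determinant

variable {R S : Type*} [CommRing R] [CommRing S]

/-- The functions `A ^ l * B ^ (N - l) * X ^ i`, with `m = D * l + i`. -/
noncomputable def basisFn (A B : R[X]) (D N m : ℕ) : R[X] :=
  A ^ (m / D) * B ^ (N - m / D) * X ^ (m % D)

/-- The coefficient matrix of the family `basisFn`. -/
noncomputable def basisMat (A B : R[X]) (D N : ℕ) :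
    Matrix (Fin (D * (N + 1))) (Fin (D * (N + 1))) R :=
  Matrix.of fun i j => (basisFn A B D N j).coeff i

lemma basisMat_det_map (φ : R →+* S) (A B : R[X]) (D N : ℕ) :
    (basisMat (A.map φ) (B.map φ) D N).det = φ (basisMat A B D N).det := by
  rw [RingHom.map_det]
  congr 1
  ext i j
  simp [basisMat, basisFn, ← coeff_map]

lemma basisFn_natDegree {A B : R[X]} {D N m : ℕ} (hA : A.natDegree ≤ D) (hB : B.natDegree ≤ D)
    (hD : 0 < D) (hm : m < D * (N + 1)) : (basisFn A B D N m).natDegree < D * (N + 1) := by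
  have h1 : m / D ≤ N := Nat.lt_succ_iff.1 (Nat.div_lt_of_lt_mul hm)
  have h2 := Nat.mod_lt m hD
  have h3 : (A ^ (m / D)).natDegree ≤ (m / D) * D :=
    natDegree_pow_le.trans (Nat.mul_le_mul_left _ hA)
  have h4 : (B ^ (N - m / D)).natDegree ≤ (N - m / D) * D :=
    natDegree_pow_le.trans (Nat.mul_le_mul_left _ hB)
  have h5 : (X ^ (m % D) : R[X]).natDegree ≤ m % D := natDegree_X_pow_le _
  have h6 := natDegree_mul_le_of_le (natDegree_mul_le_of_le h3 h4) h5
  have h7 : (m / D) * D + (N - m / D) * D = N * D := by rw [← add_mul]; congr 1; omega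
  unfold basisFn
  rw [h7] at h6
  calc _ ≤ N * D + m % D := h6
    _ < N * D + D := by omega
    _ = D * (N + 1) := by ring

lemma det_eval_basisFn {A B : R[X]} {D N : ℕ} (hA : A.natDegree ≤ D) (hB : B.natDegree ≤ D)
    (hD : 0 < D) (t : Fin (D * (N + 1)) → R) :
    (Matrix.of fun i (m : Fin (D * (N + 1))) => (basisFn A B D N m).eval (t i)).det =
      (Matrix.vandermonde t).det * (basisMat A B D N).det := by
  rw [← Matrix.det_mul]
  congr 1
  ext i m
  simp only [Matrix.of_apply, Matrix.mul_apply, Matrix.vandermonde_apply, basisMat]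
  rw [eval_eq_sum_range' (basisFn_natDegree hA hB hD m.2), Finset.sum_range]
  exact Finset.sum_congr rfl fun _ _ => mul_comm _ _

lemma basisMat_succ {A B : R[X]} {D N : ℕ} (hA : A.natDegree ≤ D) (hB : B.natDegree ≤ D)
    (hD : 0 < D) : basisMat A B D (N + 1) = sylvester (A ^ (N + 1)) B (D * (N + 1)) D *
      (Matrix.fromBlocks (basisMat A B D N) 0 0 1).reindex finSumFinEquiv finSumFinEquiv := by
  have hA' : (A ^ (N + 1)).natDegree ≤ D * (N + 1) := by
    rw [mul_comm]; exact natDegree_pow_le.trans (Nat.mul_le_mul_left _ hA)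
  have e1 : ∀ (i : Fin (D * (N + 1) + D)) (k : Fin (D * (N + 1))),
      sylvester (A ^ (N + 1)) B (D * (N + 1)) D i (Fin.castAdd D k) = (B * X ^ (k : ℕ)).coeff i := by
    intro i k
    simp only [sylvester, Matrix.of_apply, Fin.addCases_left, coeff_mul_X_pow', Set.mem_Icc]
    by_cases h : (k : ℕ) ≤ i
    · by_cases h' : (i : ℕ) ≤ k + D
      · simp [h, h']
      · simp only [h, h', and_false, if_false, if_true]
        exact (coeff_eq_zero_of_natDegree_lt (by omega)).symm
    · simp [h]
  have e2 : ∀ (i : Fin (D * (N + 1) + D)) (k : Fin D),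
      sylvester (A ^ (N + 1)) B (D * (N + 1)) D i (Fin.natAdd _ k) =
        (A ^ (N + 1) * X ^ (k : ℕ)).coeff i := by
    intro i k
    simp only [sylvester, Matrix.of_apply, Fin.addCases_right, coeff_mul_X_pow', Set.mem_Icc]
    by_cases h : (k : ℕ) ≤ i
    · by_cases h' : (i : ℕ) ≤ k + D * (N + 1)
      · simp [h, h']
      · simp only [h, h', and_false, if_false, if_true]
        exact (coeff_eq_zero_of_natDegree_lt (by omega)).symm
    · simp [h]
  have e0 : ∀ i j : Fin (D * (N + 1) + D),
      (basisMat A B D (N + 1) : Matrix (Fin (D * (N + 1) + D)) (Fin (D * (N + 1) + D)) R) i j =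
        (basisFn A B D (N + 1) j).coeff i := fun i j => rfl
  refine Matrix.ext (m := Fin (D * (N + 1) + D)) (n := Fin (D * (N + 1) + D)) fun i j => ?_
  rw [Matrix.mul_apply, e0, Fin.sum_univ_add]
  simp only [e1, e2]
  induction j using Fin.addCases with
  | left j =>
    simp only [Matrix.reindex_apply, Matrix.submatrix_apply, finSumFinEquiv_symm_apply_castAdd,
      finSumFinEquiv_symm_apply_natAdd, Matrix.fromBlocks_apply₁₁, Matrix.fromBlocks_apply₂₁,
      Matrix.zero_apply, mul_zero, Finset.sum_const_zero, add_zero]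
    have hj : (j : ℕ) / D ≤ N := Nat.lt_succ_iff.1 (Nat.div_lt_of_lt_mul j.2)
    have hb : basisFn A B D (N + 1) j = B * basisFn A B D N j := by
      simp only [basisFn]
      rw [show N + 1 - (j : ℕ) / D = (N - j / D) + 1 by omega]; ring
    have : basisFn A B D N j = ∑ k : Fin (D * (N + 1)),
        C ((basisFn A B D N j).coeff k) * X ^ (k : ℕ) := by
      rw [← Finset.sum_range (fun k => C ((basisFn A B D N j).coeff k) * X ^ k)]
      exact as_sum_range_C_mul_X_pow' _ (basisFn_natDegree hA hB hD j.2)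
    simp only [basisMat, Matrix.of_apply, Fin.val_castAdd]
    rw [hb]
    conv_lhs => rw [this, Finset.mul_sum, finsetSum_coeff]
    refine Finset.sum_congr rfl fun k _ => ?_
    rw [mul_left_comm, coeff_C_mul, mul_comm]
  | right j =>
    simp only [Matrix.reindex_apply, Matrix.submatrix_apply, finSumFinEquiv_symm_apply_castAdd,
      finSumFinEquiv_symm_apply_natAdd, Matrix.fromBlocks_apply₁₂, Matrix.fromBlocks_apply₂₂,
      Matrix.zero_apply, mul_zero, Finset.sum_const_zero, zero_add, Matrix.one_apply, mul_ite,
      mul_one, Finset.sum_ite_eq', Finset.mem_univ, if_true, Fin.val_natAdd, basisFn]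
    have h1 : (D * (N + 1) + j) / D = N + 1 := by
      rw [Nat.mul_add_div hD, Nat.div_eq_of_lt j.2, add_zero]
    have h2 : (D * (N + 1) + j) % D = j := by
      rw [Nat.mul_add_mod, Nat.mod_eq_of_lt j.2]
    rw [h1, h2]; simp

lemma basisMat_det {A B : R[X]} {D : ℕ} (hA : A.Monic) (hAD : A.natDegree = D)
    (hB : B.natDegree ≤ D) (hD : 0 < D) (N : ℕ) :
    (basisMat A B D N).det = resultant A B D D ^ (N * (N + 1) / 2) := by
  nontriviality R
  induction N with
  | zero =>
    have : basisMat A B D 0 = 1 := by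
      ext i j
      have hj : (j : ℕ) < D := by have := j.2; omega
      simp only [basisMat, Matrix.of_apply, basisFn, Nat.div_eq_of_lt hj, Nat.mod_eq_of_lt hj]
      simp [coeff_X_pow, Matrix.one_apply, Fin.ext_iff]
    rw [this]; simp
  | succ N ih =>
    have h : resultant (A ^ (N + 1)) B (D * (N + 1)) D = resultant A B D D ^ (N + 1) := by
      rw [← hAD, mul_comm]
      have h1 := resultant_pow_left (f := A) (g := B) (m := N + 1) (n := A.natDegree)
        (by simp [hA.leadingCoeff]) (by omega)
      rw [← h1, hA.natDegree_pow]
    rw [basisMat_succ hAD.le hB hD]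
    erw [Matrix.det_mul]
    rw [Matrix.det_reindex_self, Matrix.det_fromBlocks_zero₂₁, ih, Matrix.det_one, mul_one]
    change resultant _ _ _ _ * _ = _
    rw [h, ← pow_add]
    congr 1
    have : (N + 1) * (N + 1 + 1) = N * (N + 1) + 2 * (N + 1) := by ring
    omega

end Determinant

lemma resultant_ne_zero_of_monic {F : Type*} [Field F] {A B : F[X]} {D : ℕ} (hA : A.Monic)
    (hD : A.natDegree = D) (hB : B.natDegree < D) (hAB : IsCoprime A B) :
    resultant A B D D ≠ 0 := by
  have h1 := resultant_add_right_deg (f := A) (g := B) (m := D) (n := B.natDegree)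
    (D - B.natDegree) le_rfl
  rw [Nat.add_sub_cancel' hB.le] at h1
  have h2 : A.coeff D = 1 := by rw [← hD]; exact hA.coeff_natDegree
  rw [h1, h2, one_pow, one_mul, ← hD]
  exact resultant_ne_zero A B hAB

lemma pabs_det_le {L : Type*} [Field L] [NumberField L] (w : Pl L) {A B : L[X]} {D N : ℕ}
    (hD : 0 < D) {κ : ℝ} (t : Fin (D * (N + 1)) → L)
    (hκ : ∀ i, max 1 (pabs w (t i)) ^ D ≤ κ * nrm (pabs w) (A.eval (t i), B.eval (t i))) :
    pabs w (Matrix.of fun i (m : Fin (D * (N + 1))) => (basisFn A B D N m).eval (t i)).det ≤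
      kap w (D * (N + 1)).factorial *
        ∏ i, (κ * nrm (pabs w) (A.eval (t i), B.eval (t i)) ^ (N + 1)) := by
  have hpos : ∀ i, 0 ≤ κ * nrm (pabs w) (A.eval (t i), B.eval (t i)) := fun i =>
    le_trans (by positivity) (hκ i)
  have hpos' : ∀ i, 0 ≤ κ * nrm (pabs w) (A.eval (t i), B.eval (t i)) ^ (N + 1) := fun i => by
    rw [pow_succ', ← mul_assoc]
    exact mul_nonneg (hpos i) (pow_nonneg (nrm_nonneg _ _) _)
  have hent : ∀ i (m : Fin (D * (N + 1))), pabs w ((basisFn A B D N m).eval (t i)) ≤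
      κ * nrm (pabs w) (A.eval (t i), B.eval (t i)) ^ (N + 1) := by
    intro i m
    set n := nrm (pabs w) (A.eval (t i), B.eval (t i)) with hn
    have hn0 : 0 ≤ n := nrm_nonneg _ _
    have hm : (m : ℕ) / D ≤ N := Nat.lt_succ_iff.1 (Nat.div_lt_of_lt_mul m.2)
    have hr := (Nat.mod_lt m hD).le
    have h1 : pabs w (A.eval (t i)) ≤ n := le_max_left _ _
    have h2 : pabs w (B.eval (t i)) ≤ n := le_max_right _ _
    have h0 : ∀ x, 0 ≤ pabs w x := (pabs w).nonneg
    have h3 : pabs w (t i) ^ ((m : ℕ) % D) ≤ max 1 (pabs w (t i)) ^ D :=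
      (pow_le_pow_left₀ (h0 _) (le_max_right _ _) _).trans
        (pow_le_pow_right₀ (le_max_left _ _) hr)
    simp only [basisFn, eval_mul, eval_pow, eval_X, map_mul, map_pow]
    calc _ ≤ n ^ ((m : ℕ) / D) * n ^ (N - m / D) * max 1 (pabs w (t i)) ^ D := by
          have := h0 (A.eval (t i)); have := h0 (B.eval (t i)); have := h0 (t i)
          gcongr
      _ = n ^ N * max 1 (pabs w (t i)) ^ D := by rw [← pow_add]; congr 2; omega
      _ ≤ n ^ N * (κ * n) := by gcongr; exact hκ i
      _ = _ := by ring
  rw [Matrix.det_apply]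
  refine pabs_sum_le w _ _ (Finset.prod_nonneg fun i _ => hpos' i) (fun σ _ => ?_) (by
    rw [Finset.card_univ, Fintype.card_perm, Fintype.card_fin])
  have hs : pabs w (Equiv.Perm.sign σ • ∏ i, (Matrix.of fun i (m : Fin (D * (N + 1))) =>
      (basisFn A B D N m).eval (t i)) (σ i) i) = pabs w (∏ i, (Matrix.of fun i
        (m : Fin (D * (N + 1))) => (basisFn A B D N m).eval (t i)) (σ i) i) := by
    rcases Int.units_eq_one_or (Equiv.Perm.sign σ) with h | h <;> rw [h] <;> simp
  rw [hs, map_prod, ← Equiv.prod_comp σ (fun i => κ * nrm (pabs w) (A.eval (t i), B.eval (t i)) ^ (N + 1))]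
  refine Finset.prod_le_prod (fun i _ => (pabs w).nonneg _) fun i _ => ?_
  exact hent (σ i) i

/-- The defect in the local determinant bounds at all places, for points of small height. -/
lemma exists_slack {K : Type} [Field K] [NumberField K] {A B : K[X]} {D : ℕ} (hA : A.Monic)
    (hD : A.natDegree = D) (hD0 : 0 < D) (hB : B.natDegree < D) (hAB : IsCoprime A B) :
    ∃ C : ℝ, ∀ (L : Type) [Field L] [NumberField L] [Algebra K L] (N : ℕ)
      (t : Fin (D * (N + 1)) → L) (H : ℝ), Function.Injective t →
      (∀ i, ht (aeval (t i) A, aeval (t i) B) ≤ H * Module.finrank ℚ L) →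
      ∃ s : Pl L → ℝ, (∀ w, 0 ≤ s w) ∧ Adm s ∧
        psum s ≤ Module.finrank ℚ L * (H * (N + 1) * (D * (N + 1) : ℕ) + C * (D * (N + 1) : ℕ) +
          Real.log (D * (N + 1) : ℕ).factorial) ∧
        ∀ σ : L →+* ℂ, (N + 1) * ∑ i, Real.log (nrm (pabs (Sum.inl σ))
            (aeval (t i) A, aeval (t i) B)) - s (Sum.inl σ) ≤
          Real.log ‖σ (Matrix.vandermonde t).det‖ + (N * (N + 1) / 2 : ℕ) *
            Real.log ‖σ (algebraMap K L (resultant A B D D))‖ := by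
  obtain ⟨C, hC0, hC⟩ := exists_lower hA hD hD0 hB hAB
  refine ⟨C, fun L _ _ _ N t H htinj hH => ?_⟩
  obtain ⟨κ, hκ1, hκadm, hκsum, hκ⟩ := hC L
  set A' := A.map (algebraMap K L) with hA'
  set B' := B.map (algebraMap K L) with hB'
  have hp : ∀ i, ((aeval (t i) A, aeval (t i) B) : L × L) ≠ 0 := by
    intro i h
    obtain ⟨U, V, hUV⟩ := hAB
    have h1 := congrArg (aeval (t i)) hUV
    simp only [Prod.ext_iff, Prod.fst_zero, Prod.snd_zero] at h
    simp [h.1, h.2] at h1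
  set R := algebraMap K L (resultant A B D D) with hR
  have hR0 : R ≠ 0 := by
    rw [hR, Ne, FaithfulSMul.algebraMap_eq_zero_iff]
    exact resultant_ne_zero_of_monic hA hD hB hAB
  have hV0 : (Matrix.vandermonde t).det ≠ 0 := Matrix.det_vandermonde_ne_zero_iff.2 htinj
  have hdet : (Matrix.of fun i (m : Fin (D * (N + 1))) => (basisFn A' B' D N m).eval (t i)).det =
      (Matrix.vandermonde t).det * R ^ (N * (N + 1) / 2) := by
    rw [det_eval_basisFn (by rw [hA', natDegree_map, hD])
      (by rw [hB', natDegree_map]; exact hB.le) hD0, basisMat_det_map, basisMat_det hA hD hB.le hD0,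
      map_pow]
  have hev : ∀ i, ((A'.eval (t i), B'.eval (t i)) : L × L) = (aeval (t i) A, aeval (t i) B) := by
    intro i; simp only [hA', hB', eval_map_algebraMap]
  have hlogn : ∀ i, Adm (fun w => Real.log (nrm (pabs w) (aeval (t i) A, aeval (t i) B))) :=
    fun i => adm_log_nrm (hp i)
  have a1 : Adm (fun w : Pl L => Real.log (kap w (D * (N + 1)).factorial)) := by rw [log_kap]; exact adm_arch _
  have a2 : Adm (fun w : Pl L => ((D * (N + 1) : ℕ) : ℝ) * Real.log (κ w)) := hκadm.const_mul _
  have a3 : Adm (fun w : Pl L => ((N : ℝ) + 1) * ∑ i, Real.log (nrm (pabs w)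
    (aeval (t i) A, aeval (t i) B))) := (Adm.sum _ fun i _ => hlogn i).const_mul _
  have a4 : Adm (fun w : Pl L => Real.log (pabs w (Matrix.vandermonde t).det)) := adm_log _
  have a5 : Adm (fun w : Pl L => ((N * (N + 1) / 2 : ℕ) : ℝ) * Real.log (pabs w R)) :=
    (adm_log _).const_mul _
  have a6 := (a1.add a2).add a3
  have a7 := a4.add a5
  refine ⟨_, fun w => ?_, a6.sub a7, ?_, fun σ => ?_⟩
  · have h1 := pabs_det_le w (A := A') (B := B') hD0 (κ := κ w) t (fun i => by
      rw [hev]; exact hκ w (t i))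
    simp only [hev] at h1
    rw [hdet, map_mul, map_pow] at h1
    have b1 : 0 < pabs w (Matrix.vandermonde t).det := (pabs w).pos hV0
    have b2 : 0 < pabs w R := (pabs w).pos hR0
    have b3 := fun i => nrm_pos (pabs w) (hp i)
    have b4 : 0 < κ w := zero_lt_one.trans_le (hκ1 w)
    have b5 : 0 < kap w (D * (N + 1)).factorial := zero_lt_one.trans_le (kap_pos w (Nat.factorial_pos _))
    have h2 := Real.log_le_log (by positivity) h1
    have b6 : ∀ i, κ w * nrm (pabs w) (aeval (t i) A, aeval (t i) B) ^ (N + 1) ≠ 0 := fun i => by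
      have := b3 i; positivity
    rw [Real.log_mul b1.ne' (by positivity), Real.log_pow, Real.log_mul b5.ne'
      (Finset.prod_ne_zero_iff.2 fun i _ => b6 i), Real.log_prod (fun i _ => b6 i),
      Finset.sum_congr rfl (fun i _ => Real.log_mul b4.ne' (pow_pos (b3 i) _).ne'),
      Finset.sum_add_distrib, Finset.sum_const, Finset.card_univ, Fintype.card_fin, nsmul_eq_mul,
      
      Finset.sum_congr rfl (fun i _ => Real.log_pow _ (N + 1)), ← Finset.mul_sum] at h2
    push_cast at h2 ⊢
    linarith
  · rw [psum_sub a6 a7, psum_add (a1.add a2) a3, psum_add a1 a2, psum_add a4 a5, psum_const_mul,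
      psum_const_mul, psum_const_mul, psum_log hV0, psum_log hR0, psum_sum _ fun i _ => hlogn i,
      log_kap, psum_arch]
    have h1 : ∑ i, psum (fun w => Real.log (nrm (pabs w) (aeval (t i) A, aeval (t i) B))) ≤
        ((D * (N + 1) : ℕ) : ℝ) * (H * Module.finrank ℚ L) := by
      calc _ ≤ ∑ i : Fin (D * (N + 1)), H * Module.finrank ℚ L := Finset.sum_le_sum fun i _ => hH i
        _ = _ := by simp
    have h2 : (0 : ℝ) ≤ N + 1 := by positivity
    have h3 : (0 : ℝ) ≤ ((D * (N + 1) : ℕ) : ℝ) := by positivity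
    have h4 := mul_le_mul_of_nonneg_left h1 h2
    have h5 := mul_le_mul_of_nonneg_left hκsum h3
    nlinarith
  · have b1 := Real.log_nonneg (hκ1 (Sum.inl σ))
    have b2 := Real.log_nonneg (kap_pos (Sum.inl σ : Pl L) (Nat.factorial_pos (D * (N + 1))))
    have b3 : 0 ≤ ((D * (N + 1) : ℕ) : ℝ) * Real.log (κ (Sum.inl σ)) := by positivity
    simp only [pabs_inl]
    linarith

/-- The point `c` is preperiodic for the map with parameter `t`. -/
def Per {R : Type*} [CommRing R] (t c : R) : Prop :=
  ∃ m n : ℕ, m < n ∧ (orbit t c n).1 * (orbit t c m).2 - (orbit t c n).2 * (orbit t c m).1 = 0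

lemma Per.of_map {R S : Type*} [CommRing R] [CommRing S] {φ : R →+* S}
    (hφ : Function.Injective φ) {t c : R} (h : Per (φ t) (φ c)) : Per t c := by
  obtain ⟨m, n, hmn, h⟩ := h
  refine ⟨m, n, hmn, hφ ?_⟩
  simpa [orbit_map φ] using h

lemma derivative_den_self {R : Type*} [CommRing R] (c : R) (n : ℕ) :
    c * (1 - c) * (derivative (den c (n + 1))).eval c = 4 ^ (n + 1) * (num c (n + 1)).eval c := by
  induction n with
  | zero =>
    simp [den_succ, num_succ, den_zero, num_zero, derivative_mul, derivative_ofNat]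
    ring
  | succ n ih =>
    have hB : (den c (n + 1)).eval c = 0 := by rw [eval_den, orbit_self_den]
    rw [den_succ, num_succ c (n + 1)]
    generalize num c (n + 1) = A at *
    generalize den c (n + 1) = B at *
    simp only [derivative_mul, derivative_ofNat, derivative_X, derivative_sub, eval_add, eval_mul,
      eval_sub, eval_X, eval_pow, eval_ofNat, hB]
    have := congrArg (· * (4 * A.eval c ^ 3)) ih
    linear_combination this

lemma per_poly_ne_zero {F : Type*} [Field F] [CharZero F] {c : F} (hc0 : c ≠ 0) (hc1 : c ≠ 1)
    {m n : ℕ} (hmn : m < n) : num c n * den c m - den c n * num c m ≠ 0 := by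
  intro h
  obtain ⟨n, rfl⟩ : ∃ k, n = k + 1 := ⟨n - 1, by omega⟩
  have hnum : ∀ k, (num c (k + 1)).eval c ≠ 0 := by
    intro k
    rw [eval_num, orbit_self_num]
    have : c - c ^ 2 = c * (1 - c) := by ring
    rw [this]
    exact pow_ne_zero _ (pow_ne_zero _ (mul_ne_zero hc0 (sub_ne_zero.2 hc1.symm)))
  have hden : ∀ k, (den c (k + 1)).eval c = 0 := fun k => by rw [eval_den, orbit_self_den]
  rcases m with _ | m
  · have := congrArg (eval c) h
    simp [num_zero, den_zero, hden, hnum] at this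
  · have := congrArg (fun p => (derivative p).eval c) h
    simp only [derivative_sub, derivative_mul, eval_sub, eval_add, eval_mul, hden,
      derivative_zero, eval_zero] at this
    have h1 := derivative_den_self c n
    have h2 := derivative_den_self c m
    have h3 : (4 ^ (m + 1) - 4 ^ (n + 1)) * ((num c (n + 1)).eval c * (num c (m + 1)).eval c) = 0 := by
      linear_combination c * (1 - c) * this - (num c (n + 1)).eval c * h2 +
        (num c (m + 1)).eval c * h1
    refine mul_ne_zero ?_ (mul_ne_zero (hnum n) (hnum m)) h3
    rw [sub_ne_zero]
    have : (4 : ℕ) ^ (m + 1) ≠ 4 ^ (n + 1) := fun h => by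
      have := Nat.pow_right_injective (le_refl 2 |>.trans (by norm_num : 2 ≤ 4)) h
      omega
    exact_mod_cast this

lemma isAlgebraic_of_per {K : Type*} [Field K] [CharZero K] [Algebra K ℂ] {c : K} (hc0 : c ≠ 0)
    (hc1 : c ≠ 1) {t : ℂ} (h : Per t (algebraMap K ℂ c)) : IsAlgebraic K t := by
  obtain ⟨m, n, hmn, h⟩ := h
  refine ⟨_, per_poly_ne_zero hc0 hc1 hmn, ?_⟩
  simp only [← eval_map_algebraMap, Polynomial.map_sub, Polynomial.map_mul, map_num, map_den,
    eval_sub, eval_mul, eval_num, eval_den]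
  exact h

lemma isCoprime_num_den {K : Type*} [Field K] [Algebra K ℂ] {c : K} (hc0 : c ≠ 0) (hc1 : c ≠ 1) (n : ℕ) :
    IsCoprime (num c n) (den c n) := by
  rw [← isCoprime_map (algebraMap K ℂ), map_num, map_den]
  exact isCoprime_num_den_complex (by simpa) (fun h => hc1 (by
    have := (algebraMap K ℂ).injective (h.trans (map_one _).symm); exact this)) n

lemma den_natDegree_lt {R : Type*} [CommRing R] [Nontrivial R] (c : R) (n : ℕ) :
    (den c (n + 1)).natDegree < 2 * 4 ^ n := by
  by_cases h : den c (n + 1) = 0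
  · rw [h, natDegree_zero]; positivity
  · have := (degree_num_den c n).2.2
    rw [degree_eq_natDegree h] at this
    exact_mod_cast this

lemma aeval_num_den {K : Type*} [Field K] {L : Type*} [CommRing L] [Algebra K L] (c : K) (n : ℕ) (t : L) :
    ((aeval t (num c n), aeval t (den c n)) : L × L) = orbit t (algebraMap K L c) n := by
  rw [← eval_map_algebraMap, ← eval_map_algebraMap, map_num, map_den, eval_num, eval_den]

/-- Orbits of preperiodic points have bounded heights, uniformly in the parameter. -/
lemma ht_orbit_bound {K : Type} [Field K] [NumberField K] [Algebra K ℂ] {c : K} (hc0 : c ≠ 0) (hc1 : c ≠ 1) : ∃ H : ℝ, 0 ≤ H ∧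
    ∀ (L : Type) [Field L] [NumberField L] [Algebra K L] (t : L), t ≠ 0 → t ≠ 1 →
      Per t (algebraMap K L c) → ∀ n, ht (orbit t (algebraMap K L c) n) ≤
        H * Module.finrank ℚ L := by
  obtain ⟨hm, hd, -⟩ := degree_num_den c 0
  obtain ⟨C, hC0, hC⟩ := exists_lower hm hd (by norm_num) (den_natDegree_lt c 0)
    (isCoprime_num_den hc0 hc1 1)
  have hl2 : 0 ≤ Real.log 2 := Real.log_nonneg (by norm_num)
  refine ⟨5 * C + 14 * Real.log 2, by positivity, fun L _ _ _ t ht0 ht1 hper n => ?_⟩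
  obtain ⟨κ, hκ1, hκadm, hκsum, hκ⟩ := hC L
  have hne : orbit t (algebraMap K L c) 1 ≠ 0 :=
    orbit_ne_zero (pabs (Sum.inl (Classical.arbitrary (L →+* ℂ)))) two_ne_zero ht0 ht1 _ 1
  have h1 := psum_mono (f := fun w => 2 * Real.log (max 1 (pabs w t)))
    (g := fun w => Real.log (κ w) + Real.log (nrm (pabs w) (orbit t (algebraMap K L c) 1)))
    ((adm_max t).const_mul 2) (hκadm.add (adm_log_nrm hne)) (fun w => by
      have h2 := hκ w t
      simp only [zero_add, aeval_num_den] at h2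
      have h3 : 0 < max 1 (pabs w t) := lt_max_of_lt_left one_pos
      have h4 := Real.log_le_log (by positivity) h2
      rw [Real.log_pow, Real.log_mul (zero_lt_one.trans_le (hκ1 w)).ne'
        (nrm_pos (pabs w) hne).ne'] at h4
      simpa using h4)
  rw [psum_const_mul, psum_add hκadm (adm_log_nrm hne), ← ht_one] at h1
  change _ ≤ _ + ht _ at h1
  have h5 := ht_orbit_le ht0 ht1 hper 1
  have h6 := ht_orbit_le ht0 ht1 hper n
  have h7 : (0 : ℝ) ≤ Module.finrank ℚ L := by positivity
  have h8 := mul_nonneg h7 hl2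
  have h9 := mul_nonneg h7 hC0
  nlinarith

lemma det_vandermonde_map {R S : Type*} [CommRing R] [CommRing S] (φ : R →+* S) {n : ℕ}
    (t : Fin n → R) : φ (Matrix.vandermonde t).det = (Matrix.vandermonde (φ ∘ t)).det := by
  rw [RingHom.map_det]
  congr 1
  ext i j
  simp [Matrix.vandermonde]

/-- Infinitely many common preperiodic parameters yield large configurations of small energy,
simultaneously for both starting points. -/
theorem exists_configuration {K : Type} [Field K] [NumberField K] [Algebra K ℂ] {a b : K}
    (ha0 : a ≠ 0) (ha1 : a ≠ 1) (hb0 : b ≠ 0) (hb1 : b ≠ 1) {T : Set ℂ} (hTinf : T.Infinite)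
    (hT : ∀ t ∈ T, t ≠ 0 ∧ t ≠ 1 ∧ Per t (algebraMap K ℂ a) ∧ Per t (algebraMap K ℂ b)) :
    ∃ C₀ C₁ : ℝ, ∀ n : ℕ, ∃ Cn : ℝ, ∀ N : ℕ, ∃ z : Fin (2 * 4 ^ n * (N + 1)) → ℂ,
      Function.Injective z ∧ ∀ c : K, c = a ∨ c = b →
        (N + 1) * ∑ i, Real.log ‖orbit (z i) (algebraMap K ℂ c) (n + 1)‖ -
          (C₀ * (N + 1) * (2 * 4 ^ n * (N + 1) : ℕ) + Cn * (2 * 4 ^ n * (N + 1) : ℕ) +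
            C₁ * Real.log (2 * 4 ^ n * (N + 1) : ℕ).factorial) ≤
          Real.log ‖(Matrix.vandermonde z).det‖ + (N * (N + 1) / 2 : ℕ) *
            Real.log ‖algebraMap K ℂ (resultant (num c (n + 1)) (den c (n + 1)) (2 * 4 ^ n)
              (2 * 4 ^ n))‖ := by
  obtain ⟨Ha, hHa0, hHa⟩ := ht_orbit_bound ha0 ha1
  obtain ⟨Hb, hHb0, hHb⟩ := ht_orbit_bound hb0 hb1
  set k : ℝ := (Module.finrank ℚ K : ℝ) with hk
  refine ⟨k * (Ha + Hb), k * 2, fun n => ?_⟩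
  have hD0 : 0 < 2 * 4 ^ n := by positivity
  obtain ⟨hma, hda, -⟩ := degree_num_den a n
  obtain ⟨hmb, hdb, -⟩ := degree_num_den b n
  obtain ⟨Ca, hCa⟩ := exists_slack hma hda hD0 (den_natDegree_lt a n)
    (isCoprime_num_den ha0 ha1 (n + 1))
  obtain ⟨Cb, hCb⟩ := exists_slack hmb hdb hD0 (den_natDegree_lt b n)
    (isCoprime_num_den hb0 hb1 (n + 1))
  refine ⟨k * (Ca + Cb), fun N => ?_⟩
  set y : Fin (2 * 4 ^ n * (N + 1)) → ℂ := fun i => (hTinf.natEmbedding T i : ℂ) with hy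
  have hyT : ∀ i, y i ∈ T := fun i => (hTinf.natEmbedding T i).2
  have hyinj : Function.Injective y := fun i j h => by
    have := (hTinf.natEmbedding T).injective (Subtype.ext h)
    exact Fin.ext this
  let L := IntermediateField.adjoin K (Set.range y)
  have : FiniteDimensional K L := IntermediateField.finiteDimensional_adjoin (by
    rintro _ ⟨i, rfl⟩
    exact (isAlgebraic_of_per ha0 ha1 (hT _ (hyT i)).2.2.1).isIntegral)
  have : FiniteDimensional ℚ L := FiniteDimensional.trans ℚ K L
  have : NumberField L := { }
  let t : Fin (2 * 4 ^ n * (N + 1)) → L := fun i =>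
    ⟨y i, IntermediateField.subset_adjoin K _ ⟨i, rfl⟩⟩
  have hinj : Function.Injective t := fun i j h => hyinj
    (show y i = y j from congrArg (fun x : L => (x : ℂ)) h)
  have hprop : ∀ i, t i ≠ 0 ∧ t i ≠ 1 ∧ Per (t i) (algebraMap K L a) ∧
      Per (t i) (algebraMap K L b) := by
    intro i
    obtain ⟨h0, h1, h2, h3⟩ := hT _ (hyT i)
    refine ⟨fun h => h0 (congrArg Subtype.val h), fun h => h1 (congrArg Subtype.val h), ?_, ?_⟩
    · exact Per.of_map (φ := algebraMap L ℂ) (algebraMap L ℂ).injective h2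
    · exact Per.of_map (φ := algebraMap L ℂ) (algebraMap L ℂ).injective h3
  obtain ⟨sa, hsa0, hsaA, hsa1, hsa2⟩ := hCa L N t Ha hinj (fun i => by
    rw [aeval_num_den]; exact hHa L (t i) (hprop i).1 (hprop i).2.1 (hprop i).2.2.1 _)
  obtain ⟨sb, hsb0, hsbA, hsb1, hsb2⟩ := hCb L N t Hb hinj (fun i => by
    rw [aeval_num_den]; exact hHb L (t i) (hprop i).1 (hprop i).2.1 (hprop i).2.2.2 _)
  have hsum := psum_ge_embeddings (K := K) (f := fun w => sa w + sb w)
    (fun w => add_nonneg (hsa0 w) (hsb0 w))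
  rw [psum_add hsaA hsbA] at hsum
  set M : ℝ := ((2 * 4 ^ n * (N + 1) : ℕ) : ℝ) with hM
  set F : ℝ := Real.log (2 * 4 ^ n * (N + 1) : ℕ).factorial with hF
  have hfin : (Module.finrank ℚ L : ℝ) = k * Module.finrank K L := by
    rw [hk, ← Nat.cast_mul, Module.finrank_mul_finrank]
  rw [hfin] at hsa1 hsb1
  have hcard : (Fintype.card (L →ₐ[K] ℂ) : ℝ) = Module.finrank K L := by
    rw [AlgHom.card]
  obtain ⟨τ, -, hτ⟩ : ∃ τ ∈ (Finset.univ : Finset (L →ₐ[K] ℂ)),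
      sa (Sum.inl (τ : L →+* ℂ)) + sb (Sum.inl (τ : L →+* ℂ)) ≤
        k * (Ha + Hb) * (N + 1) * M + k * (Ca + Cb) * M + k * 2 * F := by
    refine Finset.exists_le_of_sum_le ⟨L.val, Finset.mem_univ _⟩ ?_
    rw [Finset.sum_const, Finset.card_univ, nsmul_eq_mul, hcard]
    refine hsum.trans ?_
    nlinarith
  refine ⟨fun i => τ (t i), fun i j h => hinj (τ.injective h), ?_⟩
  have key : ∀ c : K, ∀ i, nrm (pabs (Sum.inl (τ : L →+* ℂ)))
      (aeval (t i) (num c (n + 1)), aeval (t i) (den c (n + 1))) =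
        ‖orbit (τ (t i)) (algebraMap K ℂ c) (n + 1)‖ := by
    intro c i
    have := orbit_map (τ : L →+* ℂ) (t i) (algebraMap K L c) (n + 1)
    simp only [RingHom.coe_coe, AlgHom.commutes] at this
    rw [this, aeval_num_den, Prod.norm_def]; rfl
  have hvdm : (τ : L →+* ℂ) (Matrix.vandermonde t).det =
      (Matrix.vandermonde fun i => τ (t i)).det := det_vandermonde_map (τ : L →+* ℂ) t
  rintro c (rfl | rfl)
  · have h1 := hsa2 (τ : L →+* ℂ)
    simp only [key, hvdm, RingHom.coe_coe, AlgHom.commutes] at h1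
    have h2 := hsb0 (Sum.inl (τ : L →+* ℂ))
    linarith
  · have h1 := hsb2 (τ : L →+* ℂ)
    simp only [key, hvdm, RingHom.coe_coe, AlgHom.commutes] at h1
    have h2 := hsa0 (Sum.inl (τ : L →+* ℂ))
    linarith

lemma sum_inner_pow_nonneg (s : Finset ℂ) (n : ℕ) :
    ∀ q : ℂ → ℝ, 0 ≤ ∑ x ∈ s, ∑ y ∈ s, q x * q y * (x.re * y.re + x.im * y.im) ^ n := by
  induction n with
  | zero =>
    intro q
    have : ∑ x ∈ s, ∑ y ∈ s, q x * q y * (x.re * y.re + x.im * y.im) ^ 0 = (∑ x ∈ s, q x) ^ 2 := by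
      simp [sq, Finset.sum_mul_sum]
    rw [this]; positivity
  | succ n ih =>
    intro q
    have := add_nonneg (ih fun x => q x * x.re) (ih fun x => q x * x.im)
    simp_rw [← Finset.sum_add_distrib] at this
    refine this.trans_eq (Finset.sum_congr rfl fun x _ => Finset.sum_congr rfl fun y _ => ?_)
    ring

lemma sum_gaussian_nonneg (s : Finset ℂ) (q : ℂ → ℝ) {r : ℝ} (hr : 0 ≤ r) :
    0 ≤ ∑ x ∈ s, ∑ y ∈ s, q x * q y * Real.exp (-(r * ‖x - y‖ ^ 2)) := by
  have key : ∀ x y : ℂ, Real.exp (-(r * ‖x - y‖ ^ 2)) = Real.exp (-(r * ‖x‖ ^ 2)) *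
      Real.exp (-(r * ‖y‖ ^ 2)) * Real.exp (2 * r * (x.re * y.re + x.im * y.im)) := by
    intro x y
    rw [← Real.exp_add, ← Real.exp_add]
    simp only [Complex.sq_norm, Complex.normSq_apply, Complex.sub_re, Complex.sub_im]
    ring_nf
  have hs : HasSum (fun n : ℕ => ∑ x ∈ s, ∑ y ∈ s, (q x * Real.exp (-(r * ‖x‖ ^ 2))) *
      (q y * Real.exp (-(r * ‖y‖ ^ 2))) *
      ((2 * r * (x.re * y.re + x.im * y.im)) ^ n / n.factorial))
      (∑ x ∈ s, ∑ y ∈ s, (q x * Real.exp (-(r * ‖x‖ ^ 2))) *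
      (q y * Real.exp (-(r * ‖y‖ ^ 2))) * Real.exp (2 * r * (x.re * y.re + x.im * y.im))) := by
    refine hasSum_sum fun x _ => hasSum_sum fun y _ => HasSum.mul_left _ ?_
    rw [Real.exp_eq_exp_ℝ]
    exact NormedSpace.expSeries_div_hasSum_exp _
  have h0 := hs.nonneg (fun n => by
    have := sum_inner_pow_nonneg s n (fun x => q x * Real.exp (-(r * ‖x‖ ^ 2)))
    have h2 : (0 : ℝ) ≤ (2 * r) ^ n / n.factorial := by positivity
    have h3 := mul_nonneg h2 this
    simp_rw [Finset.mul_sum] at h3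
    refine h3.trans_eq (Finset.sum_congr rfl fun x _ => Finset.sum_congr rfl fun y _ => ?_)
    rw [mul_pow (2 * r)]; ring)
  refine h0.trans_eq (Finset.sum_congr rfl fun x _ => Finset.sum_congr rfl fun y _ => ?_)
  rw [key]; ring

lemma sum_cauchy_nonneg (s : Finset ℂ) (q : ℂ → ℝ) {c : ℝ} (hc : 0 < c) :
    0 ≤ ∑ x ∈ s, ∑ y ∈ s, q x * q y * (‖x - y‖ ^ 2 + c)⁻¹ := by
  have hint : ∀ x y : ℂ, MeasureTheory.IntegrableOn
      (fun r : ℝ => Real.exp (-(‖x - y‖ ^ 2 + c) * r)) (Set.Ioi 0) := fun x y =>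
    integrableOn_exp_mul_Ioi (by have := sq_nonneg ‖x - y‖; linarith) 0
  have key : ∑ x ∈ s, ∑ y ∈ s, q x * q y * (‖x - y‖ ^ 2 + c)⁻¹ =
      ∫ r in Set.Ioi (0 : ℝ), ∑ x ∈ s, ∑ y ∈ s,
        q x * q y * Real.exp (-(‖x - y‖ ^ 2 + c) * r) := by
    rw [MeasureTheory.integral_finsetSum _ fun x _ =>
      MeasureTheory.integrable_finsetSum _ fun y _ => (hint x y).const_mul _]
    refine Finset.sum_congr rfl fun x _ => ?_
    rw [MeasureTheory.integral_finsetSum _ fun y _ => (hint x y).const_mul _]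
    refine Finset.sum_congr rfl fun y _ => ?_
    rw [MeasureTheory.integral_const_mul,
      integral_exp_mul_Ioi (by have := sq_nonneg ‖x - y‖; linarith) 0]
    rw [mul_zero, Real.exp_zero, neg_div_neg_eq, one_div]
  rw [key]
  refine MeasureTheory.setIntegral_nonneg measurableSet_Ioi fun r hr => ?_
  have h1 := sum_gaussian_nonneg s q (le_of_lt hr)
  have h2 := mul_nonneg (Real.exp_nonneg (-(c * r))) h1
  simp_rw [Finset.mul_sum] at h2
  refine h2.trans_eq (Finset.sum_congr rfl fun x _ => Finset.sum_congr rfl fun y _ => ?_)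
  rw [mul_left_comm, ← Real.exp_add]
  ring_nf

/-- The (signed) double sum of the regularised logarithmic kernel. -/
lemma monotoneOn_sum_log (s : Finset ℂ) (q : ℂ → ℝ) :
    MonotoneOn (fun c : ℝ => ∑ x ∈ s, ∑ y ∈ s, q x * q y * Real.log (‖x - y‖ ^ 2 + c))
      (Set.Ioi 0) := by
  have hd : ∀ c ∈ Set.Ioi (0 : ℝ), HasDerivAt
      (fun c : ℝ => ∑ x ∈ s, ∑ y ∈ s, q x * q y * Real.log (‖x - y‖ ^ 2 + c))
      (∑ x ∈ s, ∑ y ∈ s, q x * q y * (‖x - y‖ ^ 2 + c)⁻¹) c := by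
    intro c hc
    refine HasDerivAt.fun_sum fun x _ => HasDerivAt.fun_sum fun y _ => ?_
    have hc' : 0 < c := hc
    have := ((hasDerivAt_id c).const_add (‖x - y‖ ^ 2)).log
      (by have := sq_nonneg ‖x - y‖; simp only [id]; positivity)
    simpa [one_div] using this.const_mul (q x * q y)
  refine monotoneOn_of_deriv_nonneg (convex_Ioi 0)
    (fun c hc => (hd c hc).continuousAt.continuousWithinAt) ?_ ?_
  · rw [interior_Ioi]
    exact fun c hc => (hd c hc).differentiableAt.differentiableWithinAt
  · rw [interior_Ioi]
    intro c hc
    rw [(hd c hc).deriv]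
    exact sum_cauchy_nonneg s q hc

lemma sum_log_nonpos (s : Finset ℂ) (q : ℂ → ℝ) (hq : ∑ x ∈ s, q x = 0) {c : ℝ} (hc : 0 < c) :
    ∑ x ∈ s, ∑ y ∈ s, q x * q y * Real.log (‖x - y‖ ^ 2 + c) ≤ 0 := by
  have hlim : Filter.Tendsto (fun c : ℝ => ∑ x ∈ s, ∑ y ∈ s, q x * q y *
      Real.log (‖x - y‖ ^ 2 + c)) Filter.atTop (nhds 0) := by
    have h1 : Filter.Tendsto (fun c : ℝ => ∑ x ∈ s, ∑ y ∈ s, q x * q y *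
        Real.log (‖x - y‖ ^ 2 / c + 1)) Filter.atTop
        (nhds (∑ x ∈ s, ∑ y ∈ s, q x * q y * Real.log (0 + 1))) := by
      refine tendsto_finsetSum _ fun x _ => tendsto_finsetSum _ fun y _ =>
        Filter.Tendsto.const_mul _ (Filter.Tendsto.log ?_ (by norm_num))
      exact (Filter.tendsto_id.const_div_atTop _).add_const _
    simp only [zero_add, Real.log_one, mul_zero, Finset.sum_const_zero] at h1
    refine h1.congr' ?_
    filter_upwards [Filter.eventually_gt_atTop 0] with c hc
    have : ∀ x y : ℂ, q x * q y * Real.log (‖x - y‖ ^ 2 + c) =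
        q x * q y * Real.log (‖x - y‖ ^ 2 / c + 1) + q x * q y * Real.log c := by
      intro x y
      rw [← mul_add, ← Real.log_mul (by positivity) (by positivity)]
      congr 2; field_simp
    simp_rw [this, Finset.sum_add_distrib, ← Finset.sum_mul, ← Finset.mul_sum, hq]
    simp
  exact ge_of_tendsto hlim (by
    filter_upwards [Filter.eventually_ge_atTop c] with d hd
    exact monotoneOn_sum_log s q (Set.mem_Ioi.2 hc) (Set.mem_Ioi.2 (hc.trans_le hd)) hd)

/-- The logarithmic kernel regularised at scale `ε`. -/
noncomputable def logKer (ε : ℝ) (x y : ℂ) : ℝ := 1 / 2 * Real.log (‖x - y‖ ^ 2 + ε ^ 2)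

/-- The bilinear form with kernel `logKer ε` on finitely supported real measures. -/
noncomputable def logForm (ε : ℝ) : (ℂ →₀ ℝ) →ₗ[ℝ] (ℂ →₀ ℝ) →ₗ[ℝ] ℝ :=
  Finsupp.linearCombination ℝ fun x => Finsupp.linearCombination ℝ fun y => logKer ε x y

/-- The total mass. -/
noncomputable def mass : (ℂ →₀ ℝ) →ₗ[ℝ] ℝ := Finsupp.linearCombination ℝ fun _ => (1 : ℝ)

lemma logForm_single (ε : ℝ) (x y : ℂ) :
    logForm ε (Finsupp.single x 1) (Finsupp.single y 1) = logKer ε x y := by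
  simp [logForm]

lemma mass_single (x : ℂ) : mass (Finsupp.single x 1) = 1 := by
  simp [mass]

lemma logKer_comm (ε : ℝ) (x y : ℂ) : logKer ε x y = logKer ε y x := by
  rw [logKer, logKer, norm_sub_rev]

lemma logForm_apply (ε : ℝ) (μ : ℂ →₀ ℝ) :
    logForm ε μ μ = 1 / 2 * ∑ x ∈ μ.support, ∑ y ∈ μ.support,
      μ x * μ y * Real.log (‖x - y‖ ^ 2 + ε ^ 2) := by
  simp only [logForm, Finsupp.linearCombination_apply, Finsupp.sum, LinearMap.sum_apply,
    LinearMap.smul_apply, smul_eq_mul, Finset.mul_sum, logKer]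
  refine Finset.sum_congr rfl fun x _ => Finset.sum_congr rfl fun y _ => ?_
  ring

lemma logForm_comm (ε : ℝ) (μ ν : ℂ →₀ ℝ) : logForm ε μ ν = logForm ε ν μ := by
  simp only [logForm, Finsupp.linearCombination_apply, Finsupp.sum, LinearMap.sum_apply,
    LinearMap.smul_apply, smul_eq_mul, Finset.mul_sum]
  rw [Finset.sum_comm]
  refine Finset.sum_congr rfl fun x _ => Finset.sum_congr rfl fun y _ => ?_
  rw [logKer_comm]; ring

lemma mass_apply (μ : ℂ →₀ ℝ) : mass μ = ∑ x ∈ μ.support, μ x := by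
  simp [mass, Finsupp.linearCombination_apply, Finsupp.sum]

lemma logForm_self_nonpos {ε : ℝ} (hε : 0 < ε) {μ : ℂ →₀ ℝ} (hμ : mass μ = 0) :
    logForm ε μ μ ≤ 0 := by
  rw [mass_apply] at hμ
  rw [logForm_apply]
  have := sum_log_nonpos μ.support μ hμ (by positivity : 0 < ε ^ 2)
  linarith

lemma logForm_self_mono {ε ε' : ℝ} (hε : 0 < ε) (h : ε ≤ ε') (μ : ℂ →₀ ℝ) :
    logForm ε μ μ ≤ logForm ε' μ μ := by
  rw [logForm_apply, logForm_apply]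
  have := monotoneOn_sum_log μ.support μ (Set.mem_Ioi.2 (by positivity : 0 < ε ^ 2))
    (Set.mem_Ioi.2 (by have := hε.trans_le h; positivity : 0 < ε' ^ 2))
    (by gcongr)
  simp only at this
  linarith

/-- Cauchy–Schwarz for the energy of two measures of total mass zero. -/
lemma logForm_cauchy {ε : ℝ} (hε : 0 < ε) {μ ν : ℂ →₀ ℝ} (hμ : mass μ = 0) (hν : mass ν = 0)
    {t : ℝ} : 2 * t * logForm ε μ ν ≤ -logForm ε μ μ - t ^ 2 * logForm ε ν ν := by
  have := logForm_self_nonpos hε (μ := μ + t • ν) (by simp [hμ, hν])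
  simp only [map_add, map_smul, LinearMap.add_apply, LinearMap.smul_apply, smul_eq_mul,
    logForm_comm ε ν μ] at this
  nlinarith

/-- The sum of point masses at the roots of a polynomial. -/
noncomputable def rootMeasure (P : ℂ[X]) : ℂ →₀ ℝ :=
  (P.roots.map fun y => Finsupp.single y (1 : ℝ)).sum

lemma mass_rootMeasure (P : ℂ[X]) : mass (rootMeasure P) = P.natDegree := by
  rw [rootMeasure, map_multiset_sum, Multiset.map_map]
  simp [mass_single, IsAlgClosed.card_roots_eq_natDegree]

lemma logForm_rootMeasure_single (ε : ℝ) (P : ℂ[X]) (z : ℂ) :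
    logForm ε (rootMeasure P) (Finsupp.single z 1) = (P.roots.map fun y => logKer ε z y).sum := by
  rw [logForm_comm, rootMeasure, map_multiset_sum, Multiset.map_map]
  simp [logForm_single]

lemma logForm_rootMeasure_rootMeasure (ε : ℝ) (P Q : ℂ[X]) :
    logForm ε (rootMeasure P) (rootMeasure Q) =
      (P.roots.map fun y => (Q.roots.map fun y' => logKer ε y y').sum).sum := by
  rw [logForm_comm]
  conv_lhs => rw [rootMeasure.eq_1 P, map_multiset_sum, Multiset.map_map]
  simp only [Function.comp_def, logForm_rootMeasure_single]

lemma log_norm_le_logKer {ε : ℝ} {x y : ℂ} (h : x ≠ y) : Real.log ‖x - y‖ ≤ logKer ε x y := by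
  have h0 : 0 < ‖x - y‖ := norm_pos_iff.2 (sub_ne_zero.2 h)
  have : Real.log ‖x - y‖ = 1 / 2 * Real.log (‖x - y‖ ^ 2) := by rw [Real.log_pow]; push_cast; ring
  rw [this, logKer]
  gcongr
  nlinarith [sq_nonneg ε]

lemma log_le_logKer {ε : ℝ} (hε : 0 < ε) (x y : ℂ) : Real.log ε ≤ logKer ε x y := by
  have : Real.log ε = 1 / 2 * Real.log (ε ^ 2) := by rw [Real.log_pow]; push_cast; ring
  rw [this, logKer]
  gcongr
  nlinarith [sq_nonneg ‖x - y‖]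

lemma log_norm_eval_eq {P : ℂ[X]} (hP : P.Monic) {z : ℂ} (hz : P.eval z ≠ 0) :
    Real.log ‖P.eval z‖ = (P.roots.map fun y => Real.log ‖z - y‖).sum := by
  rw [(IsAlgClosed.splits P).eval_eq_prod_roots_of_monic hP] at hz ⊢
  generalize P.roots = s at hz
  induction s using Multiset.induction_on with
  | empty => simp
  | cons a s ih =>
    simp only [Multiset.map_cons, Multiset.prod_cons, mul_ne_zero_iff] at hz
    simp only [Multiset.map_cons, Multiset.prod_cons, Multiset.sum_cons, norm_mul]
    rw [Real.log_mul (norm_ne_zero_iff.2 hz.1) (norm_ne_zero_iff.2 hz.2), ih hz.2]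

lemma log_norm_eval_le {P : ℂ[X]} (hP : P.Monic) {z : ℂ} (hz : P.eval z ≠ 0) (ε : ℝ) :
    Real.log ‖P.eval z‖ ≤ (P.roots.map fun y => logKer ε z y).sum := by
  rw [log_norm_eval_eq hP hz]
  refine Multiset.sum_map_le_sum_map _ _ fun y hy => log_norm_le_logKer ?_
  rintro rfl
  exact hz (isRoot_of_mem_roots hy)

section Pencil

variable {A B : ℂ[X]} {D : ℕ}

lemma pencil_monic (hA : A.Monic) (hD : A.natDegree = D) (hB : B.natDegree < D) (c : ℂ) :
    (A - C c * B).Monic ∧ (A - C c * B).natDegree = D := by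
  have hdeg : (C c * B).natDegree < A.natDegree :=
    (natDegree_C_mul_le c B).trans_lt (hB.trans_eq hD.symm)
  have h2 : (C c * B).degree < A.degree := degree_lt_degree hdeg
  exact ⟨hA.sub_of_left h2, (natDegree_sub_eq_left_of_natDegree_lt hdeg).trans hD⟩

lemma log_resultant_pencil (hA : A.Monic) (hD : A.natDegree = D) (hB : B.natDegree < D)
    (hR : resultant A B D D ≠ 0) (c : ℂ) :
    (∀ y ∈ (A - C c * B).roots, B.eval y ≠ 0) ∧
    ((A - C c * B).roots.map fun y => Real.log ‖B.eval y‖).sum =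
      Real.log ‖resultant A B D D‖ := by
  obtain ⟨hm, hd⟩ := pencil_monic hA hD hB c
  have h1 : resultant (A - C c * B) B D D = resultant A B D D := by
    have : A - C c * B = A + B * C (-c) := by simp; ring
    rw [this, resultant_add_mul_left _ _ _ _ _ (by simp) hB.le]
  have h2 := resultant_eq_prod_eval (A - C c * B) B D hB.le (IsAlgClosed.splits _)
  rw [hd, h1, hm.leadingCoeff, one_pow, one_mul] at h2
  rw [h2] at hR ⊢
  have h3 : ∀ y ∈ (A - C c * B).roots, B.eval y ≠ 0 := by
    intro y hy h0
    exact hR (Multiset.prod_eq_zero (Multiset.mem_map.2 ⟨y, hy, h0⟩))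
  refine ⟨h3, ?_⟩
  generalize (A - C c * B).roots = s at h3
  induction s using Multiset.induction_on with
  | empty => simp
  | cons a s ih =>
    simp only [Multiset.map_cons, Multiset.prod_cons, Multiset.sum_cons, norm_mul]
    rw [Real.log_mul, ih fun y hy => h3 y (Multiset.mem_cons_of_mem hy)]
    · exact norm_ne_zero_iff.2 (h3 a (Multiset.mem_cons_self a s))
    · refine norm_ne_zero_iff.2 (Multiset.prod_ne_zero fun h => ?_)
      obtain ⟨y, hy, hy0⟩ := Multiset.mem_map.1 h
      exact h3 y (Multiset.mem_cons_of_mem hy) hy0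

lemma logForm_pencil_ne (hA : A.Monic) (hD : A.natDegree = D) (hB : B.natDegree < D)
    (hR : resultant A B D D ≠ 0) {c c' : ℂ} (hc : c ≠ c') (ε : ℝ) :
    D * Real.log ‖c - c'‖ + Real.log ‖resultant A B D D‖ ≤
      logForm ε (rootMeasure (A - C c * B)) (rootMeasure (A - C c' * B)) := by
  obtain ⟨h3, h4⟩ := log_resultant_pencil hA hD hB hR c
  obtain ⟨hm, hd⟩ := pencil_monic hA hD hB c
  rw [logForm_rootMeasure_rootMeasure]
  have hc' : 0 < ‖c - c'‖ := norm_pos_iff.2 (sub_ne_zero.2 hc)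
  have key : ∀ y ∈ (A - C c * B).roots, Real.log ‖c - c'‖ + Real.log ‖B.eval y‖ ≤
      ((A - C c' * B).roots.map fun y' => logKer ε y y').sum := by
    intro y hy
    have hy0 : A.eval y - c * B.eval y = 0 := by simpa using isRoot_of_mem_roots hy
    have he : (A - C c' * B).eval y = (c - c') * B.eval y := by
      simp only [eval_sub, eval_mul, eval_C]
      linear_combination hy0
    rw [← Real.log_mul hc'.ne' (norm_ne_zero_iff.2 (h3 y hy)), ← norm_mul, ← he]
    refine log_norm_eval_le (pencil_monic hA hD hB c').1 ?_ ε
    rw [he]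
    exact mul_ne_zero (sub_ne_zero.2 hc) (h3 y hy)
  refine le_trans (le_of_eq ?_) (Multiset.sum_map_le_sum_map _ _ key)
  rw [Multiset.sum_map_add, h4]
  simp [IsAlgClosed.card_roots_eq_natDegree, hd]

lemma logForm_rootMeasure_ge {ε : ℝ} (hε : 0 < ε) (P : ℂ[X]) :
    P.natDegree ^ 2 * Real.log ε ≤ logForm ε (rootMeasure P) (rootMeasure P) := by
  rw [logForm_rootMeasure_rootMeasure]
  refine le_trans (le_of_eq ?_) (Multiset.sum_map_le_sum_map (fun _ => P.natDegree * Real.log ε) _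
    fun y _ => le_trans (le_of_eq ?_)
      (Multiset.sum_map_le_sum_map (fun _ => Real.log ε) _ fun y' _ => log_le_logKer hε y y'))
  · simp [IsAlgClosed.card_roots_eq_natDegree]; ring
  · simp [IsAlgClosed.card_roots_eq_natDegree]

end Pencil

lemma sum_log_roots_of_unity {k : ℕ} (hk : 0 < k) {ζ : ℂ} (hζ : ζ ∈ nthRootsFinset k (1 : ℂ)) :
    0 ≤ ∑ ξ ∈ (nthRootsFinset k (1 : ℂ)).erase ζ, Real.log ‖ζ - ξ‖ := by
  have h1 := X_pow_sub_one_eq_prod hk (Complex.isPrimitiveRoot_exp k hk.ne')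
  have h2 := Lagrange.eval_nodal_derivative_eval_node_eq (v := id) hζ
  rw [Lagrange.nodal] at h2
  simp only [id] at h2
  rw [← h1, Lagrange.eval_nodal] at h2
  have hz : ζ ^ k = 1 := (mem_nthRootsFinset hk (1 : ℂ)).1 hζ
  have hn : ‖ζ‖ = 1 := Complex.norm_eq_one_of_pow_eq_one hz hk.ne'
  rw [← Real.log_prod, ← norm_prod]
  · have : ∏ ξ ∈ (nthRootsFinset k (1 : ℂ)).erase ζ, (ζ - ξ) = k * ζ ^ (k - 1) := by
      simp only [id] at h2
      rw [← h2]; simp [derivative_X_pow]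
    rw [this, norm_mul, norm_pow, hn]
    simp only [Complex.norm_natCast, one_pow, mul_one]
    exact Real.log_natCast_nonneg k
  · intro ξ hξ
    exact norm_ne_zero_iff.2 (sub_ne_zero.2 (Finset.ne_of_mem_erase hξ).symm)

lemma exists_root_config {A B : ℂ[X]} {D : ℕ} (hA : A.Monic) (hD : A.natDegree = D)
    (hB : B.natDegree < D) (hR : resultant A B D D ≠ 0) {k : ℕ} (hk : 0 < k) (p : ℂ) :
    ∃ P : ℂ[X], P.Monic ∧ P.natDegree = k * D ∧
      (∀ z, ‖P.eval z‖ ≤ 2 * max ‖A.eval z‖ ‖B.eval z‖ ^ k) ∧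
      max ‖A.eval p‖ ‖B.eval p‖ ^ k ≤ ‖P.eval p‖ ∧
      ∀ ε : ℝ, 0 < ε → k * (k - 1) * Real.log ‖resultant A B D D‖ + k * D ^ 2 * Real.log ε ≤
        logForm ε (rootMeasure P) (rootMeasure P) := by
  obtain ⟨u, hu, hup⟩ : ∃ u : ℂ, ‖u‖ = 1 ∧
      max ‖A.eval p‖ ‖B.eval p‖ ^ k ≤ ‖A.eval p ^ k - u * B.eval p ^ k‖ := by
    by_contra! hcon
    have h1 := hcon 1 (by simp)
    have h2 := hcon (-1) (by simp)
    have h3 : ‖A.eval p‖ ^ k ≤ (‖A.eval p ^ k - 1 * B.eval p ^ k‖ +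
        ‖A.eval p ^ k - -1 * B.eval p ^ k‖) / 2 := by
      have : (2 : ℂ) * A.eval p ^ k = (A.eval p ^ k - 1 * B.eval p ^ k) +
        (A.eval p ^ k - -1 * B.eval p ^ k) := by ring
      have h := norm_add_le (A.eval p ^ k - 1 * B.eval p ^ k) (A.eval p ^ k - -1 * B.eval p ^ k)
      rw [← this, norm_mul, norm_pow] at h
      norm_num at h ⊢; linarith
    have h4 : ‖B.eval p‖ ^ k ≤ (‖A.eval p ^ k - 1 * B.eval p ^ k‖ +
        ‖A.eval p ^ k - -1 * B.eval p ^ k‖) / 2 := by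
      have : (2 : ℂ) * B.eval p ^ k = (A.eval p ^ k - -1 * B.eval p ^ k) -
        (A.eval p ^ k - 1 * B.eval p ^ k) := by ring
      have h := norm_sub_le (A.eval p ^ k - -1 * B.eval p ^ k) (A.eval p ^ k - 1 * B.eval p ^ k)
      rw [← this, norm_mul, norm_pow] at h
      norm_num at h ⊢; linarith
    rcases max_cases ‖A.eval p‖ ‖B.eval p‖ with ⟨h, _⟩ | ⟨h, _⟩ <;> rw [h] at h1 h2 <;> linarith
  obtain ⟨w, hw⟩ := IsAlgClosed.exists_pow_nat_eq u hk
  have hwn : ‖w‖ = 1 := by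
    have : ‖w‖ ^ k = 1 := by rw [← norm_pow, hw, hu]
    exact (pow_eq_one_iff_of_nonneg (norm_nonneg w) hk.ne').1 this
  have hw0 : w ≠ 0 := by rintro rfl; simp at hwn
  set Z := nthRootsFinset k (1 : ℂ) with hZ
  have hprim := Complex.isPrimitiveRoot_exp k hk.ne'
  have hcard : Z.card = k := hprim.card_nthRootsFinset
  set P : ℂ[X] := ∏ ζ ∈ Z, (A - C (ζ * w) * B) with hPdef
  have hev : ∀ z, P.eval z = A.eval z ^ k - u * B.eval z ^ k := by
    intro z
    rw [hPdef, eval_prod, ← hw, ← mul_pow, hprim.pow_sub_pow_eq_prod_sub_mul _ _ hk]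
    refine Finset.prod_congr rfl fun ζ _ => ?_
    simp; ring
  have hmonic : P.Monic := monic_prod_of_monic _ _ fun ζ _ => (pencil_monic hA hD hB _).1
  have hroot : rootMeasure P = ∑ ζ ∈ Z, rootMeasure (A - C (ζ * w) * B) := by
    rw [rootMeasure, roots_prod _ _ hmonic.ne_zero, Multiset.map_bind, Multiset.sum_bind]
    rfl
  refine ⟨P, hmonic, ?_, ?_, ?_, ?_⟩
  · rw [hPdef, natDegree_prod_of_monic _ _ fun ζ _ => (pencil_monic hA hD hB _).1,
      Finset.sum_congr rfl fun ζ _ => (pencil_monic hA hD hB _).2]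
    simp [hcard]
  · intro z
    rw [hev]
    refine (norm_sub_le _ _).trans ?_
    rw [norm_mul, hu, one_mul, norm_pow, norm_pow, two_mul]
    gcongr
    · exact le_max_left _ _
    · exact le_max_right _ _
  · rwa [hev]
  · intro ε hε
    rw [hroot]
    simp only [map_sum, LinearMap.sum_apply]
    have hone : ∀ ζ ∈ Z, (k - 1) * Real.log ‖resultant A B D D‖ + D ^ 2 * Real.log ε ≤
        ∑ ξ ∈ Z, logForm ε (rootMeasure (A - C (ξ * w) * B)) (rootMeasure (A - C (ζ * w) * B)) := by
      intro ζ hζ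
      rw [← Finset.add_sum_erase _ _ hζ]
      have h1 := logForm_rootMeasure_ge hε (A - C (ζ * w) * B)
      rw [(pencil_monic hA hD hB _).2] at h1
      have h2 : ∑ ξ ∈ Z.erase ζ, (D * Real.log ‖ζ - ξ‖ + Real.log ‖resultant A B D D‖) ≤
          ∑ ξ ∈ Z.erase ζ, logForm ε (rootMeasure (A - C (ξ * w) * B))
            (rootMeasure (A - C (ζ * w) * B)) := by
        refine Finset.sum_le_sum fun ξ hξ => ?_
        have hne : ξ ≠ ζ := Finset.ne_of_mem_erase hξ
        have := logForm_pencil_ne hA hD hB hR (c := ξ * w) (c' := ζ * w)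
          (fun h => hne (mul_right_cancel₀ hw0 h)) ε
        rwa [← sub_mul, norm_mul, hwn, mul_one, norm_sub_rev] at this
      rw [Finset.sum_add_distrib, ← Finset.mul_sum, Finset.sum_const, Finset.card_erase_of_mem hζ,
        hcard, nsmul_eq_mul, Nat.cast_sub hk] at h2
      have h3 : (0 : ℝ) ≤ D * ∑ ξ ∈ Z.erase ζ, Real.log ‖ζ - ξ‖ :=
        mul_nonneg D.cast_nonneg (sum_log_roots_of_unity hk hζ)
      push_cast at h2
      linarith
    refine le_trans (le_of_eq ?_) (Finset.sum_le_sum hone)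
    rw [Finset.sum_const, hcard, nsmul_eq_mul]; ring

lemma logKer_le_circleAverage {η : ℝ} (hη : 0 < η) {ε : ℝ} (hε : 0 < ε) (z y : ℂ) :
    logKer ε z y ≤ Real.circleAverage (fun u => Real.log ‖u - y‖) z η + ε ^ 2 / (2 * η ^ 2) := by
  rw [circleAverage_log_norm_sub_const_eq_log_radius_add_posLog hη.ne', logKer]
  set d := ‖z - y‖ with hd
  have hd0 : 0 ≤ d := norm_nonneg _
  set m := max d η with hm
  have hm0 : 0 < m := lt_max_of_lt_right hη
  have h1 : Real.log m ≤ Real.log η + Real.posLog (η⁻¹ * d) := by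
    rcases le_total d η with h | h
    · rw [hm, max_eq_right h]
      linarith [Real.posLog_nonneg (x := η⁻¹ * d)]
    · rw [hm, max_eq_left h]
      have hdp : 0 < d := hη.trans_le h
      have h2 : Real.log (η⁻¹ * d) ≤ Real.posLog (η⁻¹ * d) := le_max_right _ _
      rw [Real.log_mul (by positivity) hdp.ne', Real.log_inv] at h2
      linarith
  have h2 : d ^ 2 + ε ^ 2 ≤ m ^ 2 * (1 + ε ^ 2 / η ^ 2) := by
    have e1 : d ^ 2 ≤ m ^ 2 := by gcongr; exact le_max_left _ _
    have e2 : η ^ 2 ≤ m ^ 2 := by gcongr; exact le_max_right _ _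
    have e3 : ε ^ 2 = η ^ 2 * (ε ^ 2 / η ^ 2) := by field_simp
    have e4 : η ^ 2 * (ε ^ 2 / η ^ 2) ≤ m ^ 2 * (ε ^ 2 / η ^ 2) := by gcongr
    nlinarith
  have h3 : Real.log (1 + ε ^ 2 / η ^ 2) ≤ ε ^ 2 / η ^ 2 := by
    have := Real.log_le_sub_one_of_pos (show (0 : ℝ) < 1 + ε ^ 2 / η ^ 2 by positivity)
    linarith
  have h4 : Real.log (d ^ 2 + ε ^ 2) ≤ 2 * Real.log m + ε ^ 2 / η ^ 2 := by
    refine (Real.log_le_log (by positivity) h2).trans ?_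
    rw [Real.log_mul (by positivity) (by positivity), Real.log_pow]
    push_cast; linarith
  have : ε ^ 2 / (2 * η ^ 2) = 1 / 2 * (ε ^ 2 / η ^ 2) := by field_simp
  rw [this]; linarith

lemma circleAverage_multiset_sum_log (s : Multiset ℂ) (c : ℂ) (r : ℝ) :
    CircleIntegrable (fun u => (s.map fun y => Real.log ‖u - y‖).sum) c r ∧
    Real.circleAverage (fun u => (s.map fun y => Real.log ‖u - y‖).sum) c r =
      (s.map fun y => Real.circleAverage (fun u => Real.log ‖u - y‖) c r).sum := by
  induction s using Multiset.induction_on with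
  | empty =>
    simp only [Multiset.map_zero, Multiset.sum_zero]
    exact ⟨circleIntegrable_const 0 c r, Real.circleAverage_const 0 c r⟩
  | cons a s ih =>
    simp only [Multiset.map_cons, Multiset.sum_cons]
    have h1 : CircleIntegrable (fun u => Real.log ‖u - a‖) c r :=
      circleIntegrable_log_norm_sub_const r
    exact ⟨h1.add ih.1, by rw [Real.circleAverage_fun_add h1 ih.1, ih.2]⟩

lemma sum_logKer_le {P : ℂ[X]} (hP : P.Monic) {z : ℂ} {η H ε : ℝ} (hη : 0 < η) (hε : 0 < ε)
    (hH : ∀ u, ‖u - z‖ ≤ η → P.eval u ≠ 0 → Real.log ‖P.eval u‖ ≤ H) :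
    (P.roots.map fun y => logKer ε z y).sum ≤ H + P.natDegree * (2 * ε ^ 2 / η ^ 2) := by
  obtain ⟨r, ⟨hr1, hr2⟩, hr⟩ := (Set.Ioo_infinite (half_lt_self hη)).exists_notMem_finset
    (P.roots.toFinset.image fun y => ‖y - z‖)
  have hr0 : 0 < r := (half_pos hη).trans hr1
  obtain ⟨h1, h2⟩ := circleAverage_multiset_sum_log P.roots z r
  have h3 : Real.circleAverage (fun u => (P.roots.map fun y => Real.log ‖u - y‖).sum) z r ≤ H := by
    refine Real.circleAverage_mono_on_of_le_circle h1 fun u hu => ?_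
    rw [mem_sphere_iff_norm, abs_of_pos hr0] at hu
    have hu0 : P.eval u ≠ 0 := by
      intro h0
      exact hr (Finset.mem_image.2 ⟨u, by simpa [hP.ne_zero] using h0, hu⟩)
    rw [← log_norm_eval_eq hP hu0]
    exact hH u (by linarith) hu0
  rw [h2] at h3
  have h4 := Multiset.sum_map_le_sum_map _ _
    fun y (_ : y ∈ P.roots) => logKer_le_circleAverage hr0 hε z y
  rw [Multiset.sum_map_add] at h4
  simp only [Multiset.map_const', Multiset.sum_replicate, nsmul_eq_mul,
    IsAlgClosed.card_roots_eq_natDegree] at h4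
  have h5 : ε ^ 2 / (2 * r ^ 2) ≤ 2 * ε ^ 2 / η ^ 2 := by
    rw [div_le_div_iff₀ (by positivity) (by positivity)]
    have : η ^ 2 ≤ (2 * r) ^ 2 := by gcongr; linarith
    nlinarith [sq_nonneg ε]
  have h6 : (P.natDegree : ℝ) * (ε ^ 2 / (2 * r ^ 2)) ≤ P.natDegree * (2 * ε ^ 2 / η ^ 2) := by
    gcongr
  linarith

/-- The sum of point masses at finitely many points. -/
noncomputable def pointMeasure {M : ℕ} (z : Fin M → ℂ) : ℂ →₀ ℝ := ∑ i, Finsupp.single (z i) 1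

lemma mass_pointMeasure {M : ℕ} (z : Fin M → ℂ) : mass (pointMeasure z) = M := by
  simp [pointMeasure, mass_single]

lemma logForm_pointMeasure_ge {M : ℕ} {z : Fin M → ℂ} (hz : Function.Injective z) {ε : ℝ}
    (hε : 0 < ε) : 2 * Real.log ‖(Matrix.vandermonde z).det‖ + M * Real.log ε ≤
      logForm ε (pointMeasure z) (pointMeasure z) := by
  have h1 : Real.log ‖(Matrix.vandermonde z).det‖ =
      ∑ i, ∑ j ∈ Finset.Ioi i, Real.log ‖z j - z i‖ := by
    have hne : ∀ i, ∀ j ∈ Finset.Ioi i, ‖z j - z i‖ ≠ 0 := fun i j hj =>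
      norm_ne_zero_iff.2 (sub_ne_zero.2 fun h => (Finset.mem_Ioi.1 hj).ne' (hz h))
    rw [Matrix.det_vandermonde, norm_prod, Real.log_prod]
    · refine Finset.sum_congr rfl fun i _ => ?_
      rw [norm_prod, Real.log_prod]
      exact hne i
    · intro i _
      rw [norm_prod]
      exact Finset.prod_ne_zero_iff.2 (hne i)
  have h2 : ∑ i, ∑ j ∈ Finset.Ioi i, Real.log ‖z j - z i‖ ≤
      ∑ i, ∑ j ∈ Finset.Ioi i, logKer ε (z i) (z j) := by
    refine Finset.sum_le_sum fun i _ => Finset.sum_le_sum fun j hj => ?_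
    rw [norm_sub_rev]
    exact log_norm_le_logKer fun h => (Finset.mem_Ioi.1 hj).ne (hz h)
  have h3 : logForm ε (pointMeasure z) (pointMeasure z) =
      ∑ i, ∑ j, logKer ε (z i) (z j) := by
    simp only [pointMeasure, map_sum, LinearMap.sum_apply, logForm_single]
    exact Finset.sum_comm
  have h4 : ∑ i, ∑ j, logKer ε (z i) (z j) = ∑ i, ∑ j ∈ Finset.Ioi i, logKer ε (z i) (z j) +
      ∑ i, ∑ j ∈ Finset.Iio i, logKer ε (z i) (z j) + ∑ i, logKer ε (z i) (z i) := by
    rw [← Finset.sum_add_distrib, ← Finset.sum_add_distrib]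
    refine Finset.sum_congr rfl fun i _ => ?_
    have hu : (Finset.univ : Finset (Fin M)) =
        Finset.disjUnion (Finset.disjUnion (Finset.Ioi i) (Finset.Iio i)
          (Finset.disjoint_left.2 fun j h1 h2 => by
            simp only [Finset.mem_Ioi, Finset.mem_Iio] at h1 h2; exact lt_asymm h1 h2)) {i}
          (by simp) := by
      ext j
      simp only [Finset.mem_univ, Finset.disjUnion_eq_union, Finset.mem_union, Finset.mem_Ioi,
        Finset.mem_Iio, Finset.mem_singleton, true_iff]
      rcases lt_trichotomy i j with h | h | h <;> simp [h]
    rw [hu, Finset.sum_disjUnion, Finset.sum_disjUnion, Finset.sum_singleton]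
  have h5 : ∑ i, ∑ j ∈ Finset.Iio i, logKer ε (z i) (z j) =
      ∑ i, ∑ j ∈ Finset.Ioi i, logKer ε (z i) (z j) := by
    rw [Finset.sum_comm' (t' := Finset.univ) (s' := fun j => Finset.Ioi j) (by simp)]
    refine Finset.sum_congr rfl fun i _ => Finset.sum_congr rfl fun j _ => ?_
    rw [logKer_comm]
  have h6 : M * Real.log ε ≤ ∑ i, logKer ε (z i) (z i) := by
    have := Finset.sum_le_sum fun i (_ : i ∈ Finset.univ) => log_le_logKer hε (z i) (z i)
    simpa using this
  rw [h3, h4, h5]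
  linarith

lemma exists_norm_eval_le (P : ℂ[X]) {D : ℕ} (hP : P.natDegree ≤ D) :
    ∃ C : ℝ, 0 ≤ C ∧ ∀ z : ℂ, ‖P.eval z‖ ≤ C * max 1 ‖z‖ ^ D := by
  refine ⟨∑ i ∈ Finset.range (P.natDegree + 1), ‖P.coeff i‖, by positivity, fun z => ?_⟩
  rw [eval_eq_sum_range, Finset.sum_mul]
  refine (norm_sum_le _ _).trans (Finset.sum_le_sum fun i hi => ?_)
  rw [norm_mul, norm_pow]
  gcongr
  calc ‖z‖ ^ i ≤ max 1 ‖z‖ ^ i := by gcongr; exact le_max_right _ _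
    _ ≤ max 1 ‖z‖ ^ D := pow_le_pow_right₀ (le_max_left _ _)
      ((Nat.lt_succ_iff.1 (Finset.mem_range.1 hi)).trans hP)

lemma exists_norm_eval_sub_le (P : ℂ[X]) {D : ℕ} (hP : P.natDegree ≤ D) :
    ∃ C : ℝ, 0 ≤ C ∧ ∀ z u : ℂ, ‖u - z‖ ≤ 1 →
      ‖P.eval u - P.eval z‖ ≤ C * max 1 ‖z‖ ^ D * ‖u - z‖ := by
  obtain ⟨C, hC, h⟩ := exists_norm_eval_le (derivative P)
    ((natDegree_derivative_le P).trans ((Nat.sub_le _ _).trans hP))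
  refine ⟨C * 2 ^ D, by positivity, fun z u hu => ?_⟩
  refine (convex_closedBall z 1).norm_image_sub_le_of_norm_deriv_le (f := fun w => P.eval w)
    (fun w _ => P.differentiableAt) (fun w hw => ?_) (Metric.mem_closedBall_self zero_le_one)
    (by rwa [mem_closedBall_iff_norm])
  rw [Polynomial.deriv]
  refine (h w).trans ?_
  rw [mul_assoc, ← mul_pow]
  rw [mem_closedBall_iff_norm] at hw
  have h1 : ‖w‖ ≤ ‖w - z‖ + ‖z‖ := by simpa using norm_add_le (w - z) z
  have h2 : max 1 ‖w‖ ≤ 2 * max 1 ‖z‖ := by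
    have := le_max_left 1 ‖z‖
    have := le_max_right 1 ‖z‖
    exact max_le (by linarith) (by linarith)
  gcongr

lemma exists_modulus {A B : ℂ[X]} {D : ℕ} (hA : A.Monic) (hD : A.natDegree = D) (hD0 : 0 < D)
    (hB : B.natDegree < D) (hAB : IsCoprime A B) {δ : ℝ} (hδ : 0 < δ) :
    ∃ η : ℝ, 0 < η ∧ ∀ z u : ℂ, ‖u - z‖ ≤ η →
      Real.log (max ‖A.eval u‖ ‖B.eval u‖) ≤ Real.log (max ‖A.eval z‖ ‖B.eval z‖) + δ := by
  obtain ⟨κ, hκ, hlow⟩ := exists_lower_complex hA hD hD0 hB hAB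
  obtain ⟨C₁, hC₁, h₁⟩ := exists_norm_eval_sub_le A hD.le
  obtain ⟨C₂, hC₂, h₂⟩ := exists_norm_eval_sub_le B hB.le
  set C := C₁ + C₂ with hC
  have hC0 : 0 ≤ C := by positivity
  refine ⟨min 1 (δ / (C * κ + 1)), by positivity, fun z u hu => ?_⟩
  have hu1 : ‖u - z‖ ≤ 1 := hu.trans (min_le_left _ _)
  have hu2 : ‖u - z‖ ≤ δ / (C * κ + 1) := hu.trans (min_le_right _ _)
  have hpos : ∀ w, 0 < max ‖A.eval w‖ ‖B.eval w‖ := fun w => by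
    have h1 : 0 < max 1 ‖w‖ ^ D := by positivity
    by_contra! hcon
    nlinarith [hlow w]
  set m := max ‖A.eval z‖ ‖B.eval z‖ with hm
  have hm0 : 0 < m := hpos z
  set X := max 1 ‖z‖ ^ D with hX
  have hX0 : 0 ≤ X := by positivity
  have hstep : max ‖A.eval u‖ ‖B.eval u‖ ≤ m * (1 + C * κ * ‖u - z‖) := by
    have e : C * X * ‖u - z‖ ≤ m * (C * κ * ‖u - z‖) := by
      calc C * X * ‖u - z‖ ≤ C * (κ * m) * ‖u - z‖ := by gcongr; exact hlow z
        _ = _ := by ring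
    have e1 : C₁ * X * ‖u - z‖ ≤ C * X * ‖u - z‖ := by gcongr; linarith
    have e2 : C₂ * X * ‖u - z‖ ≤ C * X * ‖u - z‖ := by gcongr; linarith
    refine max_le ?_ ?_
    · have a1 := h₁ z u hu1
      have a2 : ‖A.eval u‖ ≤ ‖A.eval u - A.eval z‖ + ‖A.eval z‖ := by
        simpa using norm_add_le (A.eval u - A.eval z) (A.eval z)
      have a3 : ‖A.eval z‖ ≤ m := le_max_left _ _
      linarith
    · have a1 := h₂ z u hu1
      have a2 : ‖B.eval u‖ ≤ ‖B.eval u - B.eval z‖ + ‖B.eval z‖ := by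
        simpa using norm_add_le (B.eval u - B.eval z) (B.eval z)
      have a3 : ‖B.eval z‖ ≤ m := le_max_right _ _
      linarith
  refine (Real.log_le_log (hpos u) hstep).trans ?_
  have hq : 0 ≤ C * κ * ‖u - z‖ := by positivity
  rw [Real.log_mul hm0.ne' (by positivity)]
  have h3 := Real.log_le_sub_one_of_pos (show 0 < 1 + C * κ * ‖u - z‖ by positivity)
  have h4 : C * κ * ‖u - z‖ ≤ δ := by
    calc C * κ * ‖u - z‖ ≤ (C * κ + 1) * (δ / (C * κ + 1)) := by gcongr; linarith
      _ = δ := by field_simp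
  linarith

/-- The difference of the normalised counting measures of a point configuration and of the roots
of a polynomial. -/
noncomputable def diffMeasure {M : ℕ} (z : Fin M → ℂ) (P : ℂ[X]) : ℂ →₀ ℝ :=
  (M : ℝ)⁻¹ • pointMeasure z - (P.natDegree : ℝ)⁻¹ • rootMeasure P

lemma mass_diffMeasure {M : ℕ} (hM : 0 < M) (z : Fin M → ℂ) {P : ℂ[X]} (hP : 0 < P.natDegree) :
    mass (diffMeasure z P) = 0 := by
  have h1 : (M : ℝ) ≠ 0 := by positivity
  have h2 : (P.natDegree : ℝ) ≠ 0 := by positivity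
  simp [diffMeasure, mass_pointMeasure, mass_rootMeasure, h1, h2]

lemma sum_logKer_le_of_pencil {A B P : ℂ[X]} {k : ℕ} (hk : 0 < k) (hP : P.Monic)
    (hle : ∀ z, ‖P.eval z‖ ≤ 2 * max ‖A.eval z‖ ‖B.eval z‖ ^ k) {z : ℂ} {η ε H : ℝ}
    (hη : 0 < η) (hε : 0 < ε)
    (hH : ∀ u, ‖u - z‖ ≤ η → Real.log (max ‖A.eval u‖ ‖B.eval u‖) ≤ H) :
    (P.roots.map fun y => logKer ε z y).sum ≤
      k * H + Real.log 2 + P.natDegree * (2 * ε ^ 2 / η ^ 2) := by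
  refine sum_logKer_le hP hη hε fun u hu hu0 => ?_
  have h0 : 0 < ‖P.eval u‖ := norm_pos_iff.2 hu0
  have h1 : 0 < max ‖A.eval u‖ ‖B.eval u‖ := by
    by_contra! hcon
    have h2 : max ‖A.eval u‖ ‖B.eval u‖ = 0 := le_antisymm hcon (le_max_of_le_left (norm_nonneg _))
    have := hle u
    rw [h2, zero_pow hk.ne'] at this
    linarith
  refine (Real.log_le_log h0 (hle u)).trans ?_
  rw [Real.log_mul (by norm_num) (by positivity), Real.log_pow]
  have := mul_le_mul_of_nonneg_left (hH u hu) (k.cast_nonneg : (0 : ℝ) ≤ k)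
  linarith

lemma energy_le {A B P : ℂ[X]} {D k N M : ℕ} (hD0 : 0 < D) (hk : 0 < k) (hM : M = D * (N + 1))
    {z : Fin M → ℂ} (hz : Function.Injective z) (hP : P.Monic) (hPd : P.natDegree = k * D)
    (hle : ∀ z, ‖P.eval z‖ ≤ 2 * max ‖A.eval z‖ ‖B.eval z‖ ^ k) {η ε δ r E : ℝ}
    (hη : 0 < η) (hε : 0 < ε)
    (hen : k * (k - 1) * r + k * D ^ 2 * Real.log ε ≤ logForm ε (rootMeasure P) (rootMeasure P))
    (hmod : ∀ z u : ℂ, ‖u - z‖ ≤ η →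
      Real.log (max ‖A.eval u‖ ‖B.eval u‖) ≤ Real.log (max ‖A.eval z‖ ‖B.eval z‖) + δ)
    (hG : (N + 1) * ∑ i, Real.log (max ‖A.eval (z i)‖ ‖B.eval (z i)‖) - E ≤
      Real.log ‖(Matrix.vandermonde z).det‖ + N * (N + 1) / 2 * r) :
    -logForm ε (diffMeasure z P) (diffMeasure z P) ≤
      -Real.log ε / M - Real.log ε / k + (1 / k - 1 / (N + 1)) * r / D ^ 2 + 2 * E / M ^ 2 +
        2 * δ / D + 2 * Real.log 2 / (k * D) + 4 * ε ^ 2 / η ^ 2 := by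
  have hD' : (0 : ℝ) < D := by positivity
  have hk' : (0 : ℝ) < k := by positivity
  have hN' : (0 : ℝ) < (N : ℝ) + 1 := by positivity
  have hM' : (M : ℝ) = D * (N + 1) := by rw [hM]; push_cast; ring
  have hM0 : (0 : ℝ) < M := by rw [hM']; positivity
  have hSS := logForm_pointMeasure_ge hz hε
  set V := Real.log ‖(Matrix.vandermonde z).det‖
  set Sh := ∑ i, Real.log (max ‖A.eval (z i)‖ ‖B.eval (z i)‖)
  set SS := logForm ε (pointMeasure z) (pointMeasure z)
  set YY := logForm ε (rootMeasure P) (rootMeasure P)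
  have hSY : logForm ε (rootMeasure P) (pointMeasure z) ≤
      k * Sh + M * (k * δ + Real.log 2 + k * D * (2 * ε ^ 2 / η ^ 2)) := by
    rw [pointMeasure, map_sum]
    refine (Finset.sum_le_sum fun i _ => ?_).trans_eq (b := ∑ i,
      (k * (Real.log (max ‖A.eval (z i)‖ ‖B.eval (z i)‖) + δ) + Real.log 2 +
        P.natDegree * (2 * ε ^ 2 / η ^ 2))) ?_
    · rw [logForm_rootMeasure_single]
      exact sum_logKer_le_of_pencil hk hP hle hη hε (hmod (z i))
    · simp only [Finset.sum_add_distrib, ← Finset.mul_sum, Finset.sum_const, Finset.card_univ,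
        Fintype.card_fin, nsmul_eq_mul, hPd, Nat.cast_mul]
      ring
  set SY := logForm ε (rootMeasure P) (pointMeasure z)
  have hexp : -logForm ε (diffMeasure z P) (diffMeasure z P) =
      -(SS / M ^ 2) + 2 * SY / (M * (k * D)) - YY / (k * D) ^ 2 := by
    simp only [diffMeasure, map_sub, map_smul, LinearMap.sub_apply, LinearMap.smul_apply,
      smul_eq_mul, hPd, logForm_comm ε (pointMeasure z) (rootMeasure P)]
    push_cast
    field_simp
    ring
  have h1 : (2 * V + M * Real.log ε) / M ^ 2 ≤ SS / M ^ 2 := by gcongr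
  have h2 : (k * (k - 1) * r + k * D ^ 2 * Real.log ε) / (k * D) ^ 2 ≤ YY / (k * D) ^ 2 := by gcongr
  have h3 : Sh ≤ (V + N * (N + 1) / 2 * r + E) / (N + 1) := by
    rw [le_div_iff₀ hN']; linarith
  have h4 : 2 * SY / (M * (k * D)) ≤ 2 * (k * ((V + N * (N + 1) / 2 * r + E) / (N + 1)) +
      M * (k * δ + Real.log 2 + k * D * (2 * ε ^ 2 / η ^ 2))) / (M * (k * D)) := by
    gcongr
    refine hSY.trans ?_
    gcongr
  rw [hexp]
  refine (add_le_add (add_le_add (neg_le_neg h1) h4) (neg_le_neg h2)).trans_eq ?_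
  rw [hM']
  field_simp
  ring

lemma potential_sub_le {A B P : ℂ[X]} {D k M : ℕ} (hD0 : 0 < D) (hk : 0 < k) (hM : 0 < M)
    (z : Fin M → ℂ) (hP : P.Monic) (hPd : P.natDegree = k * D)
    (hle : ∀ z, ‖P.eval z‖ ≤ 2 * max ‖A.eval z‖ ‖B.eval z‖ ^ k) {p₁ p₂ : ℂ}
    (hp₁ : max ‖A.eval p₁‖ ‖B.eval p₁‖ ^ k ≤ ‖P.eval p₁‖)
    (hpos : 0 < max ‖A.eval p₁‖ ‖B.eval p₁‖) {η ε t Q H : ℝ}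
    (hη : 0 < η) (hε : 0 < ε) (ht : 0 < t)
    (hQ : -logForm ε (diffMeasure z P) (diffMeasure z P) ≤ Q)
    (hH : ∀ u, ‖u - p₂‖ ≤ η → Real.log (max ‖A.eval u‖ ‖B.eval u‖) ≤ H) :
    (∑ i, logKer ε (z i) p₂ - ∑ i, logKer ε (z i) p₁) / M ≤
      (H - Real.log (max ‖A.eval p₁‖ ‖B.eval p₁‖)) / D + Real.log 2 / (k * D) +
        2 * ε ^ 2 / η ^ 2 + Q / (2 * t) + t / 2 *
          -logForm ε (Finsupp.single p₂ 1 - Finsupp.single p₁ 1)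
            (Finsupp.single p₂ 1 - Finsupp.single p₁ 1) := by
  have hD' : (0 : ℝ) < D := by positivity
  have hk' : (0 : ℝ) < k := by positivity
  have hM0 : (0 : ℝ) < M := by positivity
  have hd0 : 0 < P.natDegree := by rw [hPd]; positivity
  have hcs := logForm_cauchy hε (mass_diffMeasure hM z hd0)
    (ν := Finsupp.single p₂ 1 - Finsupp.single p₁ 1) (by simp [mass_single]) (t := t)
  set W := logForm ε (Finsupp.single p₂ 1 - Finsupp.single p₁ 1)
            (Finsupp.single p₂ 1 - Finsupp.single p₁ 1)
  have hS : ∀ p, logForm ε (diffMeasure z P) (Finsupp.single p 1) =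
      (∑ i, logKer ε (z i) p) / M - (P.roots.map fun y => logKer ε p y).sum / (k * D) := by
    intro p
    rw [diffMeasure, map_sub, LinearMap.sub_apply, map_smul, map_smul, LinearMap.smul_apply,
      LinearMap.smul_apply, logForm_rootMeasure_single, pointMeasure, map_sum, LinearMap.sum_apply]
    simp only [logForm_single, smul_eq_mul, hPd, Nat.cast_mul]
    ring
  rw [map_sub, hS, hS] at hcs
  have hY2 := sum_logKer_le_of_pencil hk hP hle hη hε hH
  have hY1 : k * Real.log (max ‖A.eval p₁‖ ‖B.eval p₁‖) ≤
      (P.roots.map fun y => logKer ε p₁ y).sum := by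
    have h0 : P.eval p₁ ≠ 0 := norm_pos_iff.1 (lt_of_lt_of_le (by positivity) hp₁)
    refine le_trans ?_ (log_norm_eval_le hP h0 ε)
    rw [← Real.log_pow]
    exact Real.log_le_log (by positivity) hp₁
  set Y2 := (P.roots.map fun y => logKer ε p₂ y).sum
  set Y1 := (P.roots.map fun y => logKer ε p₁ y).sum
  have h1 : (Y2 - Y1) / (k * D) ≤ (H - Real.log (max ‖A.eval p₁‖ ‖B.eval p₁‖)) / D +
      Real.log 2 / (k * D) + 2 * ε ^ 2 / η ^ 2 := by
    rw [hPd] at hY2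
    push_cast at hY2
    have : (Y2 - Y1) / (k * D) ≤ ((k * H + Real.log 2 + k * D * (2 * ε ^ 2 / η ^ 2)) -
        k * Real.log (max ‖A.eval p₁‖ ‖B.eval p₁‖)) / (k * D) := by gcongr
    refine this.trans_eq ?_
    field_simp
    ring
  have h2 : (∑ i, logKer ε (z i) p₂) / M - Y2 / (k * D) - ((∑ i, logKer ε (z i) p₁) / M -
      Y1 / (k * D)) ≤ Q / (2 * t) + t / 2 * -W := by
    have : Q / (2 * t) + t / 2 * -W = (Q - t ^ 2 * W) / (2 * t) := by field_simp; ring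
    rw [this, le_div_iff₀ (by positivity)]
    linarith
  have h3 : (∑ i, logKer ε (z i) p₂ - ∑ i, logKer ε (z i) p₁) / M =
    ((∑ i, logKer ε (z i) p₂) / M - Y2 / (k * D) - ((∑ i, logKer ε (z i) p₁) / M -
      Y1 / (k * D))) + (Y2 - Y1) / (k * D) := by ring
  rw [h3]
  linarith

lemma exists_forall_error_le (a b : ℝ) {θ : ℝ} (hθ : 0 < θ) :
    ∃ M₀ : ℕ, ∀ M : ℕ, M₀ ≤ M → a / M + 2 * b * Real.log M.factorial / M ^ 2 ≤ θ := by
  have h1 : Filter.Tendsto (fun x : ℝ => a / x + 2 * |b| * (Real.log x / x)) Filter.atTop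
      (nhds (0 + 2 * |b| * 0)) :=
    (Filter.tendsto_id.const_div_atTop a).add
      ((Real.isLittleO_log_id_atTop.tendsto_div_nhds_zero).const_mul _)
  have h2 := (h1.comp tendsto_natCast_atTop_atTop).eventually
    (Iic_mem_nhds (show 0 + 2 * |b| * 0 < θ by simpa using hθ))
  obtain ⟨M₀, hM₀⟩ := Filter.eventually_atTop.1 h2
  refine ⟨max M₀ 1, fun M hM => ?_⟩
  have hM1 : 0 < M := (le_max_right _ _).trans hM
  have hM0 : (0 : ℝ) < M := by positivity
  refine le_trans ?_ (hM₀ M ((le_max_left _ _).trans hM))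
  simp only [Function.comp]
  have h3 : Real.log M.factorial ≤ M * Real.log M := by
    rw [← Real.log_pow]
    exact Real.log_le_log (by positivity) (by exact_mod_cast M.factorial_le_pow)
  have h4 : 0 ≤ Real.log M.factorial := Real.log_natCast_nonneg _
  gcongr
  calc 2 * b * Real.log M.factorial / M ^ 2 ≤ 2 * |b| * (M * Real.log M) / M ^ 2 := by
        gcongr
        exact le_abs_self b
    _ = _ := by field_simp

lemma max_norm_eval_pos {A B : ℂ[X]} (hAB : IsCoprime A B) (p : ℂ) :
    0 < max ‖A.eval p‖ ‖B.eval p‖ := by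
  obtain ⟨u, v, h⟩ := hAB
  have h1 := congrArg (eval p) h
  simp only [eval_add, eval_mul, eval_one] at h1
  by_contra! hcon
  have hA : A.eval p = 0 := norm_le_zero_iff.1 ((le_max_left _ _).trans hcon)
  have hB : B.eval p = 0 := norm_le_zero_iff.1 ((le_max_right _ _).trans hcon)
  simp [hA, hB] at h1

set_option maxHeartbeats 1000000 in
theorem potential_le {A B : ℕ → ℂ[X]} {D : ℕ → ℕ} (hA : ∀ n, (A n).Monic)
    (hD : ∀ n, (A n).natDegree = D n) (hD0 : ∀ n, 0 < D n) (hB : ∀ n, (B n).natDegree < D n)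
    (hAB : ∀ n, IsCoprime (A n) (B n)) (hR : ∀ n, resultant (A n) (B n) (D n) (D n) ≠ 0)
    (hDlim : Filter.Tendsto (fun n => (D n : ℝ)) Filter.atTop Filter.atTop) {p₁ p₂ : ℂ} {g₁ g₂ : ℝ}
    (hup : ∀ τ > 0, ∃ η > 0, ∃ n₀, ∀ n ≥ n₀, ∀ u, ‖u - p₂‖ ≤ η →
      Real.log (max ‖(A n).eval u‖ ‖(B n).eval u‖) ≤ D n * (g₂ + τ))
    (hlow : ∀ τ > 0, ∃ n₀, ∀ n ≥ n₀,
      D n * (g₁ - τ) ≤ Real.log (max ‖(A n).eval p₁‖ ‖(B n).eval p₁‖))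
    (C₀ C₁ : ℝ) {τ : ℝ} (hτ : 0 < τ) :
    ∃ ε₁ > 0, ∀ ε₀, 0 < ε₀ → ε₀ ≤ ε₁ → ∃ n₁, ∀ n ≥ n₁, ∀ Cn : ℝ, ∃ N₁, ∀ N ≥ N₁, ∀ M : ℕ,
      M = D n * (N + 1) → ∀ z : Fin M → ℂ, Function.Injective z →
      (N + 1) * ∑ i, Real.log (max ‖(A n).eval (z i)‖ ‖(B n).eval (z i)‖) -
          (C₀ * (N + 1) * M + Cn * M + C₁ * Real.log M.factorial) ≤
        Real.log ‖(Matrix.vandermonde z).det‖ +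
          N * (N + 1) / 2 * Real.log ‖resultant (A n) (B n) (D n) (D n)‖ →
      (∑ i, logKer ε₀ (z i) p₂ - ∑ i, logKer ε₀ (z i) p₁) / M ≤ g₂ - g₁ + τ := by
  obtain ⟨η₀, hη₀, n₂, hn₂⟩ := hup (τ / 6) (by positivity)
  obtain ⟨n₃, hn₃⟩ := hlow (τ / 6) (by positivity)
  refine ⟨η₀ * min 1 (τ / 12), by positivity, fun ε₀ hε₀ hε₁ => ?_⟩
  have hε₀η : 2 * ε₀ ^ 2 / η₀ ^ 2 ≤ τ / 6 := by
    rw [div_le_iff₀ (by positivity)]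
    have h1 : ε₀ ^ 2 ≤ (η₀ * min 1 (τ / 12)) ^ 2 := by gcongr
    have h2 : (min 1 (τ / 12)) ^ 2 ≤ τ / 12 := by
      have h3 : 0 < min 1 (τ / 12) := by positivity
      nlinarith [min_le_left 1 (τ / 12), min_le_right 1 (τ / 12)]
    nlinarith [sq_nonneg η₀]
  set W := -logForm ε₀ (Finsupp.single p₂ 1 - Finsupp.single p₁ 1)
            (Finsupp.single p₂ 1 - Finsupp.single p₁ 1) with hW
  have hW0 : 0 ≤ W := by
    have := logForm_self_nonpos hε₀ (μ := Finsupp.single p₂ 1 - Finsupp.single p₁ 1)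
      (by simp [mass_single])
    linarith
  set t := τ / 3 / (W + 1) with ht
  have ht0 : 0 < t := by positivity
  have htW : t / 2 * W ≤ τ / 6 := by
    have : t * (W + 1) = τ / 3 := by rw [ht]; field_simp
    nlinarith
  set θ := t * τ / 3 with hθ
  have hθ0 : 0 < θ := by positivity
  have hθt : θ / (2 * t) = τ / 6 := by rw [hθ]; field_simp; norm_num
  obtain ⟨n₄, hn₄⟩ := Filter.eventually_atTop.1 (hDlim.eventually_ge_atTop (10 * |C₀| / θ))
  refine ⟨max n₂ (max n₃ n₄), fun n hn Cn => ?_⟩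
  have hD1 : (0 : ℝ) < D n := by exact_mod_cast hD0 n
  have hC0 : 2 * C₀ / D n ≤ θ / 5 := by
    have := hn₄ n ((le_max_right _ _).trans ((le_max_right _ _).trans hn))
    rw [div_le_iff₀ hθ0] at this
    rw [div_le_iff₀ hD1]
    have := le_abs_self C₀
    nlinarith
  obtain ⟨η, hη, hmod⟩ := exists_modulus (hA n) (hD n) (hD0 n) (hB n) (hAB n)
    (show 0 < θ * D n / 10 by positivity)
  set ε := min ε₀ (η * min 1 (θ / 20)) with hε
  have hεpos : 0 < ε := by positivity
  have hεη : 4 * ε ^ 2 / η ^ 2 ≤ θ / 5 := by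
    rw [div_le_iff₀ (by positivity)]
    have h1 : ε ^ 2 ≤ (η * min 1 (θ / 20)) ^ 2 := by gcongr; exact min_le_right _ _
    have h2 : (min 1 (θ / 20)) ^ 2 ≤ θ / 20 := by
      have h3 : 0 < min 1 (θ / 20) := by positivity
      nlinarith [min_le_left 1 (θ / 20), min_le_right 1 (θ / 20)]
    nlinarith [sq_nonneg η]
  set r := Real.log ‖resultant (A n) (B n) (D n) (D n)‖ with hr
  obtain ⟨k, hk⟩ := exists_nat_gt (max (Real.log 2 / D n / (τ / 6))
    (|-Real.log ε + r / D n ^ 2 + 2 * Real.log 2 / D n| / (θ / 5)))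
  have hlog2 : 0 < Real.log 2 := Real.log_pos (by norm_num)
  have hk0' : (0 : ℝ) < k := lt_of_le_of_lt (le_max_of_le_left (by positivity)) hk
  have hk0 : 0 < k := by exact_mod_cast hk0'
  have hk1 : Real.log 2 / (k * D n) ≤ τ / 6 := by
    have := (le_max_left _ _).trans hk.le
    rw [div_le_iff₀ (by positivity), div_le_iff₀ hD1] at this
    rw [div_le_iff₀ (by positivity)]
    linarith
  have hk2 : (-Real.log ε + r / D n ^ 2 + 2 * Real.log 2 / D n) / k ≤ θ / 5 := by
    have := (le_max_right _ _).trans hk.le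
    rw [div_le_iff₀ (by positivity)] at this
    rw [div_le_iff₀ hk0']
    linarith [le_abs_self (-Real.log ε + r / D n ^ 2 + 2 * Real.log 2 / D n)]
  obtain ⟨M₀, hM₀⟩ := exists_forall_error_le (-Real.log ε - r / D n + 2 * Cn) C₁
    (show 0 < θ / 5 by positivity)
  refine ⟨M₀, fun N hN M hM z hz hG => ?_⟩
  have hMN : N + 1 ≤ M := by rw [hM]; exact Nat.le_mul_of_pos_left _ (hD0 n)
  have hM0 : 0 < M := by lia
  have hM' : (M : ℝ) = D n * (N + 1) := by rw [hM]; push_cast; ring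
  have hMpos : (0 : ℝ) < M := by positivity
  have herr := hM₀ M (by lia)
  obtain ⟨P, hP, hPd, hle, hp₁, hen⟩ := exists_root_config (hA n) (hD n) (hB n) (hR n) hk0 p₁
  have hQ := energy_le (hD0 n) hk0 hM hz hP hPd hle hη hεpos (hen ε hεpos) hmod hG
  have hQ2 : -logForm ε₀ (diffMeasure z P) (diffMeasure z P) ≤ θ := by
    have h1 := logForm_self_mono hεpos (min_le_left _ _ : ε ≤ ε₀) (diffMeasure z P)
    have h2 : -Real.log ε / M - Real.log ε / k + (1 / k - 1 / (N + 1)) * r / D n ^ 2 +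
        2 * (C₀ * (N + 1) * M + Cn * M + C₁ * Real.log M.factorial) / M ^ 2 +
        2 * (θ * D n / 10) / D n + 2 * Real.log 2 / (k * D n) + 4 * ε ^ 2 / η ^ 2 =
        2 * C₀ / D n + θ / 5 + 4 * ε ^ 2 / η ^ 2 +
        (-Real.log ε + r / D n ^ 2 + 2 * Real.log 2 / D n) / k +
        ((-Real.log ε - r / D n + 2 * Cn) / M + 2 * C₁ * Real.log M.factorial / M ^ 2) := by
      rw [hM']
      have : (0 : ℝ) < (N : ℝ) + 1 := by positivity
      field_simp
      ring
    linarith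
  have hpos := max_norm_eval_pos (hAB n) p₁
  have hfin := potential_sub_le (hD0 n) hk0 hM0 z hP hPd hle hp₁ hpos hη₀ hε₀ ht0 hQ2
    (hn₂ n ((le_max_left _ _).trans hn))
  have hl := hn₃ n ((le_max_left _ _).trans ((le_max_right _ _).trans hn))
  rw [← hW, hθt] at hfin
  have h5 : (D n * (g₂ + τ / 6) - Real.log (max ‖(A n).eval p₁‖ ‖(B n).eval p₁‖)) / D n ≤
      g₂ - g₁ + τ / 3 := by
    rw [div_le_iff₀ hD1]
    linear_combination hl
  linarith

lemma nrm_norm (p : ℂ × ℂ) : nrm (NormedField.toAbsoluteValue ℂ) p = ‖p‖ := by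
  rw [nrm, Prod.norm_def]; rfl

lemma norm_step_le (t : ℂ) (p : ℂ × ℂ) : ‖step t p‖ ≤ 8 * (1 + ‖t‖) ^ 2 * ‖p‖ ^ 4 := by
  obtain ⟨z, w⟩ := p
  set R := ‖(z, w)‖ with hR
  have hz : ‖z‖ ≤ R := norm_fst_le (z, w)
  have hw : ‖w‖ ≤ R := norm_snd_le (z, w)
  have hR0 : 0 ≤ R := norm_nonneg _
  have h1 : ‖t * w ^ 2 - z ^ 2‖ ≤ (1 + ‖t‖) * R ^ 2 := by
    calc ‖t * w ^ 2 - z ^ 2‖ ≤ ‖t‖ * ‖w‖ ^ 2 + ‖z‖ ^ 2 := by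
          refine (norm_sub_le _ _).trans ?_
          simp [norm_pow]
      _ ≤ ‖t‖ * R ^ 2 + R ^ 2 := by gcongr
      _ = _ := by ring
  have h2 : ‖w - z‖ ≤ 2 * R := (norm_sub_le _ _).trans (by linarith)
  have h3 : ‖t * w - z‖ ≤ (1 + ‖t‖) * R := by
    calc ‖t * w - z‖ ≤ ‖t‖ * ‖w‖ + ‖z‖ := by
          refine (norm_sub_le _ _).trans ?_
          simp
      _ ≤ ‖t‖ * R + R := by gcongr
      _ = _ := by ring
  rw [Prod.norm_def]
  refine max_le ?_ ?_
  · simp only [step, norm_pow]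
    calc ‖t * w ^ 2 - z ^ 2‖ ^ 2 ≤ ((1 + ‖t‖) * R ^ 2) ^ 2 := by gcongr
      _ = 1 * ((1 + ‖t‖) ^ 2 * R ^ 4) := by ring
      _ ≤ 8 * ((1 + ‖t‖) ^ 2 * R ^ 4) := by gcongr; norm_num
      _ = _ := by ring
  · simp only [step, norm_mul, Complex.norm_ofNat]
    calc 4 * ‖z‖ * ‖w‖ * ‖w - z‖ * ‖t * w - z‖ ≤
          4 * R * R * (2 * R) * ((1 + ‖t‖) * R) := by gcongr
      _ = 8 * ((1 + ‖t‖) * 1) * R ^ 4 := by ring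
      _ ≤ 8 * ((1 + ‖t‖) * (1 + ‖t‖)) * R ^ 4 := by
          gcongr; linarith [norm_nonneg t]
      _ = _ := by ring

/-- A locally bounded bound for the defect of `log ‖·‖` under one step of the dynamics. -/
noncomputable def stepBound (t : ℂ) : ℝ :=
  |Real.log (2 ^ 5 * (2 : ℝ)⁻¹ ^ 2 * max 1 ‖t‖⁻¹ ^ 2 * max 1 ‖1 - t‖⁻¹ ^ 2 * max 1 ‖t‖)| +
    |Real.log (8 * (1 + ‖t‖) ^ 2)|

lemma stepBound_nonneg (t : ℂ) : 0 ≤ stepBound t := by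
  rw [stepBound]; positivity

lemma continuousAt_stepBound {t : ℂ} (h0 : t ≠ 0) (h1 : t ≠ 1) : ContinuousAt stepBound t := by
  have h0' : ‖t‖ ≠ 0 := norm_ne_zero_iff.2 h0
  have h1' : ‖1 - t‖ ≠ 0 := norm_ne_zero_iff.2 (sub_ne_zero.2 h1.symm)
  have c1 : ContinuousAt (fun t : ℂ => ‖t‖⁻¹) t := continuousAt_id.norm.inv₀ h0'
  have c2 : ContinuousAt (fun t : ℂ => ‖1 - t‖⁻¹) t :=
    (continuousAt_const.sub continuousAt_id).norm.inv₀ h1'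
  have c3 : ContinuousAt (fun t : ℂ => max 1 ‖t‖⁻¹) t := continuousAt_const.max c1
  have c4 : ContinuousAt (fun t : ℂ => max 1 ‖1 - t‖⁻¹) t := continuousAt_const.max c2
  have c5 : ContinuousAt (fun t : ℂ => max 1 ‖t‖) t := continuousAt_const.max continuousAt_id.norm
  refine ContinuousAt.add (ContinuousAt.abs (ContinuousAt.log ?_ ?_))
    (ContinuousAt.abs (ContinuousAt.log ?_ ?_))
  · exact ((continuousAt_const.mul (c3.pow 2)).mul (c4.pow 2)).mul c5
  · positivity
  · fun_prop
  · positivity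

lemma abs_log_step_sub_le {t : ℂ} (h0 : t ≠ 0) (h1 : t ≠ 1) {p : ℂ × ℂ} (hp : p ≠ 0) :
    |Real.log ‖step t p‖ - 4 * Real.log ‖p‖| ≤ stepBound t := by
  have hl := step_lower (NormedField.toAbsoluteValue ℂ) (κ := 2) (by norm_num) (fun x y => by
    refine (AbsoluteValue.add_le _ x y).trans ?_
    have := le_max_left (NormedField.toAbsoluteValue ℂ x) (NormedField.toAbsoluteValue ℂ y)
    have := le_max_right (NormedField.toAbsoluteValue ℂ x) (NormedField.toAbsoluteValue ℂ y)
    linarith) two_ne_zero h0 h1 p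
  have hu := norm_step_le t p
  rw [nrm_norm, nrm_norm] at hl
  simp only [NormedField.toAbsoluteValue, AbsoluteValue.coe_mk, MulHom.coe_mk,
    Complex.norm_ofNat] at hl
  have hp0 : 0 < ‖p‖ := norm_pos_iff.2 hp
  set E := 2 ^ 5 * (2 : ℝ)⁻¹ ^ 2 * max 1 ‖t‖⁻¹ ^ 2 * max 1 ‖1 - t‖⁻¹ ^ 2 * max 1 ‖t‖ with hE
  have hE0 : 0 < E := by positivity
  have hs : 0 < ‖step t p‖ := by
    have := pow_pos hp0 4
    by_contra! h
    nlinarith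
  have h4 : 4 * Real.log ‖p‖ = Real.log (‖p‖ ^ 4) := by rw [Real.log_pow]; norm_num
  have hl' := Real.log_le_log (by positivity) hl
  have hu' := Real.log_le_log hs hu
  rw [Real.log_mul hE0.ne' hs.ne'] at hl'
  rw [Real.log_mul (by positivity) (by positivity)] at hu'
  rw [h4, abs_le, stepBound, ← hE]
  have := le_abs_self (Real.log E)
  have := le_abs_self (Real.log (8 * (1 + ‖t‖) ^ 2))
  have := abs_nonneg (Real.log E)
  have := abs_nonneg (Real.log (8 * (1 + ‖t‖) ^ 2))
  constructor <;> linarith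

/-- The escape rate of the marked point `c`. -/
noncomputable def green (c t : ℂ) : ℝ :=
  Filter.limUnder Filter.atTop fun n => Real.log ‖orbit t c n‖ / 4 ^ n

lemma abs_log_orbit_sub_green_le {c t : ℂ} (hc0 : c ≠ 0) (hc1 : c ≠ 1) (h0 : t ≠ 0) (h1 : t ≠ 1)
    (n : ℕ) : |Real.log ‖orbit t c n‖ - 4 ^ n * green c t| ≤ stepBound t := by
  have hK := stepBound_nonneg t
  have hd : ∀ n, dist (Real.log ‖orbit t c n‖ / 4 ^ n) (Real.log ‖orbit t c (n + 1)‖ / 4 ^ (n + 1))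
      ≤ stepBound t / 4 * (1 / 4) ^ n := by
    intro n
    have h := abs_log_step_sub_le h0 h1 (orbit_ne_zero' (t := t) hc0 hc1 n)
    rw [dist_comm, Real.dist_eq]
    have : Real.log ‖orbit t c (n + 1)‖ / 4 ^ (n + 1) - Real.log ‖orbit t c n‖ / 4 ^ n =
      (Real.log ‖step t (orbit t c n)‖ - 4 * Real.log ‖orbit t c n‖) / 4 ^ (n + 1) := by
      rw [orbit]; field_simp; ring
    rw [this, abs_div, abs_of_pos (by positivity : (0 : ℝ) < 4 ^ (n + 1))]
    calc _ ≤ stepBound t / 4 ^ (n + 1) := by gcongr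
      _ = _ := by rw [one_div, inv_pow]; field_simp; ring
  have hc := cauchySeq_of_le_geometric (1 / 4 : ℝ) (stepBound t / 4) (by norm_num) hd
  have hlim := hc.tendsto_limUnder
  have h := dist_le_of_le_geometric_of_tendsto (1 / 4 : ℝ) (stepBound t / 4) (by norm_num) hd
    hlim n
  rw [Real.dist_eq] at h
  change |Real.log ‖orbit t c n‖ / 4 ^ n - green c t| ≤ _ at h
  have h4 : (0 : ℝ) < 4 ^ n := by positivity
  have : Real.log ‖orbit t c n‖ - 4 ^ n * green c t =
      4 ^ n * (Real.log ‖orbit t c n‖ / 4 ^ n - green c t) := by field_simp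
  rw [this, abs_mul, abs_of_pos h4]
  calc _ ≤ 4 ^ n * (stepBound t / 4 * (1 / 4) ^ n / (1 - 1 / 4)) := by gcongr
    _ = stepBound t / 3 := by rw [one_div, inv_pow]; field_simp; norm_num
    _ ≤ _ := by linarith

lemma continuous_orbit (c : ℂ) (n : ℕ) : Continuous fun t : ℂ => orbit t c n := by
  have : (fun t : ℂ => orbit t c n) = fun t => ((num c n).eval t, (den c n).eval t) := by
    ext1 t; rw [eval_num, eval_den]
  rw [this]
  exact (num c n).continuous.prodMk (den c n).continuous

lemma continuousAt_green {c t : ℂ} (hc0 : c ≠ 0) (hc1 : c ≠ 1) (h0 : t ≠ 0) (h1 : t ≠ 1) :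
    ContinuousAt (green c) t := by
  set K := stepBound t + 1 with hKdef
  have hK0 : 0 < K := by have := stepBound_nonneg t; positivity
  have hev : ∀ᶠ u in nhds t, stepBound u < K ∧ u ≠ 0 ∧ u ≠ 1 :=
    ((continuousAt_stepBound h0 h1).eventually_lt continuousAt_const (by simp [hKdef])).and
      ((isOpen_ne.eventually_mem h0).and (isOpen_ne.eventually_mem h1))
  rw [Metric.continuousAt_iff']
  intro ε hε
  obtain ⟨n, hn⟩ := pow_unbounded_of_one_lt (3 * K / ε) (by norm_num : (1 : ℝ) < 4)
  have h4 : (0 : ℝ) < 4 ^ n := by positivity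
  have hcont : ContinuousAt (fun u => Real.log ‖orbit u c n‖) t :=
    ((continuous_orbit c n).continuousAt.norm).log (norm_ne_zero_iff.2 (orbit_ne_zero' hc0 hc1 n))
  filter_upwards [hev, Metric.continuousAt_iff'.1 hcont K hK0] with u hu hu2
  have e1 := abs_le.1 ((abs_log_orbit_sub_green_le hc0 hc1 hu.2.1 hu.2.2 n).trans hu.1.le)
  have e2 := abs_le.1 ((abs_log_orbit_sub_green_le hc0 hc1 h0 h1 n).trans
    (show stepBound t ≤ K by linarith))
  rw [Real.dist_eq, abs_lt] at hu2 ⊢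
  rw [div_lt_iff₀ hε] at hn
  constructor <;> (by_contra! hcon; nlinarith)

lemma norm_orbit_eq (t c : ℂ) (n : ℕ) :
    ‖orbit t c n‖ = max ‖(num c n).eval t‖ ‖(den c n).eval t‖ := by
  rw [eval_num, eval_den, Prod.norm_def]

lemma tendsto_two_mul_four_pow :
    Filter.Tendsto (fun n : ℕ => ((2 * 4 ^ n : ℕ) : ℝ)) Filter.atTop Filter.atTop := by
  push_cast
  exact (tendsto_pow_atTop_atTop_of_one_lt (by norm_num)).const_mul_atTop (by norm_num)

lemma exists_log_orbit_le {c p : ℂ} (hc0 : c ≠ 0) (hc1 : c ≠ 1) (h0 : p ≠ 0) (h1 : p ≠ 1)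
    {τ : ℝ} (hτ : 0 < τ) : ∃ η > 0, ∃ n₀ : ℕ, ∀ n ≥ n₀, ∀ u, ‖u - p‖ ≤ η →
      |Real.log ‖orbit u c (n + 1)‖ - (2 * 4 ^ n : ℕ) * (2 * green c p)| ≤
        (2 * 4 ^ n : ℕ) * τ := by
  set K := stepBound p + 1 with hK
  have hev : ∀ᶠ u in nhds p, (stepBound u < K ∧ u ≠ 0 ∧ u ≠ 1) ∧
      dist (green c u) (green c p) < τ / 4 :=
    (((continuousAt_stepBound h0 h1).eventually_lt continuousAt_const (by simp [hK])).and
      ((isOpen_ne.eventually_mem h0).and (isOpen_ne.eventually_mem h1))).and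
      (Metric.continuousAt_iff'.1 (continuousAt_green hc0 hc1 h0 h1) _ (by positivity))
  obtain ⟨η, hη, hball⟩ := Metric.eventually_nhds_iff.1 hev
  obtain ⟨n₀, hn₀⟩ := Filter.eventually_atTop.1
    (tendsto_two_mul_four_pow.eventually_ge_atTop (2 * K / τ))
  refine ⟨η / 2, by positivity, n₀, fun n hn u hu => ?_⟩
  obtain ⟨⟨hs, hu0, hu1⟩, hg⟩ := hball (show dist u p < η by rw [dist_eq_norm]; linarith)
  have e := abs_le.1 ((abs_log_orbit_sub_green_le hc0 hc1 hu0 hu1 (n + 1)).trans hs.le)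
  have hn' := hn₀ n hn
  rw [div_le_iff₀ hτ] at hn'
  rw [Real.dist_eq, abs_lt] at hg
  have h4 : (0 : ℝ) < 4 ^ n := by positivity
  push_cast at hn' ⊢
  rw [pow_succ] at e
  have u1 := mul_lt_mul_of_pos_left hg.1 h4
  have u2 := mul_lt_mul_of_pos_left hg.2 h4
  rw [abs_le]
  constructor <;> linarith

lemma potential_green_le {c : ℂ} (hc0 : c ≠ 0) (hc1 : c ≠ 1) {p₁ p₂ : ℂ} (h10 : p₁ ≠ 0)
    (h11 : p₁ ≠ 1) (h20 : p₂ ≠ 0) (h21 : p₂ ≠ 1) (C₀ C₁ : ℝ) {τ : ℝ} (hτ : 0 < τ) :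
    ∃ ε₁ > 0, ∀ ε₀, 0 < ε₀ → ε₀ ≤ ε₁ → ∃ n₁ : ℕ, ∀ n ≥ n₁, ∀ Cn : ℝ, ∃ N₁ : ℕ, ∀ N ≥ N₁,
      ∀ z : Fin (2 * 4 ^ n * (N + 1)) → ℂ, Function.Injective z →
      (N + 1) * ∑ i, Real.log ‖orbit (z i) c (n + 1)‖ -
          (C₀ * (N + 1) * (2 * 4 ^ n * (N + 1) : ℕ) + Cn * (2 * 4 ^ n * (N + 1) : ℕ) +
            C₁ * Real.log (2 * 4 ^ n * (N + 1) : ℕ).factorial) ≤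
          Real.log ‖(Matrix.vandermonde z).det‖ + (N * (N + 1) / 2 : ℕ) *
            Real.log ‖resultant (num c (n + 1)) (den c (n + 1)) (2 * 4 ^ n) (2 * 4 ^ n)‖ →
      (∑ i, logKer ε₀ (z i) p₂ - ∑ i, logKer ε₀ (z i) p₁) / (2 * 4 ^ n * (N + 1) : ℕ) ≤
        2 * green c p₂ - 2 * green c p₁ + τ := by
  have hco := fun n => isCoprime_num_den_complex hc0 hc1 (n + 1)
  obtain ⟨ε₁, hε₁, H⟩ := potential_le (A := fun n => num c (n + 1)) (B := fun n => den c (n + 1))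
    (D := fun n => 2 * 4 ^ n) (p₁ := p₁) (p₂ := p₂) (g₁ := 2 * green c p₁) (g₂ := 2 * green c p₂)
    (fun n => (degree_num_den c n).1) (fun n => (degree_num_den c n).2.1)
    (fun n => by positivity) (fun n => den_natDegree_lt c n) hco
    (fun n => resultant_ne_zero_of_monic (degree_num_den c n).1 (degree_num_den c n).2.1
      (den_natDegree_lt c n) (hco n)) tendsto_two_mul_four_pow
    (fun τ hτ => by
      obtain ⟨η, hη, n₀, h⟩ := exists_log_orbit_le hc0 hc1 h20 h21 hτ
      refine ⟨η, hη, n₀, fun n hn u hu => ?_⟩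
      have := (abs_le.1 (h n hn u hu)).2
      rw [norm_orbit_eq] at this
      linarith)
    (fun τ hτ => by
      obtain ⟨η, hη, n₀, h⟩ := exists_log_orbit_le hc0 hc1 h10 h11 hτ
      refine ⟨n₀, fun n hn => ?_⟩
      have := (abs_le.1 (h n hn p₁ (by simpa using hη.le))).1
      rw [norm_orbit_eq] at this
      linarith) C₀ C₁ hτ
  refine ⟨ε₁, hε₁, fun ε₀ h0 h1 => ?_⟩
  obtain ⟨n₁, hn₁⟩ := H ε₀ h0 h1
  refine ⟨n₁, fun n hn Cn => ?_⟩
  obtain ⟨N₁, hN₁⟩ := hn₁ n hn Cn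
  refine ⟨N₁, fun N hN z hz hG => hN₁ N hN _ rfl z hz ?_⟩
  simp only [← norm_orbit_eq]
  refine hG.trans_eq ?_
  congr 2
  rw [Nat.cast_div (Nat.even_mul_succ_self N).two_dvd (by norm_num)]
  push_cast
  ring

theorem green_sub_le {K : Type} [Field K] [NumberField K] [Algebra K ℂ] {a b : K}
    (ha0 : a ≠ 0) (ha1 : a ≠ 1) (hb0 : b ≠ 0) (hb1 : b ≠ 1) {T : Set ℂ} (hTinf : T.Infinite)
    (hT : ∀ t ∈ T, t ≠ 0 ∧ t ≠ 1 ∧ Per t (algebraMap K ℂ a) ∧ Per t (algebraMap K ℂ b))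
    {p₁ p₂ : ℂ} (h10 : p₁ ≠ 0) (h11 : p₁ ≠ 1) (h20 : p₂ ≠ 0) (h21 : p₂ ≠ 1) :
    green (algebraMap K ℂ b) p₂ - green (algebraMap K ℂ b) p₁ ≤
      green (algebraMap K ℂ a) p₂ - green (algebraMap K ℂ a) p₁ := by
  obtain ⟨C₀, C₁, H⟩ := exists_configuration ha0 ha1 hb0 hb1 hTinf hT
  have hne0 : ∀ {x : K}, x ≠ 0 → algebraMap K ℂ x ≠ 0 := fun h => by simpa using h
  have hne1 : ∀ {x : K}, x ≠ 1 → algebraMap K ℂ x ≠ 1 := fun h h' =>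
    h ((algebraMap K ℂ).injective (by simpa using h'))
  refine le_of_forall_pos_le_add fun τ hτ => ?_
  obtain ⟨εa, hεa, Ha⟩ := potential_green_le (hne0 ha0) (hne1 ha1) h10 h11 h20 h21 C₀ C₁ hτ
  obtain ⟨εb, hεb, Hb⟩ := potential_green_le (hne0 hb0) (hne1 hb1) h20 h21 h10 h11 C₀ C₁ hτ
  obtain ⟨na, Ha⟩ := Ha (min εa εb) (lt_min hεa hεb) (min_le_left _ _)
  obtain ⟨nb, Hb⟩ := Hb (min εa εb) (lt_min hεa hεb) (min_le_right _ _)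
  obtain ⟨Cn, hCn⟩ := H (max na nb)
  obtain ⟨Na, Ha⟩ := Ha (max na nb) (le_max_left _ _) Cn
  obtain ⟨Nb, Hb⟩ := Hb (max na nb) (le_max_right _ _) Cn
  obtain ⟨z, hz, hz'⟩ := hCn (max Na Nb)
  have hres : ∀ c : K, algebraMap K ℂ (resultant (num c (max na nb + 1)) (den c (max na nb + 1))
      (2 * 4 ^ max na nb) (2 * 4 ^ max na nb)) = resultant (num (algebraMap K ℂ c) (max na nb + 1))
      (den (algebraMap K ℂ c) (max na nb + 1)) (2 * 4 ^ max na nb) (2 * 4 ^ max na nb) := by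
    intro c
    rw [← resultant_map_map, map_num, map_den]
  have hGa := hz' a (Or.inl rfl)
  have hGb := hz' b (Or.inr rfl)
  rw [hres] at hGa hGb
  have ha := Ha (max Na Nb) (le_max_left _ _) z hz hGa
  have hb := Hb (max Na Nb) (le_max_right _ _) z hz hGb
  rw [sub_div] at ha hb
  linarith

/-- The Wronskian of the two coordinates of `orbit · c n`, as a polynomial in the parameter. -/
noncomputable def wron (c : ℂ) (n : ℕ) : ℂ[X] :=
  derivative (num c n) * den c n - num c n * derivative (den c n)

lemma wron_zero (c : ℂ) : wron c 0 = 0 := by simp [wron, num_zero, den_zero]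

lemma eval_wron_succ (c t : ℂ) (n : ℕ) {z w : ℂ} (h : orbit t c n = (z, w)) :
    (wron c (n + 1)).eval t =
      4 * (t * w ^ 2 - z ^ 2) * (z ^ 2 - 2 * z * w + t * w ^ 2) *
        (-(z ^ 2 - 2 * t * z * w + t * w ^ 2) * (wron c n).eval t + z * w ^ 2 * (w - z)) := by
  have hz : (num c n).eval t = z := by rw [eval_num, h]
  have hw : (den c n).eval t = w := by rw [eval_den, h]
  simp only [wron, num_succ, den_succ, derivative_mul, derivative_pow, derivative_sub,
    derivative_X, eval_sub, eval_mul, eval_add, eval_pow, eval_X, hz, hw, derivative_ofNat,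
    eval_ofNat, map_ofNat, Nat.cast_ofNat, eval_zero, eval_one]
  norm_num
  ring

/-- The product of the four coordinate forms vanishing at the `2`-torsion. -/
def torsionForm (t z w : ℂ) : ℂ := z * w * (w - z) * (t * w - z)

lemma torsionForm_step (t z w : ℂ) :
    torsionForm t (step t (z, w)).1 (step t (z, w)).2 =
      (2 * ((t * w ^ 2 - z ^ 2) * (z ^ 2 - 2 * z * w + t * w ^ 2) *
        (z ^ 2 - 2 * t * z * w + t * w ^ 2))) ^ 2 * torsionForm t z w := by
  simp only [torsionForm, step]; ring

lemma sqrt_torsionForm_step (t z w : ℂ) :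
    √‖torsionForm t (step t (z, w)).1 (step t (z, w)).2‖ =
      2 * (‖t * w ^ 2 - z ^ 2‖ * ‖z ^ 2 - 2 * z * w + t * w ^ 2‖ *
        ‖z ^ 2 - 2 * t * z * w + t * w ^ 2‖) * √‖torsionForm t z w‖ := by
  rw [torsionForm_step, norm_mul, norm_pow, Real.sqrt_mul (by positivity),
    Real.sqrt_sq (by positivity)]
  simp

lemma norm_torsionForm (t z w : ℂ) :
    ‖torsionForm t z w‖ = ‖z‖ * ‖w‖ * ‖w - z‖ * ‖z - t * w‖ := by
  rw [torsionForm, norm_mul, norm_mul, norm_mul, norm_sub_rev z]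

lemma le_mul_sqrt_of_sq_le {x y h : ℝ} (hy : 0 ≤ y) (hxy : x ^ 2 ≤ y ^ 2 * h) :
    x ≤ y * √h := by
  calc x ≤ √(x ^ 2) := by rw [Real.sqrt_sq_eq_abs]; exact le_abs_self x
    _ ≤ √(y ^ 2 * h) := Real.sqrt_le_sqrt hxy
    _ = y * √h := by rw [Real.sqrt_mul (by positivity), Real.sqrt_sq hy]

lemma far_far_bound {t z w : ℂ} {ρ C : ℝ} (hρ : 0 < ρ) (hC : 0 ≤ C) (hCρ : 1 ≤ C ^ 2 * ρ ^ 3)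
    (hfar : ρ * ‖w‖ ≤ ‖z - t * w‖)
    (hfar' : 4 * ρ * ‖torsionForm t z w‖ ≤ ‖z ^ 2 - 2 * t * z * w + t * w ^ 2‖ ^ 2) :
    2 * ‖z * w ^ 2 * (w - z)‖ ≤
      C * ‖z ^ 2 - 2 * t * z * w + t * w ^ 2‖ * √‖torsionForm t z w‖ := by
  refine le_mul_sqrt_of_sq_le (by positivity) ?_
  set q := ‖z ^ 2 - 2 * t * z * w + t * w ^ 2‖
  calc (2 * ‖z * w ^ 2 * (w - z)‖) ^ 2
      = 1 * (4 * (‖z‖ * ‖w‖ * ‖w - z‖) ^ 2 * ‖w‖ ^ 2) := by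
        simp only [norm_mul, norm_pow]; ring
    _ ≤ C ^ 2 * ρ ^ 3 * (4 * (‖z‖ * ‖w‖ * ‖w - z‖) ^ 2 * ‖w‖ ^ 2) := by gcongr
    _ = C ^ 2 * (4 * ρ * (‖z‖ * ‖w‖ * ‖w - z‖) ^ 2) * (ρ * ‖w‖) ^ 2 := by ring
    _ ≤ C ^ 2 * (4 * ρ * (‖z‖ * ‖w‖ * ‖w - z‖) ^ 2) * ‖z - t * w‖ ^ 2 := by gcongr
    _ = C ^ 2 * (4 * ρ * ‖torsionForm t z w‖) * ‖torsionForm t z w‖ := by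
        rw [norm_torsionForm]; ring
    _ ≤ C ^ 2 * q ^ 2 * ‖torsionForm t z w‖ := by gcongr
    _ = _ := by ring

section Near

variable {t z w : ℂ} {δ L ρ : ℝ}

lemma near_bounds (hρδ : ρ ≤ δ / 2) (hL : 1 ≤ L) (ht0 : δ ≤ ‖t‖) (ht1 : δ ≤ ‖1 - t‖)
    (htL : ‖t‖ ≤ L) (hδ : 0 < δ) (hnear : ‖z - t * w‖ < ρ * ‖w‖) :
    0 < ‖w‖ ∧ δ / 2 * ‖w‖ ≤ ‖z‖ ∧ δ / 2 * ‖w‖ ≤ ‖w - z‖ ∧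
      δ ^ 2 / 2 * ‖w‖ ^ 2 ≤ ‖z ^ 2 - 2 * t * z * w + t * w ^ 2‖ ∧ ‖z‖ ≤ 2 * L * ‖w‖ := by
  have hw : 0 < ‖w‖ := by
    rcases (norm_nonneg w).eq_or_lt with h | h
    · rw [← h, mul_zero] at hnear
      exact absurd hnear (not_lt.2 (norm_nonneg _))
    · exact h
  have h1 : ‖z - t * w‖ ≤ δ / 2 * ‖w‖ := hnear.le.trans (by gcongr)
  have h2 : δ * ‖w‖ ≤ ‖t * w‖ := by rw [norm_mul]; gcongr
  have h3 : δ * ‖w‖ ≤ ‖(1 - t) * w‖ := by rw [norm_mul]; gcongr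
  have h4 : ‖t * w‖ ≤ L * ‖w‖ := by rw [norm_mul]; gcongr
  refine ⟨hw, ?_, ?_, ?_, ?_⟩
  · have : ‖t * w‖ ≤ ‖z‖ + ‖z - t * w‖ := by
      simpa using norm_sub_le z (z - t * w)
    linarith
  · have : ‖(1 - t) * w‖ ≤ ‖w - z‖ + ‖z - t * w‖ := by
      have e : (1 - t) * w = (w - z) + (z - t * w) := by ring
      rw [e]; exact norm_add_le _ _
    linarith
  · have e : t * (1 - t) * w ^ 2 = (z ^ 2 - 2 * t * z * w + t * w ^ 2) - (z - t * w) ^ 2 := by ring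
    have h5 : ‖t * (1 - t) * w ^ 2‖ ≤ ‖z ^ 2 - 2 * t * z * w + t * w ^ 2‖ + ‖z - t * w‖ ^ 2 := by
      rw [e, ← norm_pow]; exact norm_sub_le _ _
    have h6 : δ * δ * ‖w‖ ^ 2 ≤ ‖t * (1 - t) * w ^ 2‖ := by
      rw [norm_mul, norm_mul, norm_pow]; gcongr
    have h7 : ‖z - t * w‖ ^ 2 ≤ (δ / 2 * ‖w‖) ^ 2 := by gcongr
    nlinarith [sq_nonneg (δ * ‖w‖)]
  · have : ‖z‖ ≤ ‖z - t * w‖ + ‖t * w‖ := by simpa using norm_add_le (z - t * w) (t * w)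
    nlinarith

lemma near_far (hρδ : ρ ≤ δ / 2) (hL : 1 ≤ L) (ht0 : δ ≤ ‖t‖) (ht1 : δ ≤ ‖1 - t‖)
    (htL : ‖t‖ ≤ L) (hδ : 0 < δ) (hρ : 0 < ρ) (hρ2 : 96 * ρ ^ 2 * L ^ 2 ≤ δ ^ 4)
    (hnear : ‖z - t * w‖ < ρ * ‖w‖) :
    4 * ρ * ‖torsionForm t z w‖ ≤ ‖z ^ 2 - 2 * t * z * w + t * w ^ 2‖ ^ 2 := by
  obtain ⟨hw, -, -, hq, hz⟩ := near_bounds hρδ hL ht0 ht1 htL hδ hnear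
  have hwz : ‖w - z‖ ≤ 3 * L * ‖w‖ := (norm_sub_le _ _).trans (by nlinarith)
  calc 4 * ρ * ‖torsionForm t z w‖
      ≤ 4 * ρ * (2 * L * ‖w‖ * ‖w‖ * (3 * L * ‖w‖) * (ρ * ‖w‖)) := by
        rw [norm_torsionForm]; gcongr
    _ = (96 * ρ ^ 2 * L ^ 2) / 4 * ‖w‖ ^ 4 := by ring
    _ ≤ δ ^ 4 / 4 * ‖w‖ ^ 4 := by gcongr
    _ = (δ ^ 2 / 2 * ‖w‖ ^ 2) ^ 2 := by ring
    _ ≤ _ := by gcongr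

lemma near_far_bound {C : ℝ} (hρδ : ρ ≤ δ / 2) (hL : 1 ≤ L) (ht0 : δ ≤ ‖t‖)
    (ht1 : δ ≤ ‖1 - t‖) (htL : ‖t‖ ≤ L) (hδ : 0 < δ) (hC : 0 ≤ C)
    (hCδ : 1600 * L ^ 2 * ρ ≤ C ^ 2 * δ ^ 6) (hnear : ‖z - t * w‖ < ρ * ‖w‖) :
    2 * (‖w‖ ^ 2 * ‖(2 * z - w) * (z - t * w)‖) ≤
      C * ‖z ^ 2 - 2 * t * z * w + t * w ^ 2‖ * √‖torsionForm t z w‖ := by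
  obtain ⟨hw, hz0, hw0, hq, hz⟩ := near_bounds hρδ hL ht0 ht1 htL hδ hnear
  refine le_mul_sqrt_of_sq_le (by positivity) ?_
  have h1 : ‖2 * z - w‖ ≤ 5 * L * ‖w‖ := by
    refine (norm_sub_le _ _).trans ?_
    rw [norm_mul, Complex.norm_ofNat]
    nlinarith
  rw [norm_mul, norm_torsionForm]
  calc (2 * (‖w‖ ^ 2 * (‖2 * z - w‖ * ‖z - t * w‖))) ^ 2
      = 4 * ‖w‖ ^ 4 * ‖2 * z - w‖ ^ 2 * ‖z - t * w‖ * ‖z - t * w‖ := by ring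
    _ ≤ 4 * ‖w‖ ^ 4 * (5 * L * ‖w‖) ^ 2 * (ρ * ‖w‖) * ‖z - t * w‖ := by gcongr
    _ = (1600 * L ^ 2 * ρ) / 16 * ‖w‖ ^ 7 * ‖z - t * w‖ := by ring
    _ ≤ (C ^ 2 * δ ^ 6) / 16 * ‖w‖ ^ 7 * ‖z - t * w‖ := by gcongr
    _ = C ^ 2 * (δ ^ 2 / 2 * ‖w‖ ^ 2) ^ 2 * (δ / 2 * ‖w‖ * ‖w‖ * (δ / 2 * ‖w‖) * ‖z - t * w‖) := by
        ring
    _ ≤ C ^ 2 * ‖z ^ 2 - 2 * t * z * w + t * w ^ 2‖ ^ 2 *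
        (‖z‖ * ‖w‖ * ‖w - z‖ * ‖z - t * w‖) := by gcongr
    _ = _ := by ring

lemma far_near_bound {κ C : ℝ} (hρδ : ρ ≤ δ / 2) (hL : 1 ≤ L) (ht0 : δ ≤ ‖t‖)
    (ht1 : δ ≤ ‖1 - t‖) (htL : ‖t‖ ≤ L) (hδ : 0 < δ) (hC : 0 ≤ C) (hκ : 0 < κ)
    (hstep : κ * ‖(z, w)‖ ^ 4 ≤ ‖step t (z, w)‖)
    (hCδ : 1024 * 512 * L ^ 5 ≤ C ^ 2 * δ ^ 2 * κ ^ 3)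
    (hnear : ‖z ^ 2 - 2 * t * z * w + t * w ^ 2‖ ^ 2 < 4 * ρ * ‖torsionForm t z w‖) :
    2 * (‖z * w ^ 2 * (w - z)‖ * ‖3 * z ^ 2 - (2 + 2 * t) * z * w + t * w ^ 2‖) ≤
      C * (‖t * w ^ 2 - z ^ 2‖ * ‖z ^ 2 - 2 * z * w + t * w ^ 2‖) * √‖torsionForm t z w‖ := by
  set H := ‖torsionForm t z w‖ with hH
  set R := ‖(z, w)‖ with hR
  have hz : ‖z‖ ≤ R := norm_fst_le (z, w)
  have hw : ‖w‖ ≤ R := norm_snd_le (z, w)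
  have hR0 : 0 ≤ R := norm_nonneg _
  have hH0 : 0 ≤ H := norm_nonneg _
  have h2 : ‖(step t (z, w)).2‖ = 4 * H := by
    rw [hH, torsionForm, ← Complex.norm_ofNat 4, ← norm_mul, step]
    ring_nf
  have hq : ‖(step t (z, w)).1 - t * (step t (z, w)).2‖ ≤ δ / 2 * (4 * H) := by
    have e : (step t (z, w)).1 - t * (step t (z, w)).2 =
      (z ^ 2 - 2 * t * z * w + t * w ^ 2) ^ 2 := by simp only [step]; ring
    rw [e, norm_pow]
    nlinarith
  have hX : δ / 2 * (4 * H) ≤ ‖t * w ^ 2 - z ^ 2‖ ^ 2 := by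
    have e : (t * w ^ 2 - z ^ 2) ^ 2 = (step t (z, w)).1 := rfl
    rw [← norm_pow, e]
    have h3 : ‖t * (step t (z, w)).2‖ ≤ ‖(step t (z, w)).1‖ +
        ‖(step t (z, w)).1 - t * (step t (z, w)).2‖ := by
      simpa using norm_sub_le (step t (z, w)).1 ((step t (z, w)).1 - t * (step t (z, w)).2)
    rw [norm_mul, h2] at h3
    nlinarith
  have hY : δ / 2 * (4 * H) ≤ ‖z ^ 2 - 2 * z * w + t * w ^ 2‖ ^ 2 := by
    have e : (z ^ 2 - 2 * z * w + t * w ^ 2) ^ 2 = (step t (z, w)).1 - (step t (z, w)).2 := by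
      simp only [step]; ring
    rw [← norm_pow, e]
    have h3 : ‖(1 - t) * (step t (z, w)).2‖ ≤ ‖(step t (z, w)).1 - (step t (z, w)).2‖ +
        ‖(step t (z, w)).1 - t * (step t (z, w)).2‖ := by
      refine le_trans (le_of_eq ?_) (norm_sub_le ((step t (z, w)).1 - (step t (z, w)).2)
        ((step t (z, w)).1 - t * (step t (z, w)).2)) |>.trans (le_of_eq rfl)
      rw [norm_sub_rev ((step t (z, w)).1 - (step t (z, w)).2)]
      ring_nf
    rw [norm_mul, h2] at h3
    nlinarith
  have hlow : κ * R ^ 4 ≤ 8 * L * H := by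
    refine hstep.trans ?_
    rw [Prod.norm_def]
    refine max_le ?_ (by rw [h2]; nlinarith)
    have h3 : ‖(step t (z, w)).1‖ ≤ ‖(step t (z, w)).1 - t * (step t (z, w)).2‖ +
        ‖t * (step t (z, w)).2‖ := by
      simpa using norm_add_le ((step t (z, w)).1 - t * (step t (z, w)).2) (t * (step t (z, w)).2)
    rw [norm_mul, h2] at h3
    nlinarith
  have hS : ‖3 * z ^ 2 - (2 + 2 * t) * z * w + t * w ^ 2‖ ≤ 8 * L * R ^ 2 := by
    have h3 : ‖2 + 2 * t‖ ≤ 2 + 2 * L := by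
      refine (norm_add_le _ _).trans ?_
      rw [norm_mul, Complex.norm_ofNat]; linarith
    calc _ ≤ ‖3 * z ^ 2‖ + ‖(2 + 2 * t) * z * w‖ + ‖t * w ^ 2‖ :=
          (norm_add_le _ _).trans (by gcongr; exact norm_sub_le _ _)
      _ ≤ 3 * R ^ 2 + (2 + 2 * L) * R * R + L * R ^ 2 := by
          simp only [norm_mul, norm_pow, Complex.norm_ofNat] at h3 ⊢
          gcongr
      _ ≤ _ := by nlinarith [sq_nonneg R]
  have hwz : ‖w - z‖ ≤ 2 * R := (norm_sub_le _ _).trans (by linarith)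
  refine le_mul_sqrt_of_sq_le (by positivity) ?_
  have hL0 : (0 : ℝ) < L := by linarith
  have hRH : 4 * R ^ 12 * (256 * L ^ 2) ≤ C ^ 2 * (2 * δ) ^ 2 * H ^ 3 := by
    have h5 : (κ * R ^ 4) ^ 3 ≤ (8 * L * H) ^ 3 := by gcongr
    have h6 : 0 < κ ^ 3 := by positivity
    have h7 : κ ^ 3 * R ^ 12 * (1024 * L ^ 2) ≤ 512 * L ^ 3 * H ^ 3 * (1024 * L ^ 2) := by
      have : κ ^ 3 * R ^ 12 ≤ 512 * L ^ 3 * H ^ 3 := by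
        calc _ = (κ * R ^ 4) ^ 3 := by ring
          _ ≤ _ := h5
          _ = _ := by ring
      gcongr
    have h8 : 1024 * 512 * L ^ 5 * H ^ 3 ≤ C ^ 2 * δ ^ 2 * κ ^ 3 * H ^ 3 := by gcongr
    have h9 : 0 ≤ C ^ 2 * δ ^ 2 * κ ^ 3 * H ^ 3 := by positivity
    refine le_of_mul_le_mul_left ?_ h6
    calc _ = κ ^ 3 * R ^ 12 * (1024 * L ^ 2) := by ring
      _ ≤ _ := h7
      _ = 1024 * 512 * L ^ 5 * H ^ 3 := by ring
      _ ≤ C ^ 2 * δ ^ 2 * κ ^ 3 * H ^ 3 := h8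
      _ ≤ 4 * (C ^ 2 * δ ^ 2 * κ ^ 3 * H ^ 3) := by linarith
      _ = _ := by ring
  calc _ = 4 * (‖z‖ * ‖w‖ ^ 2 * ‖w - z‖) ^ 2 *
        ‖3 * z ^ 2 - (2 + 2 * t) * z * w + t * w ^ 2‖ ^ 2 := by
        simp only [norm_mul, norm_pow]; ring
    _ ≤ 4 * (R * R ^ 2 * (2 * R)) ^ 2 * (8 * L * R ^ 2) ^ 2 := by gcongr
    _ = 4 * R ^ 12 * (256 * L ^ 2) := by ring
    _ ≤ C ^ 2 * (2 * δ) ^ 2 * H ^ 3 := hRH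
    _ = C ^ 2 * ((δ / 2 * (4 * H)) * (δ / 2 * (4 * H))) * H := by ring
    _ ≤ C ^ 2 * (‖t * w ^ 2 - z ^ 2‖ ^ 2 * ‖z ^ 2 - 2 * z * w + t * w ^ 2‖ ^ 2) * H := by gcongr
    _ = _ := by ring

end Near

/-- A bound for the derivative `W` of a marked point in the flat metric, relative to the constant
section away from `x = t` and to the section `x = t` near it. -/
def FlatBound (ρ k : ℝ) (t z w W : ℂ) : Prop :=
  (ρ * ‖w‖ ≤ ‖z - t * w‖ → ‖W‖ ≤ k * √‖torsionForm t z w‖) ∧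
    (‖z - t * w‖ < ρ * ‖w‖ → ‖W - w ^ 2‖ ≤ k * √‖torsionForm t z w‖)

lemma norm_step_snd (t z w : ℂ) : ‖(step t (z, w)).2‖ = 4 * ‖torsionForm t z w‖ := by
  rw [torsionForm, ← Complex.norm_ofNat 4, ← norm_mul, step]
  ring_nf

lemma norm_step_sub (t z w : ℂ) : ‖(step t (z, w)).1 - t * (step t (z, w)).2‖ =
    ‖z ^ 2 - 2 * t * z * w + t * w ^ 2‖ ^ 2 := by
  rw [← norm_pow]
  congr 1
  simp only [step]; ring

lemma FlatBound.step {t z w W : ℂ} {δ L ρ κ C k : ℝ} (hρδ : ρ ≤ δ / 2) (hL : 1 ≤ L)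
    (ht0 : δ ≤ ‖t‖) (ht1 : δ ≤ ‖1 - t‖) (htL : ‖t‖ ≤ L) (hδ : 0 < δ) (hρ : 0 < ρ) (hC : 0 ≤ C)
    (hκ : 0 < κ) (hρ2 : 96 * ρ ^ 2 * L ^ 2 ≤ δ ^ 4) (hC1 : 1 ≤ C ^ 2 * ρ ^ 3)
    (hC2 : 1600 * L ^ 2 * ρ ≤ C ^ 2 * δ ^ 6)
    (hC3 : 1024 * 512 * L ^ 5 ≤ C ^ 2 * δ ^ 2 * κ ^ 3)
    (hstep : κ * ‖(z, w)‖ ^ 4 ≤ ‖step t (z, w)‖) (h : FlatBound ρ k t z w W) :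
    FlatBound ρ (2 * k + C) t (Lattes.step t (z, w)).1 (Lattes.step t (z, w)).2
      (4 * (t * w ^ 2 - z ^ 2) * (z ^ 2 - 2 * z * w + t * w ^ 2) *
        (-(z ^ 2 - 2 * t * z * w + t * w ^ 2) * W + z * w ^ 2 * (w - z))) := by
  set h0 := √‖torsionForm t z w‖ with hh0
  have hh : 0 ≤ h0 := Real.sqrt_nonneg _
  unfold FlatBound
  rw [sqrt_torsionForm_step, norm_step_sub, norm_step_snd, ← hh0]
  set x := t * w ^ 2 - z ^ 2 with hx
  set y := z ^ 2 - 2 * z * w + t * w ^ 2 with hy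
  set q := z ^ 2 - 2 * t * z * w + t * w ^ 2 with hq
  have key : ∀ V E : ℂ, ‖V‖ ≤ k * h0 → 2 * ‖E‖ ≤ C * (‖x‖ * ‖y‖ * ‖q‖) * h0 →
      ‖4 * (x * y * q) * V + 4 * E‖ ≤ (2 * k + C) * (2 * (‖x‖ * ‖y‖ * ‖q‖) * h0) := by
    intro V E hV hE
    calc _ ≤ 4 * (‖x‖ * ‖y‖ * ‖q‖) * ‖V‖ + 4 * ‖E‖ := by
          refine (norm_add_le _ _).trans ?_
          simp only [norm_mul, Complex.norm_ofNat]
          exact le_rfl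
      _ ≤ 4 * (‖x‖ * ‖y‖ * ‖q‖) * (k * h0) + 2 * (C * (‖x‖ * ‖y‖ * ‖q‖) * h0) := by
          have := mul_le_mul_of_nonneg_left hV (show 0 ≤ 4 * (‖x‖ * ‖y‖ * ‖q‖) by positivity)
          linarith
      _ = _ := by ring
  have hxy : 0 ≤ ‖x‖ * ‖y‖ := by positivity
  refine ⟨fun hfar' => ?_, fun hnear' => ?_⟩
  · have hfar'' : 4 * ρ * ‖torsionForm t z w‖ ≤ ‖q‖ ^ 2 := by linarith
    rcases le_or_gt (ρ * ‖w‖) ‖z - t * w‖ with hfar | hnear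
    · have hb := far_far_bound hρ hC hC1 hfar hfar''
      rw [← hq, ← hh0] at hb
      convert key (-W) (x * y * (z * w ^ 2 * (w - z))) (by rw [norm_neg]; exact h.1 hfar) ?_
        using 2
      · ring
      · rw [norm_mul, norm_mul x]
        calc _ = ‖x‖ * ‖y‖ * (2 * ‖z * w ^ 2 * (w - z)‖) := by ring
          _ ≤ ‖x‖ * ‖y‖ * (C * ‖q‖ * h0) := by gcongr
          _ = _ := by ring
    · have hb := near_far_bound hρδ hL ht0 ht1 htL hδ hC hC2 hnear
      rw [← hq, ← hh0] at hb
      convert key (-(W - w ^ 2)) (x * y * (-(w ^ 2 * ((2 * z - w) * (z - t * w)))))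
        (by rw [norm_neg]; exact h.2 hnear) ?_ using 2
      · rw [hq]; ring
      · rw [norm_mul, norm_mul x, norm_neg, norm_mul (w ^ 2), norm_pow]
        calc _ = ‖x‖ * ‖y‖ * (2 * (‖w‖ ^ 2 * ‖(2 * z - w) * (z - t * w)‖)) := by ring
          _ ≤ ‖x‖ * ‖y‖ * (C * ‖q‖ * h0) := by gcongr
          _ = _ := by ring
  · have hnear'' : ‖q‖ ^ 2 < 4 * ρ * ‖torsionForm t z w‖ := by linarith
    have hfar : ρ * ‖w‖ ≤ ‖z - t * w‖ := by
      by_contra! hnear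
      have := near_far hρδ hL ht0 ht1 htL hδ hρ hρ2 hnear
      rw [← hq] at this
      linarith
    have hb := far_near_bound hρδ hL ht0 ht1 htL hδ hC hκ hstep hC3 hnear''
    rw [← hx, ← hy, ← hh0] at hb
    convert key (-W) (z * w ^ 2 * (w - z) * (3 * z ^ 2 - (2 + 2 * t) * z * w + t * w ^ 2) * q)
      (by rw [norm_neg]; exact h.1 hfar) ?_ using 2
    · rw [hx, hy, hq]; simp only [Lattes.step]; ring
    · rw [norm_mul, norm_mul (z * w ^ 2 * (w - z))]
      calc _ = ‖q‖ * (2 * (‖z * w ^ 2 * (w - z)‖ *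
            ‖3 * z ^ 2 - (2 + 2 * t) * z * w + t * w ^ 2‖)) := by ring
        _ ≤ ‖q‖ * (C * (‖x‖ * ‖y‖) * h0) := by gcongr
        _ = _ := by ring

lemma FlatBound.norm_le {t z w W : ℂ} {L ρ k : ℝ} (hL : 1 ≤ L) (htL : ‖t‖ ≤ L)
    (hk : 0 ≤ k) (h : FlatBound ρ k t z w W) : ‖W‖ ≤ (4 * L * k + 1) * ‖(z, w)‖ ^ 2 := by
  set R := ‖(z, w)‖ with hR
  have hz : ‖z‖ ≤ R := norm_fst_le (z, w)
  have hw : ‖w‖ ≤ R := norm_snd_le (z, w)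
  have hR0 : 0 ≤ R := norm_nonneg _
  have h1 : √‖torsionForm t z w‖ ≤ 4 * L * R ^ 2 := by
    refine Real.sqrt_le_iff.2 ⟨by positivity, ?_⟩
    have h2 : ‖w - z‖ ≤ 2 * R := (norm_sub_le _ _).trans (by linarith)
    have h3 : ‖z - t * w‖ ≤ 2 * L * R := by
      refine (norm_sub_le _ _).trans ?_
      rw [norm_mul]
      have : ‖t‖ * ‖w‖ ≤ L * R := by gcongr
      nlinarith
    rw [norm_torsionForm]
    calc _ ≤ R * R * (2 * R) * (2 * L * R) := by gcongr
      _ = 4 * L * 1 * R ^ 4 := by ring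
      _ ≤ 4 * L * (4 * L) * R ^ 4 := by gcongr; linarith
      _ = _ := by ring
  have h4 : k * √‖torsionForm t z w‖ ≤ k * (4 * L * R ^ 2) := by gcongr
  have h5 : ‖w‖ ^ 2 ≤ R ^ 2 := by gcongr
  rcases le_or_gt (ρ * ‖w‖) ‖z - t * w‖ with hfar | hnear
  · have := h.1 hfar
    nlinarith [sq_nonneg R]
  · have := h.2 hnear
    have h6 : ‖W‖ ≤ ‖W - w ^ 2‖ + ‖w‖ ^ 2 := by
      rw [← norm_pow]
      calc ‖W‖ = ‖(W - w ^ 2) + w ^ 2‖ := by ring_nf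
        _ ≤ _ := norm_add_le _ _
    linarith

set_option maxHeartbeats 1000000 in
lemma exists_wron_bound {a b : ℂ} (ha0 : a ≠ 0) (ha1 : a ≠ 1) (hab : a ≠ b) :
    ∃ r₀ > 0, ∃ C > 0, ∀ (n : ℕ) (t : ℂ), ‖t - a‖ ≤ r₀ →
      ‖(wron b n).eval t‖ ≤ C * 2 ^ n * ‖orbit t b n‖ ^ 2 := by
  set K := stepBound a + 1 with hK
  obtain ⟨η, hη, hball⟩ := Metric.eventually_nhds_iff.1
    ((continuousAt_stepBound ha0 ha1).eventually_lt continuousAt_const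
      (show stepBound a < K by simp [hK]))
  have ha0' : 0 < ‖a‖ := norm_pos_iff.2 ha0
  have ha1' : 0 < ‖1 - a‖ := norm_pos_iff.2 (sub_ne_zero.2 ha1.symm)
  have hab' : 0 < ‖b - a‖ := norm_pos_iff.2 (sub_ne_zero.2 hab.symm)
  set δ := min 1 (min ‖a‖ (min ‖1 - a‖ ‖b - a‖)) / 2 with hδdef
  have hδ : 0 < δ := by positivity
  have hδ1 : 2 * δ ≤ 1 := by rw [hδdef]; linarith [min_le_left 1 (min ‖a‖ (min ‖1 - a‖ ‖b - a‖))]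
  have hm := min_le_right 1 (min ‖a‖ (min ‖1 - a‖ ‖b - a‖))
  have hδa : 2 * δ ≤ ‖a‖ := by rw [hδdef]; linarith [hm.trans (min_le_left _ _)]
  have hm' := hm.trans (min_le_right _ _)
  have hδ1a : 2 * δ ≤ ‖1 - a‖ := by rw [hδdef]; linarith [hm'.trans (min_le_left _ _)]
  have hδb : 2 * δ ≤ ‖b - a‖ := by rw [hδdef]; linarith [hm'.trans (min_le_right _ _)]
  set L := ‖a‖ + 1 with hLdef
  have hL : 1 ≤ L := by linarith
  set κ := Real.exp (-K) with hκdef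
  have hκ : 0 < κ := Real.exp_pos _
  set ρ := δ ^ 2 / (10 * L) with hρdef
  have hL0 : 0 < L := by linarith
  have hρ : 0 < ρ := by positivity
  have hρδ : ρ ≤ δ / 2 := by
    rw [hρdef, div_le_iff₀ (by positivity)]
    nlinarith
  have hρ2 : 96 * ρ ^ 2 * L ^ 2 ≤ δ ^ 4 := by
    have : ρ * L = δ ^ 2 / 10 := by rw [hρdef]; field_simp
    have e : 96 * ρ ^ 2 * L ^ 2 = 96 * (ρ * L) ^ 2 := by ring
    rw [e, this]
    nlinarith [pow_pos hδ 4]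
  set C := 1 + 1 / ρ ^ 3 + 1600 * L ^ 2 * ρ / δ ^ 6 + 1024 * 512 * L ^ 5 / (δ ^ 2 * κ ^ 3) with hC
  have e1 : 0 < 1 / ρ ^ 3 := by positivity
  have e2 : 0 < 1600 * L ^ 2 * ρ / δ ^ 6 := by positivity
  have e3 : 0 < 1024 * 512 * L ^ 5 / (δ ^ 2 * κ ^ 3) := by positivity
  have hC1 : 1 ≤ C := by linarith
  have hC2 : C ≤ C ^ 2 := by nlinarith
  refine ⟨min δ (η / 2), by positivity, 4 * L * C + 1, by positivity, fun n t ht => ?_⟩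
  have htδ : ‖t - a‖ ≤ δ := ht.trans (min_le_left _ _)
  have hstep : ∀ p, κ * ‖p‖ ^ 4 ≤ ‖Lattes.step t p‖ := by
    intro p
    rcases eq_or_ne p 0 with rfl | hp
    · simp
    have hp0 : 0 < ‖p‖ := norm_pos_iff.2 hp
    have ht0 : t ≠ 0 := by
      rintro rfl
      rw [zero_sub, norm_neg] at htδ
      linarith
    have ht1 : t ≠ 1 := by rintro rfl; linarith
    have hsK : stepBound t < K := hball (by
      rw [dist_eq_norm]; linarith [ht.trans (min_le_right _ _)])
    have h1 := (abs_le.1 ((abs_log_step_sub_le ht0 ht1 hp).trans hsK.le)).1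
    have hs : 0 < ‖Lattes.step t p‖ :=
      norm_pos_iff.2 (step_ne_zero (NormedField.toAbsoluteValue ℂ) two_ne_zero ht0 ht1 hp)
    rw [← Real.log_le_log_iff (by positivity) hs, Real.log_mul hκ.ne' (by positivity), Real.log_pow,
      hκdef, Real.log_exp]
    push_cast
    linarith
  have ht0 : δ ≤ ‖t‖ := by
    have := norm_sub_norm_le a t
    rw [norm_sub_rev] at this
    linarith
  have ht1 : δ ≤ ‖1 - t‖ := by
    have : ‖1 - a‖ ≤ ‖1 - t‖ + ‖t - a‖ := by simpa using norm_add_le (1 - t) (t - a)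
    linarith
  have htb : δ ≤ ‖b - t‖ := by
    have : ‖b - a‖ ≤ ‖b - t‖ + ‖t - a‖ := by simpa using norm_add_le (b - t) (t - a)
    linarith
  have htL : ‖t‖ ≤ L := by
    have : ‖t‖ ≤ ‖t - a‖ + ‖a‖ := by simpa using norm_add_le (t - a) a
    linarith
  have hflat : FlatBound ρ (C * (2 ^ n - 1)) t (orbit t b n).1 (orbit t b n).2
      ((wron b n).eval t) := by
    induction n with
    | zero =>
      simp only [orbit, wron_zero, eval_zero]
      refine ⟨fun _ => by simp, fun h => ?_⟩
      simp only [norm_one, mul_one] at h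
      linarith
    | succ n ih =>
      rw [eval_wron_succ b t n (z := (orbit t b n).1) (w := (orbit t b n).2) rfl]
      have := FlatBound.step hρδ hL ht0 ht1 htL hδ hρ (by linarith) hκ hρ2
        (C := C) ?_ ?_ ?_ (hstep _) ih
      · have e : C * (2 ^ (n + 1) - 1) = 2 * (C * (2 ^ n - 1)) + C := by rw [pow_succ]; ring
        rw [e]
        exact this
      · have : 1 ≤ C * ρ ^ 3 := by
          rw [← div_le_iff₀ (by positivity)]; linarith
        refine this.trans (by gcongr)
      · have : 1600 * L ^ 2 * ρ ≤ C * δ ^ 6 := by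
          rw [← div_le_iff₀ (by positivity)]; linarith
        refine this.trans (by gcongr)
      · have : 1024 * 512 * L ^ 5 ≤ C * (δ ^ 2 * κ ^ 3) := by
          rw [← div_le_iff₀ (by positivity)]; linarith
        refine this.trans ?_
        rw [← mul_assoc]
        gcongr
  have h2n : (1 : ℝ) ≤ 2 ^ n := one_le_pow₀ (by norm_num)
  have hfin := hflat.norm_le hL htL (mul_nonneg (zero_le_one.trans hC1) (sub_nonneg.2 h2n))
  refine hfin.trans ?_
  change _ * ‖orbit t b n‖ ^ 2 ≤ _
  gcongr
  have : 0 ≤ 4 * L * C := by positivity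
  nlinarith

lemma norm_eval_le_two_mul {A B : ℂ[X]} {a : ℂ} {r K : ℝ}
    (hne : ∀ t, ‖t - a‖ ≤ r → A.eval t ≠ 0 ∨ B.eval t ≠ 0)
    (hW : ∀ t, ‖t - a‖ ≤ r → ‖(derivative A * B - A * derivative B).eval t‖ ≤
      K * max ‖A.eval t‖ ‖B.eval t‖ ^ 2)
    (hK : 0 ≤ K) (hKr : K * r ≤ 3 / 10) (hdom : ‖B.eval a‖ ≤ ‖A.eval a‖) (t : ℂ)
    (ht : ‖t - a‖ ≤ r) : ‖B.eval t‖ ≤ 2 * ‖A.eval t‖ := by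
  set v := t - a with hv
  set f : ℝ → ℂ := fun s => A.eval (a + s * v) with hf
  set g : ℝ → ℂ := fun s => B.eval (a + s * v) with hg
  set f' : ℝ → ℂ := fun s => (derivative A).eval (a + s * v) * v with hf'
  set g' : ℝ → ℂ := fun s => (derivative B).eval (a + s * v) * v with hg'
  have hlin : ∀ s : ℝ, HasDerivAt (fun s : ℝ => a + (s : ℂ) * v) v s := fun s => by
    simpa using ((Complex.ofRealCLM.hasDerivAt (x := s)).mul_const v).const_add a
  have hfd : ∀ s, HasDerivAt f (f' s) s := fun s => (A.hasDerivAt _).comp s (hlin s)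
  have hgd : ∀ s, HasDerivAt g (g' s) s := fun s => (B.hasDerivAt _).comp s (hlin s)
  have hpos : ∀ s ∈ Set.Icc (0 : ℝ) 1, 0 < ‖f s‖ ^ 2 + ‖g s‖ ^ 2 ∧
      ‖f' s * g s - f s * g' s‖ ≤ 3 / 10 * (‖f s‖ ^ 2 + ‖g s‖ ^ 2) := by
    intro s hs
    have hd : ‖a + s * v - a‖ ≤ r := by
      rw [add_sub_cancel_left, norm_mul, Complex.norm_real, Real.norm_of_nonneg hs.1]
      exact (mul_le_of_le_one_left (norm_nonneg _) hs.2).trans ht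
    refine ⟨?_, ?_⟩
    · rcases hne _ hd with h | h
      · have : 0 < ‖f s‖ := norm_pos_iff.2 h
        positivity
      · have : 0 < ‖g s‖ := norm_pos_iff.2 h
        positivity
    · have h1 := hW _ hd
      have e : f' s * g s - f s * g' s =
          (derivative A * B - A * derivative B).eval (a + s * v) * v := by
        simp only [hf, hg, hf', hg', eval_sub, eval_mul]; ring
      have h2 : max ‖f s‖ ‖g s‖ ^ 2 ≤ ‖f s‖ ^ 2 + ‖g s‖ ^ 2 := by
        rcases max_choice ‖f s‖ ‖g s‖ with h | h <;> rw [h] <;>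
          nlinarith [sq_nonneg ‖f s‖, sq_nonneg ‖g s‖]
      rw [e, norm_mul]
      calc _ ≤ K * max ‖f s‖ ‖g s‖ ^ 2 * r := by gcongr
        _ = K * r * max ‖f s‖ ‖g s‖ ^ 2 := by ring
        _ ≤ _ := by gcongr
  set ψ : ℝ → ℝ := fun s => ‖g s‖ ^ 2 / (‖f s‖ ^ 2 + ‖g s‖ ^ 2) with hψ
  have hψd : ∀ s ∈ Set.Icc (0 : ℝ) 1, HasDerivAt ψ
      ((2 * inner ℝ (g s) (g' s) * (‖f s‖ ^ 2 + ‖g s‖ ^ 2) -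
        ‖g s‖ ^ 2 * (2 * inner ℝ (f s) (f' s) + 2 * inner ℝ (g s) (g' s))) /
          (‖f s‖ ^ 2 + ‖g s‖ ^ 2) ^ 2) s := fun s hs =>
    (hgd s).norm_sq.div ((hfd s).norm_sq.add (hgd s).norm_sq) (hpos s hs).1.ne'
  have hbound : ∀ s ∈ Set.Icc (0 : ℝ) 1, ‖(2 * inner ℝ (g s) (g' s) * (‖f s‖ ^ 2 + ‖g s‖ ^ 2) -
        ‖g s‖ ^ 2 * (2 * inner ℝ (f s) (f' s) + 2 * inner ℝ (g s) (g' s))) /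
          (‖f s‖ ^ 2 + ‖g s‖ ^ 2) ^ 2‖ ≤ 3 / 10 := by
    intro s hs
    obtain ⟨h1, h2⟩ := hpos s hs
    have e : 2 * inner ℝ (g s) (g' s) * (‖f s‖ ^ 2 + ‖g s‖ ^ 2) -
        ‖g s‖ ^ 2 * (2 * inner ℝ (f s) (f' s) + 2 * inner ℝ (g s) (g' s)) =
        -(2 * (starRingEnd ℂ (f s * g s) * (f' s * g s - f s * g' s)).re) := by
      simp only [Complex.inner, ← Complex.normSq_eq_norm_sq, Complex.normSq_apply, Complex.mul_re,
        Complex.mul_im, Complex.conj_re, Complex.conj_im, Complex.sub_re, Complex.sub_im, map_mul]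
      ring
    rw [e, norm_div, norm_neg, Real.norm_of_nonneg (sq_nonneg (‖f s‖ ^ 2 + ‖g s‖ ^ 2)),
      div_le_iff₀ (by positivity), norm_mul, Real.norm_ofNat]
    calc 2 * ‖(starRingEnd ℂ (f s * g s) * (f' s * g s - f s * g' s)).re‖
        ≤ 2 * ‖starRingEnd ℂ (f s * g s) * (f' s * g s - f s * g' s)‖ := by
          gcongr; exact Complex.abs_re_le_norm _
      _ = 2 * ‖f s‖ * ‖g s‖ * ‖f' s * g s - f s * g' s‖ := by
          rw [norm_mul, RCLike.norm_conj, norm_mul]; ring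
      _ ≤ (‖f s‖ ^ 2 + ‖g s‖ ^ 2) * (3 / 10 * (‖f s‖ ^ 2 + ‖g s‖ ^ 2)) := by
          gcongr
          exact two_mul_le_add_sq _ _
      _ = _ := by ring
  have hmv := norm_image_sub_le_of_norm_deriv_le_segment_01'
    (fun s hs => (hψd s hs).hasDerivWithinAt) (fun s hs => hbound s ⟨hs.1, hs.2.le⟩)
  have h01 := (abs_le.1 (Real.norm_eq_abs _ ▸ hmv)).2
  have hf0 : f 0 = A.eval a := by simp [hf]
  have hg0 : g 0 = B.eval a := by simp [hg]
  have hf1 : f 1 = A.eval t := by simp [hf, hv]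
  have hg1 : g 1 = B.eval t := by simp [hg, hv]
  have hψ0 : ψ 0 ≤ 1 / 2 := by
    simp only [hψ]
    rw [div_le_iff₀ (hpos 0 (by simp)).1, hf0, hg0]
    have : ‖B.eval a‖ ^ 2 ≤ ‖A.eval a‖ ^ 2 := by gcongr
    linarith
  have hψ1 : ψ 1 ≤ 4 / 5 := by linarith
  simp only [hψ] at hψ1
  rw [div_le_iff₀ (hpos 1 (by simp)).1, hf1, hg1] at hψ1
  refine le_of_sq_le_sq ?_ (by positivity)
  nlinarith

lemma exists_dominant {A B : ℂ[X]} {a : ℂ} {r K : ℝ}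
    (hne : ∀ t, ‖t - a‖ ≤ r → A.eval t ≠ 0 ∨ B.eval t ≠ 0)
    (hW : ∀ t, ‖t - a‖ ≤ r → ‖(derivative A * B - A * derivative B).eval t‖ ≤
      K * max ‖A.eval t‖ ‖B.eval t‖ ^ 2)
    (hK : 0 ≤ K) (hKr : K * r ≤ 3 / 10) : ∃ f : ℂ[X], ∀ t, ‖t - a‖ ≤ r → f.eval t ≠ 0 ∧
      ‖f.eval t‖ ≤ max ‖A.eval t‖ ‖B.eval t‖ ∧ max ‖A.eval t‖ ‖B.eval t‖ ≤ 2 * ‖f.eval t‖ := by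
  rcases le_total ‖B.eval a‖ ‖A.eval a‖ with h | h
  · have H := norm_eval_le_two_mul hne hW hK hKr h
    refine ⟨A, fun t ht => ⟨fun h0 => ?_, le_max_left _ _, max_le ?_ (H t ht)⟩⟩
    · have := H t ht
      rw [h0, norm_zero, mul_zero, norm_le_zero_iff] at this
      simpa [h0, this] using hne t ht
    · linarith [norm_nonneg (A.eval t)]
  · have H := norm_eval_le_two_mul (fun t ht => (hne t ht).symm) (fun t ht => by
      have e : derivative B * A - B * derivative A =
        -(derivative A * B - A * derivative B) := by ring
      rw [e, eval_neg, norm_neg, max_comm]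
      exact hW t ht) hK hKr h
    refine ⟨B, fun t ht => ⟨fun h0 => ?_, le_max_right _ _, max_le (H t ht) ?_⟩⟩
    · have := H t ht
      rw [h0, norm_zero, mul_zero, norm_le_zero_iff] at this
      simpa [h0, this] using hne t ht
    · linarith [norm_nonneg (B.eval t)]

lemma norm_eval_le_of_sphere {Q f : ℂ[X]} {a : ℂ} {r M : ℝ} (hr : 0 < r)
    (hf : ∀ t, ‖t - a‖ ≤ r → f.eval t ≠ 0)
    (hQ : ∀ t, ‖t - a‖ = r → ‖Q.eval t‖ ≤ M * ‖f.eval t‖) : ‖Q.eval a‖ ≤ M * ‖f.eval a‖ := by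
  have hb := Complex.norm_le_of_forall_mem_frontier_norm_le (U := Metric.ball a r)
    (f := fun t => Q.eval t / f.eval t) (C := M) Metric.isBounded_ball
    (DifferentiableOn.diffContOnCl (fun t ht => by
      rw [closure_ball a hr.ne', Metric.mem_closedBall, dist_eq_norm] at ht
      exact (Q.differentiableAt.div f.differentiableAt (hf t ht)).differentiableWithinAt))
    (fun t ht => by
      rw [frontier_ball a hr.ne', mem_sphere_iff_norm] at ht
      rw [norm_div, div_le_iff₀ (norm_pos_iff.2 (hf t ht.le))]
      exact hQ t ht) (subset_closure (Metric.mem_ball_self hr))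
  rwa [norm_div, div_le_iff₀ (norm_pos_iff.2 (hf a (by simpa using hr.le)))] at hb

set_option maxHeartbeats 1000000 in
theorem not_green_sub_const {a b : ℂ} (ha0 : a ≠ 0) (ha1 : a ≠ 1) (hb0 : b ≠ 0) (hb1 : b ≠ 1)
    (hab : a ≠ b) {g : ℝ} (hg : ∀ t, t ≠ 0 → t ≠ 1 → green b t = green a t + g) : False := by
  obtain ⟨r₀, hr₀, C, hC, hW⟩ := exists_wron_bound ha0 ha1 hab
  set K := stepBound a + 1 with hK
  obtain ⟨η, hη, hball⟩ := Metric.eventually_nhds_iff.1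
    (((continuousAt_stepBound ha0 ha1).eventually_lt continuousAt_const
      (show stepBound a < K by simp [hK])).and
      ((isOpen_ne.eventually_mem ha0).and (isOpen_ne.eventually_mem ha1)))
  set c := min 1 (min r₀ (min (η / 2) (3 / 10 / C))) with hc
  have hc0 : 0 < c := by positivity
  have hcr : c ≤ r₀ := (min_le_right _ _).trans (min_le_left _ _)
  have hcη : c ≤ η / 2 := (min_le_right _ _).trans ((min_le_right _ _).trans (min_le_left _ _))
  have hcC : c ≤ 3 / 10 / C :=
    (min_le_right _ _).trans ((min_le_right _ _).trans (min_le_right _ _))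
  have hcomp : ∀ n t, ‖t - a‖ ≤ c →
      Real.log ‖orbit t a n‖ ≤ Real.log ‖orbit t b n‖ - 4 ^ n * g + 2 * K ∧
      Real.log ‖orbit t b n‖ ≤ Real.log ‖orbit t a n‖ + 4 ^ n * g + 2 * K := by
    intro n t ht
    obtain ⟨hs, ht0, ht1⟩ := hball (show dist t a < η by rw [dist_eq_norm]; linarith)
    have e1 := abs_le.1 ((abs_log_orbit_sub_green_le ha0 ha1 ht0 ht1 n).trans hs.le)
    have e2 := abs_le.1 ((abs_log_orbit_sub_green_le hb0 hb1 ht0 ht1 n).trans hs.le)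
    rw [hg t ht0 ht1] at e2
    constructor <;> linarith
  have hexp : ∀ {x y d : ℝ}, 0 < x → 0 < y → Real.log x ≤ Real.log y + d → x ≤ Real.exp d * y := by
    intro x y d hx hy h
    rw [← Real.log_le_log_iff hx (by positivity), Real.log_mul (Real.exp_pos _).ne' hy.ne',
      Real.log_exp]
    linarith
  set E := ‖a * (1 - a)‖ * (2 * Real.exp (4 * K) / c) with hE
  have hmain : ∀ n : ℕ, (4 : ℝ) ^ (n + 1) ≤ E * 2 ^ (n + 1) := by
    intro n
    set r := c / 2 ^ (n + 1) with hr
    have hr0 : 0 < r := by positivity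
    have hrc : r ≤ c := div_le_self hc0.le (one_le_pow₀ (by norm_num))
    have hne : ∀ {x : ℂ} (_ : x ≠ 0) (_ : x ≠ 1) (t : ℂ) (n : ℕ), 0 < ‖orbit t x n‖ :=
      fun hx0 hx1 t n => norm_pos_iff.2 (orbit_ne_zero' hx0 hx1 n)
    obtain ⟨f, hf⟩ := exists_dominant (A := num b (n + 1)) (B := den b (n + 1)) (a := a)
      (r := r) (K := C * 2 ^ (n + 1)) (fun t _ => by
        by_contra! h
        refine orbit_ne_zero' (t := t) hb0 hb1 (n + 1) (Prod.ext ?_ ?_)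
        · rw [← eval_num, h.1]; rfl
        · rw [← eval_den, h.2]; rfl)
      (fun t ht => by
        rw [← norm_orbit_eq]; exact hW (n + 1) t (ht.trans (hrc.trans hcr)))
      (by positivity) (by
        rw [hr]
        calc C * 2 ^ (n + 1) * (c / 2 ^ (n + 1)) = c * C := by field_simp
          _ ≤ 3 / 10 / C * C := by gcongr
          _ = _ := by field_simp)
    simp only [← norm_orbit_eq] at hf
    obtain ⟨Q, hQ⟩ : (X - Polynomial.C a) ∣ den a (n + 1) := dvd_iff_isRoot.2 (by
      rw [IsRoot, eval_den, orbit_self_den])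
    have hQa : (derivative (den a (n + 1))).eval a = Q.eval a := by
      rw [hQ, derivative_mul]; simp
    have hd := derivative_den_self a n
    rw [hQa] at hd
    set M := 2 * Real.exp (-(4 ^ (n + 1) * g) + 2 * K) / r with hM
    have hbd := norm_eval_le_of_sphere (Q := Q) (f := f) (a := a) (M := M) hr0
      (fun t ht => (hf t ht).1) (fun t ht => by
        have h1 : r * ‖Q.eval t‖ ≤ ‖orbit t a (n + 1)‖ := by
          rw [norm_orbit_eq]
          refine le_trans (le_of_eq ?_) (le_max_right _ _)
          rw [hQ, eval_mul, norm_mul, eval_sub, eval_X, eval_C, ht]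
        have h2 := hexp (hne ha0 ha1 t (n + 1)) (hne hb0 hb1 t (n + 1))
          (d := -(4 ^ (n + 1) * g) + 2 * K)
          (by linarith [(hcomp (n + 1) t (ht.le.trans hrc)).1])
        have h3 := (hf t ht.le).2.2
        rw [hM, div_mul_eq_mul_div, le_div_iff₀ hr0]
        calc _ = r * ‖Q.eval t‖ := mul_comm _ _
          _ ≤ _ := h1
          _ ≤ _ := h2
          _ ≤ Real.exp (-(4 ^ (n + 1) * g) + 2 * K) * (2 * ‖f.eval t‖) := by gcongr
          _ = _ := by ring)
    have haa : ‖a - a‖ ≤ r := by simpa using hr0.le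
    have h4 := hexp (hne hb0 hb1 a (n + 1)) (hne ha0 ha1 a (n + 1))
      (d := 4 ^ (n + 1) * g + 2 * K) (by linarith [(hcomp (n + 1) a (haa.trans hrc)).2])
    have h5 : ‖orbit a a (n + 1)‖ = ‖(num a (n + 1)).eval a‖ := by
      rw [norm_orbit_eq, eval_den, orbit_self_den, norm_zero, max_eq_left (norm_nonneg _)]
    have hnum : 0 < ‖(num a (n + 1)).eval a‖ := h5 ▸ hne ha0 ha1 a (n + 1)
    have h6 : ‖Q.eval a‖ ≤ 2 * Real.exp (4 * K) / r * ‖(num a (n + 1)).eval a‖ := by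
      calc _ ≤ M * ‖f.eval a‖ := hbd
        _ ≤ M * (Real.exp (4 ^ (n + 1) * g + 2 * K) * ‖orbit a a (n + 1)‖) := by
            have : 0 ≤ M := by positivity
            gcongr
            exact (hf a haa).2.1.trans h4
        _ = _ := by
            rw [h5, hM]
            have : Real.exp (4 * K) = Real.exp (-(4 ^ (n + 1) * g) + 2 * K) *
                Real.exp (4 ^ (n + 1) * g + 2 * K) := by
              rw [← Real.exp_add]; ring_nf
            rw [this]; ring
    have h7 := congrArg norm hd
    rw [norm_mul, norm_mul (4 ^ (n + 1)), norm_pow, Complex.norm_ofNat] at h7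
    refine le_of_mul_le_mul_right ?_ hnum
    rw [← h7]
    calc _ ≤ ‖a * (1 - a)‖ * (2 * Real.exp (4 * K) / r * ‖(num a (n + 1)).eval a‖) := by gcongr
      _ = _ := by rw [hE, hr]; field_simp
  obtain ⟨n, hn⟩ := pow_unbounded_of_one_lt E (by norm_num : (1 : ℝ) < 2)
  have h1 := hmain n
  have e : (4 : ℝ) ^ (n + 1) = 2 ^ (n + 1) * 2 ^ (n + 1) := by rw [← mul_pow]; norm_num
  rw [e] at h1
  have h2 := le_of_mul_le_mul_right h1 (by positivity)
  have h3 : (2 : ℝ) ^ n ≤ 2 ^ (n + 1) := pow_le_pow_right₀ (by norm_num) (Nat.le_succ n)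
  linarith

lemma iterate_lattesLift (t c : ℂ) (n : ℕ) : (LattesLift t 1)^[n] (c, 1) = orbit t c n := by
  induction n with
  | zero => rfl
  | succ n ih =>
    rw [Function.iterate_succ_apply', ih]
    simp only [LattesLift, orbit, step, one_mul, mul_one]

lemma per_of_lattesPreperiodic {t c : ℂ} (h : LattesPreperiodic t (c, 1)) : Per t c := by
  simpa only [LattesPreperiodic, Per, iterate_lattesLift] using h

end Lattes

/-- Masser–Zannier, dynamical form: for distinct algebraic `a, b ∉ {0,1}`, there are only
finitely many `t ∈ ℂ \ {0,1}` for which both `(a,1)` and `(b,1)` are preperiodic for the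
Lattès map `F_t`. -/
theorem masser_zannier_dynamical (a b : ℂ) (haAlg : IsAlgebraic ℚ a) (hbAlg : IsAlgebraic ℚ b)
    (hab : a ≠ b) (ha0 : a ≠ 0) (ha1 : a ≠ 1) (hb0 : b ≠ 0) (hb1 : b ≠ 1) :
    {t : ℂ | t ≠ 0 ∧ t ≠ 1 ∧ LattesPreperiodic t (a, 1) ∧ LattesPreperiodic t (b, 1)}.Finite := by
  by_contra hinf
  set K := IntermediateField.adjoin ℚ ({a, b} : Set ℂ)
  have : FiniteDimensional ℚ K := IntermediateField.finiteDimensional_adjoin (by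
    rintro x (rfl | rfl)
    exacts [haAlg.isIntegral, hbAlg.isIntegral])
  have : NumberField K := { }
  let a' : K := ⟨a, IntermediateField.subset_adjoin ℚ _ (by simp)⟩
  let b' : K := ⟨b, IntermediateField.subset_adjoin ℚ _ (by simp)⟩
  have hne : ∀ {x y : K}, (x : ℂ) ≠ y → x ≠ y := fun h e => h (congrArg _ e)
  have hle : ∀ {p₁ p₂ : ℂ}, p₁ ≠ 0 → p₁ ≠ 1 → p₂ ≠ 0 → p₂ ≠ 1 →
      Lattes.green b p₂ - Lattes.green b p₁ ≤ Lattes.green a p₂ - Lattes.green a p₁ :=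
    fun h10 h11 h20 h21 => Lattes.green_sub_le (K := K) (a := a') (b := b')
      (hne ha0) (hne ha1) (hne hb0) (hne hb1) hinf
      (fun t ht => ⟨ht.1, ht.2.1, Lattes.per_of_lattesPreperiodic ht.2.2.1,
        Lattes.per_of_lattesPreperiodic ht.2.2.2⟩) h10 h11 h20 h21
  refine Lattes.not_green_sub_const ha0 ha1 hb0 hb1 hab
    (g := Lattes.green b 2 - Lattes.green a 2) fun t ht0 ht1 => ?_
  have h1 := hle (p₁ := 2) (p₂ := t) (by norm_num) (by norm_num) ht0 ht1
  have h2 := hle (p₁ := t) (p₂ := 2) ht0 ht1 (by norm_num) (by norm_num)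
  linarith
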